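/- Let m ≥ 1 be an integer and write m = 2^{4q+r} s with integers q ≥ 0, 0 ≤ r ≤ 3, and s odd. If n' > 8q + 2^r, then for ANY real m×m matrices M_1, …, M_{n'}, there exists λ = (λ_1, …, λ_{n'}) ∈ ℝ^{n'} \ {0} such that the matrix λ_1 M_1 + ⋯ + λ_{n'} M_{n'} is singular (has determinant zero). -/

import Mathlib

namespace RadonHurwitz

open scoped MatrixOrder ComplexOrder Kronecker Matrix

section Sign

variable {ι : Type*} [Fintype ι] [DecidableEq ι]

/-- `S` is the sign (the unitary part of the polar decomposition) of the Hermitian matrix `H`. -/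
structure IsSign (S H : Matrix ι ι ℂ) : Prop where
  isHermitian : S.IsHermitian
  isHermitian_right : H.IsHermitian
  mul_self : S * S = 1
  posDef : (S * H).PosDef

theorem exists_isSign {H : Matrix ι ι ℂ} (hH : H.IsHermitian) (hdet : H.det ≠ 0) :
    ∃ S, IsSign S H ∧ ∃ N : ℕ, S.trace = Fintype.card ι - 2 * N ∧ 0 < (-1) ^ N * H.det := by
  classical
  set U : Matrix ι ι ℂ := (hH.eigenvectorUnitary : Matrix ι ι ℂ) with hU
  have hUU : star U * U = 1 := Unitary.coe_star_mul_self hH.eigenvectorUnitary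
  have hUU' : U * star U = 1 := Unitary.coe_mul_star_self hH.eigenvectorUnitary
  set l := hH.eigenvalues with hl
  have hspec : H = U * Matrix.diagonal (fun i => (l i : ℂ)) * star U := by
    conv_lhs => rw [hH.spectral_theorem, Unitary.conjStarAlgAut_apply]
    rfl
  have hd := hH.det_eq_prod_eigenvalues
  have hl0 : ∀ i, l i ≠ 0 := by
    intro i hi
    apply hdet
    rw [hd]
    exact Finset.prod_eq_zero (Finset.mem_univ i) (by simp [← hl, hi])
  set e : ι → ℝ := fun i => if l i < 0 then -1 else 1 with he
  have he2 : ∀ i, e i * e i = 1 := fun i => by simp only [he]; split_ifs <;> norm_num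
  have hel : ∀ i, 0 < e i * l i := fun i => by
    simp only [he]; split_ifs with h
    · linarith
    · have := lt_of_le_of_ne (not_lt.mp h) (hl0 i).symm
      linarith
  refine ⟨U * Matrix.diagonal (fun i => (e i : ℂ)) * star U, ⟨?_, hH, ?_, ?_⟩, ?_⟩
  · rw [Matrix.IsHermitian, ← Matrix.star_eq_conjTranspose]
    simp only [star_mul, star_star, mul_assoc]
    congr 2
    rw [Matrix.star_eq_conjTranspose, Matrix.diagonal_conjTranspose]
    congr 1
    ext i
    simp
  · calc _ = U * (Matrix.diagonal (fun i => (e i : ℂ)) * (star U * U) *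
        Matrix.diagonal (fun i => (e i : ℂ))) * star U := by simp only [mul_assoc]
      _ = 1 := by
        rw [hUU, mul_one, Matrix.diagonal_mul_diagonal]
        have : (fun i => (e i : ℂ) * e i) = fun _ => 1 := by
          ext i; exact_mod_cast he2 i
        rw [this, Matrix.diagonal_one, mul_one, hUU']
  · have : U * Matrix.diagonal (fun i => (e i : ℂ)) * star U * H =
        U * Matrix.diagonal (fun i => ((e i * l i : ℝ) : ℂ)) * star U := by
      rw [hspec]
      calc _ = U * (Matrix.diagonal (fun i => (e i : ℂ)) * (star U * U) *
          Matrix.diagonal (fun i => (l i : ℂ))) * star U := by simp only [mul_assoc]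
        _ = _ := by
          rw [hUU, mul_one, Matrix.diagonal_mul_diagonal]
          simp
    rw [this]
    rw [Matrix.IsUnit.posDef_star_right_conjugate_iff
      (IsUnit.of_mul_eq_one _ hUU')]
    rw [Matrix.posDef_diagonal_iff]
    intro i
    exact_mod_cast hel i
  · refine ⟨(Finset.univ.filter fun i => l i < 0).card, ?_, ?_⟩
    · rw [Matrix.trace_mul_cycle, hUU, one_mul, Matrix.trace_diagonal]
      have : ∀ i, (e i : ℂ) = 1 - 2 * (if l i < 0 then 1 else 0) := fun i => by
        simp only [he]; split_ifs <;> norm_num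
      simp only [this, Finset.sum_sub_distrib, ← Finset.mul_sum, Finset.sum_boole]
      simp
    · rw [hd]
      have h1 : ((-1 : ℂ)) ^ (Finset.univ.filter fun i => l i < 0).card = ∏ i, (e i : ℂ) := by
        rw [← Finset.prod_const, Finset.prod_filter]
        refine Finset.prod_congr rfl fun i _ => ?_
        simp only [he]; split_ifs <;> simp
      rw [h1, ← Finset.prod_mul_distrib]
      refine Finset.prod_pos fun i _ => ?_
      have := hel i
      rw [hl] at this
      have h2 : (0 : ℂ) < ((e i * hH.eigenvalues i : ℝ) : ℂ) := Complex.zero_lt_real.mpr this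
      rwa [Complex.ofReal_mul] at h2

namespace IsSign

variable {S S' H H' : Matrix ι ι ℂ}

theorem isUnit (h : IsSign S H) : IsUnit S := IsUnit.of_mul_eq_one _ h.mul_self

theorem commute (h : IsSign S H) : S * H = H * S := by
  rw [← h.posDef.isHermitian.eq, Matrix.conjTranspose_mul, h.isHermitian.eq, h.isHermitian_right.eq]

theorem trace_eq (h : IsSign S H) (h' : IsSign S' H') (hp : (S * H' + H' * S).PosDef) :
    S.trace = S'.trace := by
  have hQ : S * (S + S') = (S + S') * S' := by
    rw [mul_add, add_mul, h.mul_self, h'.mul_self, add_comm]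
  have hu : IsUnit (S + S') := by
    rw [← Matrix.mulVec_injective_iff_isUnit]
    refine (injective_iff_map_eq_zero (Matrix.mulVecLin (S + S'))).mpr fun v hv => ?_
    by_contra hv0
    have hv : S *ᵥ v = -(S' *ᵥ v) := by
      rw [Matrix.mulVecLin_apply, Matrix.add_mulVec] at hv
      exact eq_neg_of_add_eq_zero_left hv
    have h1 := hp.dotProduct_mulVec_pos hv0
    have h2 := h'.posDef.dotProduct_mulVec_pos hv0
    have e : star v ⬝ᵥ ((S * H' + H' * S) *ᵥ v) = -(star v ⬝ᵥ ((S' * H') *ᵥ v)) -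
        (star v ⬝ᵥ ((S' * H') *ᵥ v)) := by
      rw [Matrix.add_mulVec, dotProduct_add, h'.commute, sub_eq_add_neg]
      congr 1
      · have : star v ᵥ* S = star (S *ᵥ v) := by
          rw [Matrix.star_mulVec, h.isHermitian.eq]
        have h3 : star v ᵥ* S' = star (S' *ᵥ v) := by
          rw [Matrix.star_mulVec, h'.isHermitian.eq]
        rw [← h'.commute, ← Matrix.mulVec_mulVec, Matrix.dotProduct_mulVec, this, hv,
          ← Matrix.mulVec_mulVec, Matrix.dotProduct_mulVec _ S', h3, star_neg, neg_dotProduct]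
      · rw [← Matrix.mulVec_mulVec, hv, Matrix.mulVec_neg, dotProduct_neg, Matrix.mulVec_mulVec]
    rw [e] at h1
    have h4 := add_pos (add_pos h1 h2) h2
    simp at h4
  obtain ⟨u, hu⟩ := hu
  have : S' = (u⁻¹ : (Matrix ι ι ℂ)ˣ) * S * (u : Matrix ι ι ℂ) := by
    rw [mul_assoc, hu, hQ, ← hu, ← mul_assoc, Units.inv_mul, one_mul]
  rw [this, Matrix.trace_mul_cycle, Units.mul_inv, one_mul]

theorem trace_unique (h : IsSign S H) (h' : IsSign S' H) : S.trace = S'.trace :=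
  h.trace_eq h' (by rw [← h.commute]; exact h.posDef.add h.posDef)

theorem unique (h : IsSign S H) (h' : IsSign S' H) : S = S' := by
  have key : ∀ {T}, IsSign T H → CFC.sqrt (H * H) = T * H := fun {T} hT =>
    CFC.sqrt_unique (by
      calc T * H * (T * H) = T * H * (H * T) := by rw [hT.commute]
        _ = T * (H * H) * T := by simp only [mul_assoc]
        _ = H * H * (T * T) := by
          rw [← mul_assoc, hT.commute, mul_assoc H, hT.commute]; simp only [mul_assoc]
        _ = _ := by rw [hT.mul_self, mul_one]) hT.posDef.posSemidef.nonneg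
  have h1 : S * H = S' * H := by rw [← key h, key h']
  have hu : IsUnit H := by
    have := h.isUnit.mul h.posDef.isUnit
    rwa [← mul_assoc, h.mul_self, one_mul] at this
  exact hu.mul_left_injective h1

theorem det_ne_zero (h : IsSign S H) : H.det ≠ 0 := by
  have := h.isUnit.mul h.posDef.isUnit
  rw [← mul_assoc, h.mul_self, one_mul, Matrix.isUnit_iff_isUnit_det] at this
  exact this.ne_zero

theorem neg (h : IsSign S H) : IsSign (-S) (-H) :=
  ⟨h.isHermitian.neg, h.isHermitian_right.neg, by simp [h.mul_self], by simpa using h.posDef⟩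

/-- Conjugation by a unitary. -/
theorem conj (h : IsSign S H) {U : Matrix ι ι ℂ} (hU : Uᴴ * U = 1) :
    IsSign (U * S * Uᴴ) (U * H * Uᴴ) := by
  refine ⟨Matrix.isHermitian_mul_mul_conjTranspose _ h.isHermitian,
    Matrix.isHermitian_mul_mul_conjTranspose _ h.isHermitian_right, ?_, ?_⟩
  · calc _ = U * S * (Uᴴ * U) * S * Uᴴ := by simp only [mul_assoc]
      _ = U * (S * S) * Uᴴ := by rw [hU]; simp only [mul_assoc, mul_one]
      _ = 1 := by rw [h.mul_self, mul_one, mul_eq_one_comm.mp hU]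
  · have : U * S * Uᴴ * (U * H * Uᴴ) = U * (S * H) * Uᴴ := by
      calc _ = U * S * (Uᴴ * U) * H * Uᴴ := by simp only [mul_assoc]
        _ = _ := by rw [hU]; simp only [mul_assoc, one_mul]
    rw [this]
    exact (Matrix.IsUnit.posDef_star_right_conjugate_iff
      (IsUnit.of_mul_eq_one_right _ hU)).mpr h.posDef

variable {G : Matrix ι ι ℂ}

theorem conj_involution (h : IsSign S H) (hG : G.IsHermitian) (hGG : G * G = 1) :
    IsSign (G * S * G) (G * H * G) := by
  have := h.conj (U := G) (by rw [hG.eq, hGG])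
  rwa [hG.eq] at this

theorem commute_involution (h : IsSign S H) (hG : G.IsHermitian) (hGG : G * G = 1)
    (hGH : G * H = H * G) : G * S = S * G := by
  have h1 := h.conj_involution hG hGG
  rw [hGH, mul_assoc H, hGG, mul_one] at h1
  have h2 := h1.unique h
  calc G * S = G * S * (G * G) := by rw [hGG, mul_one]
    _ = _ := by rw [← mul_assoc, h2]

theorem mul_involution (h : IsSign S H) (hG : G.IsHermitian) (hGG : G * G = 1)
    (hGH : G * H = H * G) : IsSign (G * S) (G * H) := by
  have hc := h.commute_involution hG hGG hGH
  refine ⟨?_, ?_, ?_, ?_⟩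
  · rw [Matrix.IsHermitian, Matrix.conjTranspose_mul, h.isHermitian.eq, hG.eq, hc]
  · rw [Matrix.IsHermitian, Matrix.conjTranspose_mul, h.isHermitian_right.eq, hG.eq, hGH]
  · calc G * S * (G * S) = S * (G * G) * S := by rw [hc]; simp only [mul_assoc]; rw [← hc]
      _ = 1 := by rw [hGG, mul_one, h.mul_self]
  · have : G * S * (G * H) = S * H := by
      calc _ = S * (G * G) * H := by rw [hc]; simp only [mul_assoc]
        _ = _ := by rw [hGG, mul_one]
    rw [this]; exact h.posDef

theorem trace_eq_zero_of_anticommute (h : IsSign S H) (hG : G.IsHermitian) (hGG : G * G = 1)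
    (hGH : G * H = -(H * G)) : S.trace = 0 := by
  have h1 := h.conj_involution hG hGG
  rw [hGH, neg_mul, mul_assoc H, hGG, mul_one] at h1
  have h2 := h1.unique h.neg
  have h3 : (G * S * G).trace = S.trace := by rw [Matrix.trace_mul_cycle, hGG, one_mul]
  rw [h2, Matrix.trace_neg] at h3
  exact self_eq_neg.mp h3.symm

theorem one_kronecker (h : IsSign S H) (κ : Type*) [Fintype κ] [DecidableEq κ] :
    IsSign ((1 : Matrix κ κ ℂ) ⊗ₖ S) ((1 : Matrix κ κ ℂ) ⊗ₖ H) := by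
  refine ⟨?_, ?_, ?_, ?_⟩
  · rw [Matrix.IsHermitian, Matrix.conjTranspose_kronecker, h.isHermitian.eq,
      Matrix.conjTranspose_one]
  · rw [Matrix.IsHermitian, Matrix.conjTranspose_kronecker, h.isHermitian_right.eq,
      Matrix.conjTranspose_one]
  · rw [← Matrix.mul_kronecker_mul, h.mul_self, one_mul, Matrix.one_kronecker_one]
  · rw [← Matrix.mul_kronecker_mul, one_mul]
    exact Matrix.PosDef.one.kronecker h.posDef

end IsSign

theorem eventually_posDef {A : ℝ → Matrix ι ι ℂ} (hA : Continuous A)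
    (hH : ∀ t, (A t).IsHermitian) {t : ℝ} (ht : (A t).PosDef) :
    ∀ᶠ u in nhds t, (A u).PosDef := by
  have hK : IsCompact (Metric.sphere (0 : EuclideanSpace ℂ ι) 1) := isCompact_sphere _ _
  have hc : Continuous fun p : ℝ × EuclideanSpace ℂ ι =>
      (star (p.2 : ι → ℂ) ⬝ᵥ (A p.1 *ᵥ (p.2 : ι → ℂ))).re := by
    refine Complex.continuous_re.comp ?_
    have h2 : Continuous fun p : ℝ × EuclideanSpace ℂ ι => (p.2 : ι → ℂ) := by fun_prop
    exact (continuous_star.comp h2).dotProduct ((hA.comp continuous_fst).matrix_mulVec h2)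
  have := hK.eventually_forall_of_forall_eventually (x₀ := t)
    (P := fun u v => 0 < (star (v : ι → ℂ) ⬝ᵥ (A u *ᵥ (v : ι → ℂ))).re) (fun v hv => by
      have hv0 : (v : ι → ℂ) ≠ 0 := fun h0 => by
        have : v = 0 := by ext i; exact congrFun h0 i
        simp [this] at hv
      have hpos : 0 < (star (v : ι → ℂ) ⬝ᵥ (A t *ᵥ (v : ι → ℂ))).re := ht.re_dotProduct_pos hv0
      exact (hc.tendsto (t, v)).eventually_const_lt hpos)
  filter_upwards [this] with u hu
  refine Matrix.PosDef.of_dotProduct_mulVec_pos (hH u) fun x hx => ?_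
  set v : EuclideanSpace ℂ ι := WithLp.toLp 2 x with hv
  have hv0 : v ≠ 0 := fun h => hx (by
    have := congrArg (fun w : EuclideanSpace ℂ ι => (w : ι → ℂ)) h
    simpa [hv] using this)
  have hn : 0 < ‖v‖ := norm_pos_iff.mpr hv0
  have h1 := hu (((‖v‖⁻¹ : ℝ) : ℂ) • v) (by
    rw [mem_sphere_zero_iff_norm, norm_smul, Complex.norm_real, norm_inv, norm_norm,
      inv_mul_cancel₀ hn.ne'])
  have him : (star x ⬝ᵥ (A u *ᵥ x)).im = 0 := by
    have : star (star x ⬝ᵥ (A u *ᵥ x)) = star x ⬝ᵥ (A u *ᵥ x) := by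
      rw [← Matrix.star_dotProduct, Matrix.star_mulVec, (hH u).eq, ← Matrix.dotProduct_mulVec]
    exact Complex.conj_eq_iff_im.mp this
  have h2 : (star (((((‖v‖⁻¹ : ℝ) : ℂ) • v : EuclideanSpace ℂ ι)) : ι → ℂ) ⬝ᵥ
      (A u *ᵥ (((((‖v‖⁻¹ : ℝ) : ℂ) • v : EuclideanSpace ℂ ι)) : ι → ℂ))) =
      ((‖v‖⁻¹ * ‖v‖⁻¹ : ℝ) : ℂ) * (star x ⬝ᵥ (A u *ᵥ x)) := by
    have : ((((((‖v‖⁻¹ : ℝ) : ℂ) • v : EuclideanSpace ℂ ι)) : ι → ℂ)) =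
      ((‖v‖⁻¹ : ℝ) : ℂ) • x := by rw [hv]; rfl
    rw [this, star_smul, Matrix.mulVec_smul, smul_dotProduct, dotProduct_smul, smul_eq_mul,
      smul_eq_mul, ← mul_assoc]
    simp
  rw [h2, Complex.re_ofReal_mul] at h1
  rw [Complex.lt_def]
  refine ⟨?_, him.symm⟩
  exact pos_of_mul_pos_right h1 (by positivity)

theorem trace_sign_eq_of_path {H : ℝ → Matrix ι ι ℂ} (hc : Continuous H)
    (hH : ∀ t, (H t).IsHermitian) (hdet : ∀ t ∈ Set.Icc (0 : ℝ) 1, (H t).det ≠ 0)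
    {S T : Matrix ι ι ℂ} (hS : IsSign S (H 0)) (hT : IsSign T (H 1)) : S.trace = T.trace := by
  have hex : ∀ t, ∃ R : Matrix ι ι ℂ, t ∈ Set.Icc (0 : ℝ) 1 → IsSign R (H t) := fun t => by
    by_cases ht : t ∈ Set.Icc (0 : ℝ) 1
    · obtain ⟨R, hR, -⟩ := exists_isSign (hH t) (hdet t ht)
      exact ⟨R, fun _ => hR⟩
    · exact ⟨0, fun h => absurd h ht⟩
  choose R hR using hex
  have h0 : (0 : ℝ) ∈ Set.Icc (0 : ℝ) 1 := by simp
  have h1 : (1 : ℝ) ∈ Set.Icc (0 : ℝ) 1 := by simp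
  rw [hS.trace_unique (hR 0 h0), hT.trace_unique (hR 1 h1)]
  refine isPreconnected_Icc.induction₂ (fun t u => (R t).trace = (R u).trace) (fun t ht => ?_)
    (fun _ _ _ _ _ _ h₁ h₂ => h₁.trans h₂) (fun _ _ _ _ h => h.symm) h0 h1
  have hsymm : ∀ u, (R t * H u + H u * R t).IsHermitian := fun u => by
    rw [Matrix.IsHermitian, Matrix.conjTranspose_add, Matrix.conjTranspose_mul,
      Matrix.conjTranspose_mul, (hH u).eq, (hR t ht).isHermitian.eq, add_comm]
  have hpos : (R t * H t + H t * R t).PosDef := by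
    rw [← (hR t ht).commute]; exact (hR t ht).posDef.add (hR t ht).posDef
  have hev := eventually_posDef (A := fun u => R t * H u + H u * R t) (by fun_prop) hsymm hpos
  filter_upwards [mem_nhdsWithin_of_mem_nhds hev, self_mem_nhdsWithin] with u hu hu1
  exact (hR t ht).trace_eq (hR u hu1) hu

end Sign

section Pfaffian

theorem isSquare_det_of_skew_field {K : Type*} [Field K] (h2 : (2 : K) ≠ 0) (n : ℕ) :
    ∀ {ι : Type} [Fintype ι] [DecidableEq ι] (A : Matrix ι ι K), Fintype.card ι = n → Aᵀ = -A →
      IsSquare A.det := by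
  induction n using Nat.strong_induction_on with
  | _ n ih =>
  intro ι _ _ A hn hA
  have hskew : ∀ x y, A y x = -A x y := fun x y => congrFun (congrFun hA x) y
  have hdiag : ∀ x, A x x = 0 := fun x => by
    have h := hskew x x
    have : 2 * A x x = 0 := by linear_combination h
    exact (mul_eq_zero.mp this).resolve_left h2
  by_cases h0 : A = 0
  · rcases isEmpty_or_nonempty ι with h | h
    · rw [Matrix.det_isEmpty]; exact IsSquare.one
    · rw [h0, Matrix.det_zero]; exact IsSquare.zero
  obtain ⟨i, j, hij⟩ : ∃ i j, A i j ≠ 0 := by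
    by_contra! h
    exact h0 (by ext i j; exact h i j)
  have hne : i ≠ j := fun h => hij (h ▸ hdiag i)
  let p : ι → Prop := fun x => x = i ∨ x = j
  let e : Fin 2 ≃ {x // p x} :=
    { toFun := fun k => if k = 0 then ⟨i, Or.inl rfl⟩ else ⟨j, Or.inr rfl⟩
      invFun := fun x => if x.1 = i then 0 else 1
      left_inv := fun k => by fin_cases k <;> simp [hne.symm]
      right_inv := fun x => by
        rcases x with ⟨x, rfl | rfl⟩
        · simp
        · simp [hne.symm] }
  let E : Fin 2 ⊕ {x // ¬p x} ≃ ι := (Equiv.sumCongr e (Equiv.refl _)).trans (Equiv.sumCompl p)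
  let B := A.submatrix E E
  have hB : Bᵀ = -B := by ext x y; exact hskew (E x) (E y)
  have hdet : A.det = B.det := (Matrix.det_submatrix_equiv_self E A).symm
  have h11 : B.toBlocks₁₁.det = A i j * A i j := by
    rw [Matrix.det_fin_two]
    have a : B.toBlocks₁₁ 0 0 = A i i := rfl
    have b : B.toBlocks₁₁ 0 1 = A i j := rfl
    have c : B.toBlocks₁₁ 1 0 = A j i := rfl
    have d : B.toBlocks₁₁ 1 1 = A j j := rfl
    rw [a, b, c, d, hdiag, hdiag, hskew i j]
    ring
  have hu : IsUnit B.toBlocks₁₁.det := by rw [h11]; exact (mul_ne_zero hij hij).isUnit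
  let _ := Matrix.invertibleOfIsUnitDet _ hu
  rw [← Matrix.fromBlocks_toBlocks B, Matrix.fromBlocks_transpose, Matrix.fromBlocks_neg,
    Matrix.fromBlocks_inj] at hB
  obtain ⟨hb11, hb21, hb12, hb22⟩ := hB
  rw [hdet, ← Matrix.fromBlocks_toBlocks B, Matrix.det_fromBlocks₁₁, h11]
  refine IsSquare.mul ⟨_, rfl⟩ (ih (Fintype.card {x // ¬p x}) ?_ _ rfl ?_)
  · have h := Fintype.card_congr E
    rw [Fintype.card_sum, Fintype.card_fin] at h
    omega
  · rw [Matrix.transpose_sub, Matrix.transpose_mul, Matrix.transpose_mul, Matrix.invOf_eq_nonsing_inv,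
      Matrix.transpose_nonsing_inv, hb11, hb12, hb21, hb22]
    have : (-B.toBlocks₁₁)⁻¹ = -(B.toBlocks₁₁)⁻¹ := by
      refine Matrix.inv_eq_right_inv ?_
      rw [neg_mul_neg, Matrix.mul_nonsing_inv _ hu]
    rw [this]
    simp only [Matrix.neg_mul, Matrix.mul_neg, neg_neg, Matrix.mul_assoc]
    abel

theorem isSquare_det_of_skew {R : Type*} [CommRing R] [IsDomain R] [IsIntegrallyClosed R]
    (h2 : (2 : R) ≠ 0) {ι : Type} [Fintype ι] [DecidableEq ι] (A : Matrix ι ι R) (hA : Aᵀ = -A) :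
    IsSquare A.det := by
  let K := FractionRing R
  have hinj : Function.Injective (algebraMap R K) := IsFractionRing.injective R K
  obtain ⟨y, hy⟩ := isSquare_det_of_skew_field (K := K) (by
    intro h
    apply h2
    apply hinj
    rw [map_ofNat, h, map_zero]) _ (A.map (algebraMap R K)) rfl (by
      rw [← Matrix.transpose_map, hA]; ext; simp)
  have hd : (A.map (algebraMap R K)).det = algebraMap R K A.det :=
    (RingHom.map_det (algebraMap R K) A).symm
  rw [hd] at hy
  obtain ⟨z, hz⟩ := IsIntegrallyClosed.exists_algebraMap_eq_of_isIntegral_pow (R := R) (x := y)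
    (n := 2) (by norm_num) (by rw [pow_two, ← hy]; exact isIntegral_algebraMap)
  exact ⟨z, hinj (by rw [hy, map_mul, hz])⟩

theorem Polynomial.eq_of_sq_eq {p q : Polynomial ℂ}
    (h : ∀ t : ℝ, p.eval (t : ℂ) * p.eval (t : ℂ) = q.eval (t : ℂ) * q.eval (t : ℂ))
    (h0 : p.eval 0 = q.eval 0) (h1 : p.eval 0 ≠ 0) : p = q := by
  have hpq : p * p = q * q := by
    refine Polynomial.eq_of_infinite_eval_eq _ _ ?_
    refine (Set.infinite_range_of_injective Complex.ofReal_injective).mono ?_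
    rintro _ ⟨t, rfl⟩
    simpa using h t
  rcases mul_self_eq_mul_self_iff.mp hpq with h | h
  · exact h
  · rw [h, Polynomial.eval_neg] at h0 h1
    exact absurd (self_eq_neg.mp h0.symm) (by simpa using h1)

theorem pos_of_continuous_ne_zero {g : ℝ → ℝ} (hg : Continuous g)
    (h : ∀ t ∈ Set.Icc (0 : ℝ) 1, g t ≠ 0) (h0 : 0 < g 0) : ∀ t ∈ Set.Icc (0 : ℝ) 1, 0 < g t := by
  intro t ht
  by_contra hlt
  obtain ⟨x, hx, hx0⟩ := intermediate_value_Icc' ht.1 hg.continuousOn ⟨not_lt.mp hlt, h0.le⟩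
  exact h x ⟨hx.1, hx.2.trans ht.2⟩ hx0

theorem pos_of_continuous_sq_ne_zero {f : ℝ → ℂ} (hf : Continuous f)
    (hne : ∀ t ∈ Set.Icc (0 : ℝ) 1, f t ≠ 0) (hre : ∀ t, (f t * f t).im = 0)
    (h0 : 0 < f 0) : 0 < f 1 := by
  rw [Complex.lt_def] at h0 ⊢
  simp only [Complex.zero_re, Complex.zero_im] at h0 ⊢
  have hsq : ∀ t ∈ Set.Icc (0 : ℝ) 1, 0 < (f t * f t).re := by
    refine pos_of_continuous_ne_zero (by fun_prop) (fun t ht h => ?_) ?_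
    · exact mul_self_ne_zero.mpr (hne t ht) (Complex.ext h (hre t))
    · rw [Complex.mul_re, ← h0.2]; simpa using h0.1.ne'
  have key : ∀ t ∈ Set.Icc (0 : ℝ) 1, (f t).re ≠ 0 := fun t ht h => by
    have := hsq t ht
    rw [Complex.mul_re, h] at this
    nlinarith [mul_self_nonneg (f t).im]
  have h1 : (1 : ℝ) ∈ Set.Icc (0 : ℝ) 1 := by simp
  refine ⟨pos_of_continuous_ne_zero (by fun_prop) key h0.1 1 h1, ?_⟩
  have := hre 1
  rw [Complex.mul_im] at this
  have h2 : (f 1).re * (f 1).im = 0 := by linarith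
  exact ((mul_eq_zero.mp h2).resolve_left (key 1 h1)).symm

variable {ι : Type} [Fintype ι] [DecidableEq ι]

theorem _root_.Matrix.IsHermitian.det_im {A : Matrix ι ι ℂ} (hA : A.IsHermitian) : A.det.im = 0 := by
  have h := Matrix.det_conjTranspose A
  rw [hA.eq] at h
  exact Complex.conj_eq_iff_im.mp h.symm

theorem exists_poly_det_line (A B : Matrix ι ι ℂ) :
    ∃ p : Polynomial ℂ, ∀ t : ℂ, p.eval t = (t • A + (1 - t) • B).det := by
  refine ⟨((Polynomial.X : Polynomial ℂ) • A.map Polynomial.C +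
    (1 - Polynomial.X : Polynomial ℂ) • B.map Polynomial.C).det, fun t => ?_⟩
  rw [← Polynomial.coe_evalRingHom, RingHom.map_det]
  congr 1
  ext i j
  simp
  ring

theorem exists_poly_sq_det_line {A B : Matrix ι ι ℂ} (hA : Aᵀ = -A) (hB : Bᵀ = -B) :
    ∃ p : Polynomial ℂ, ∀ t : ℂ, p.eval t * p.eval t = (t • A + (1 - t) • B).det := by
  obtain ⟨p, hp⟩ := isSquare_det_of_skew (R := Polynomial ℂ) (two_ne_zero)
    ((Polynomial.X : Polynomial ℂ) • A.map Polynomial.C +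
    (1 - Polynomial.X : Polynomial ℂ) • B.map Polynomial.C) (by
      have hA' : ∀ i j, A j i = - A i j := fun i j => congrFun (congrFun hA i) j
      have hB' : ∀ i j, B j i = - B i j := fun i j => congrFun (congrFun hB i) j
      ext1 i j
      simp [hA' i j, hB' i j]; ring)
  refine ⟨p, fun t => ?_⟩
  rw [← Polynomial.eval_mul, ← hp, ← Polynomial.coe_evalRingHom, RingHom.map_det]
  congr 1
  ext i j
  simp
  ring

theorem det_pos_of_quaternionic {h U : Matrix ι ι ℂ} (hh : h.IsHermitian) (hU : Uᵀ = -U)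
    (hUdet : U.det ≠ 0) (hUh : U * hᵀ = h * U) (hdet : h.det ≠ 0) : 0 < h.det := by
  obtain ⟨p, hp⟩ := exists_poly_sq_det_line (A := h * U) (B := U)
    (by rw [Matrix.transpose_mul, hU, neg_mul, hUh]) hU
  have hline : ∀ t : ℂ, p.eval t * p.eval t = (t • h + (1 - t) • (1 : Matrix ι ι ℂ)).det * U.det := by
    intro t
    rw [hp, ← Matrix.det_mul, add_mul, smul_mul_assoc, smul_mul_assoc, one_mul]
  have h00 : p.eval 0 * p.eval 0 = U.det := by simpa using hline 0
  have h0 : p.eval 0 ≠ 0 := fun h => hUdet (by rw [← h00, h, mul_zero])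
  set P : Polynomial ℂ := Polynomial.C (p.eval 0)⁻¹ * p with hP
  have hPsq : ∀ t : ℂ, P.eval t * P.eval t = (t • h + (1 - t) • (1 : Matrix ι ι ℂ)).det := by
    intro t
    simp only [hP, Polynomial.eval_mul, Polynomial.eval_C]
    calc _ = (p.eval t * p.eval t) / (p.eval 0 * p.eval 0) := by field_simp
      _ = _ := by rw [hline, h00, mul_div_cancel_right₀ _ hUdet]
  have hP0 : P.eval 0 = 1 := by simp [hP, h0]
  have hconj : ∀ t : ℝ, (P.map (starRingEnd ℂ)).eval (t : ℂ) = starRingEnd ℂ (P.eval (t : ℂ)) := by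
    intro t
    rw [← Polynomial.eval_map_apply, Complex.conj_ofReal]
  have him : ∀ t : ℝ, starRingEnd ℂ (P.eval (t : ℂ) * P.eval (t : ℂ)) =
      P.eval (t : ℂ) * P.eval (t : ℂ) := by
    intro t
    rw [Complex.conj_eq_iff_im, hPsq]
    refine Matrix.IsHermitian.det_im ?_
    rw [Matrix.IsHermitian, Matrix.conjTranspose_add, Matrix.conjTranspose_smul,
      Matrix.conjTranspose_smul, hh.eq, Matrix.conjTranspose_one]
    simp
  have hreal : P.map (starRingEnd ℂ) = P := Polynomial.eq_of_sq_eq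
    (fun t => by rw [hconj, ← map_mul, him])
    (by have := hconj 0; rw [Complex.ofReal_zero] at this; rw [this, hP0, map_one])
    (by have := hconj 0; rw [Complex.ofReal_zero] at this; rw [this, hP0, map_one]; simp)
  have h1 : starRingEnd ℂ (P.eval 1) = P.eval 1 := by
    have := hconj 1
    rw [hreal, Complex.ofReal_one] at this
    exact this.symm
  obtain ⟨r, hr⟩ := Complex.conj_eq_iff_real.mp h1
  have hd : h.det = ((r * r : ℝ) : ℂ) := by
    have := hPsq 1
    simp only [one_smul, sub_self, zero_smul, add_zero] at this
    rw [← this, hr, Complex.ofReal_mul]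
  rw [hd] at hdet ⊢
  exact Complex.zero_lt_real.mpr (mul_self_pos.mpr fun h => hdet (by simp [h]))

theorem exists_mvPoly_sq_det (A : Fin 3 → Matrix ι ι ℂ) (hA : ∀ i, (A i)ᵀ = -A i) :
    ∃ p : MvPolynomial (Fin 3) ℂ, ∀ v : Fin 3 → ℂ,
      MvPolynomial.eval v p * MvPolynomial.eval v p = (∑ i, v i • A i).det := by
  obtain ⟨p, hp⟩ := isSquare_det_of_skew (R := MvPolynomial (Fin 3) ℂ) (two_ne_zero)
    (∑ i, (MvPolynomial.X i : MvPolynomial (Fin 3) ℂ) • (A i).map MvPolynomial.C) (by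
      ext1 x y
      have h : ∀ i, A i y x = - A i x y := fun i => congrFun (congrFun (hA i) x) y
      simp [Matrix.sum_apply, h])
  refine ⟨p, fun v => ?_⟩
  rw [← map_mul, ← hp, RingHom.map_det]
  congr 1
  ext x y
  simp [Matrix.sum_apply]

/-- The Pfaffian of a real three-parameter family determines the sign of the determinant of the
compression of `H` to the positive eigenspace of `G`. -/
theorem det_pos_of_real {H M G U : Matrix ι ι ℂ} (hH : H.IsHermitian) (hM : M.IsHermitian)
    (hG : G.IsHermitian) (hGG : G * G = 1) (hGH : G * H = H * G) (hMG : M * G = -(G * M))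
    (hU : Uᵀ = U) (hUdet : U.det ≠ 0) (hUH : U * Hᵀ = -(H * U)) (hUM : U * Mᵀ = -(M * U))
    (hUG : U * Gᵀ = -(G * U))
    (hdet : ∀ t ∈ Set.Icc (0 : ℝ) 1, ((1 - t : ℂ) • H + (t : ℂ) • M).det ≠ 0) :
    0 < ((2⁻¹ : ℂ) • (1 + G) * H + (2⁻¹ : ℂ) • (1 - G)).det := by
  have hsk : ∀ {A : Matrix ι ι ℂ}, U * Aᵀ = -(A * U) → (A * U)ᵀ = -(A * U) := fun {A} h => by
    rw [Matrix.transpose_mul, hU, h]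
  obtain ⟨p, hp⟩ := exists_mvPoly_sq_det ![H * U, M * U, G * U] (by
    intro i; fin_cases i
    exacts [hsk hUH, hsk hUM, hsk hUG])
  have hGdet : G.det * G.det = 1 := by rw [← Matrix.det_mul, hGG, Matrix.det_one]
  have hGdet0 : G.det ≠ 0 := fun h => by simp [h] at hGdet
  have hp' : ∀ a b c : ℂ, MvPolynomial.eval ![a, b, c] p * MvPolynomial.eval ![a, b, c] p =
      (a • H + b • M + c • G).det * U.det := by
    intro a b c
    rw [hp, ← Matrix.det_mul]
    simp [Fin.sum_univ_three, add_mul]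
  set w := MvPolynomial.eval ![0, 0, 1] p with hw
  have hww : w * w = G.det * U.det := by simpa using hp' 0 0 1
  have hw0 : w ≠ 0 := fun h => mul_ne_zero hGdet0 hUdet (by rw [← hww, h, mul_zero])
  set P : ℂ → ℂ → ℂ → ℂ := fun a b c => w⁻¹ * MvPolynomial.eval ![a, b, c] p with hPdef
  have hP : ∀ a b c, P a b c * P a b c = (a • H + b • M + c • G).det * G.det := by
    intro a b c
    calc P a b c * P a b c = (MvPolynomial.eval ![a, b, c] p * MvPolynomial.eval ![a, b, c] p) /
          (w * w) := by simp only [hPdef]; field_simp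
      _ = _ := by
        rw [hp', hww, div_eq_iff (mul_ne_zero hGdet0 hUdet)]
        linear_combination -((a • H + b • M + c • G).det * U.det) * hGdet
  have hP001 : P 0 0 1 = 1 := by simp only [hPdef, ← hw]; exact inv_mul_cancel₀ hw0
  have hherm : ∀ a b c : ℝ, ((a : ℂ) • H + (b : ℂ) • M + (c : ℂ) • G).IsHermitian := by
    intro a b c
    simp [Matrix.IsHermitian, Matrix.conjTranspose_add, Matrix.conjTranspose_smul, hH.eq, hM.eq,
      hG.eq]
  have hPim : ∀ a b c : ℝ, (P a b c * P a b c).im = 0 := by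
    intro a b c
    rw [hP, Complex.mul_im, hG.det_im, (hherm a b c).det_im]
    simp
  have hPc : ∀ {a b c : ℝ → ℂ}, Continuous a → Continuous b → Continuous c →
      Continuous fun t => P (a t) (b t) (c t) := by
    intro a b c ha hb hc
    refine continuous_const.mul ((MvPolynomial.continuous_eval p).comp ?_)
    refine continuous_pi fun i => ?_
    fin_cases i
    exacts [ha, hb, hc]
  have hPne : ∀ {a b c : ℂ}, (a • H + b • M + c • G).det ≠ 0 → P a b c ≠ 0 := by
    intro a b c h h0
    have := hP a b c
    rw [h0, mul_zero] at this
    exact mul_ne_zero h hGdet0 this.symm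
  have hP010 : 0 < P 0 1 0 := by
    have := pos_of_continuous_sq_ne_zero (f := fun t : ℝ => P (0 : ℝ) (t : ℝ) ((1 - t : ℝ) : ℝ))
      (hPc (by fun_prop) (by fun_prop) (by fun_prop)) (fun t ht => hPne ?_) (fun t => hPim _ _ _)
      (by simp [hP001])
    · simpa using this
    · rcases eq_or_ne t 1 with rfl | ht1
      · simpa using hdet 1 (by simp)
      · have hs : 0 < (1 - t) * (1 - t) := mul_self_pos.mpr (sub_ne_zero.mpr ht1.symm)
        have hsq : (((0 : ℝ) : ℂ) • H + (t : ℂ) • M + ((1 - t : ℝ) : ℂ) • G) *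
            (((0 : ℝ) : ℂ) • H + (t : ℂ) • M + ((1 - t : ℝ) : ℂ) • G) =
            (((1 - t) * (1 - t) : ℝ) : ℂ) • (1 : Matrix ι ι ℂ) + ((t : ℂ) • M)ᴴ * ((t : ℂ) • M) := by
          simp only [Complex.ofReal_zero, zero_smul, zero_add, add_mul, mul_add, smul_mul_smul,
            hGG, hMG, Matrix.conjTranspose_smul, hM.eq, Complex.star_def, Complex.conj_ofReal,
            Complex.ofReal_mul]
          module
        have hpd := (Matrix.PosDef.one.smul (Complex.zero_lt_real.mpr hs)).add_posSemidef
          (Matrix.posSemidef_conjTranspose_mul_self ((t : ℂ) • M))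
        rw [← hsq] at hpd
        have := hpd.det_pos.ne'
        rw [Matrix.det_mul] at this
        exact left_ne_zero_of_mul this
  have hP100 : 0 < P 1 0 0 := by
    have := pos_of_continuous_sq_ne_zero (f := fun t : ℝ => P (t : ℝ) ((1 - t : ℝ) : ℝ) (0 : ℝ))
      (hPc (by fun_prop) (by fun_prop) (by fun_prop)) (fun t ht => hPne ?_) (fun t => hPim _ _ _)
      (by simp [hP010])
    · simpa using this
    · have := hdet (1 - t) ⟨by linarith [ht.2], by linarith [ht.1]⟩
      simpa using this
  -- the determinant of the compression, along the segment from `G` to `H`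
  set Q₁ : Matrix ι ι ℂ := (2⁻¹ : ℂ) • (1 + G) with hQ₁
  set Q₂ : Matrix ι ι ℂ := (2⁻¹ : ℂ) • (1 - G) with hQ₂
  obtain ⟨q, hq⟩ := exists_poly_det_line (Q₁ * H + Q₂) 1
  have hq0 : q.eval 0 = 1 := by simp [hq]
  let pl : Polynomial ℂ := MvPolynomial.aeval
    ![(Polynomial.X : Polynomial ℂ), 0, 1 - Polynomial.X] p
  have hpl : ∀ t : ℂ, pl.eval t = MvPolynomial.eval ![t, 0, 1 - t] p := by
    intro t
    have : (Polynomial.evalRingHom t).comp ((MvPolynomial.aeval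
        ![(Polynomial.X : Polynomial ℂ), 0, 1 - Polynomial.X] : _ →ₐ[ℂ] Polynomial ℂ) : _ →+* _) =
        MvPolynomial.eval ![t, 0, 1 - t] := by
      refine MvPolynomial.ringHom_ext (fun r => by simp) (fun i => ?_)
      fin_cases i <;> simp
    exact congrArg (fun f => f p) this
  have hPq : Polynomial.C w⁻¹ * pl = q := by
    refine Polynomial.eq_of_sq_eq (fun t => ?_) ?_ ?_
    · have h1 : (Polynomial.C w⁻¹ * pl).eval (t : ℂ) = P t 0 (1 - t) := by
        simp [hPdef, hpl]
      rw [h1, hP, hq]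
      set N : Matrix ι ι ℂ := (t : ℂ) • (Q₁ * H + Q₂) + (1 - t : ℂ) • (1 : Matrix ι ι ℂ) with hN
      set W : Matrix ι ι ℂ := Q₁ + (1 - t : ℂ) • Q₂ - (t : ℂ) • (H * Q₂) with hW
      have hUN : U * Nᵀ = W * U := by
        have e1 : U * (H * G)ᵀ = G * H * U * 1 := by
          rw [Matrix.transpose_mul, ← mul_assoc, hUG, neg_mul, mul_assoc, hUH, mul_neg, neg_neg,
            mul_one, mul_assoc]
        simp only [hN, hW, hQ₁, hQ₂, add_mul, mul_add, sub_mul, mul_sub, Matrix.transpose_add,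
          Matrix.transpose_sub, Matrix.transpose_smul, Matrix.transpose_one, smul_mul_assoc,
          mul_smul_comm, hUH, hUG, one_mul, mul_one, hGH, e1]
        module
      have hNW : N * (W * G) = (t : ℂ) • H + (0 : ℂ) • M + (1 - t : ℂ) • G := by
        have e4 : ∀ A, G * (H * A) = H * (G * A) := fun A => by rw [← mul_assoc, hGH, mul_assoc]
        simp only [hN, hW, hQ₁, hQ₂, add_mul, mul_add, sub_mul, mul_sub, smul_mul_assoc,
          mul_smul_comm, one_mul, mul_one, hGH, hGG, mul_assoc, e4]
        module
      have hdU : W.det = N.det := by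
        have := congrArg Matrix.det hUN
        rw [Matrix.det_mul, Matrix.det_mul, Matrix.det_transpose, mul_comm] at this
        exact (mul_right_cancel₀ hUdet this).symm
      rw [← hNW, Matrix.det_mul, Matrix.det_mul, hdU, mul_assoc, mul_assoc, hGdet, mul_one]
    · simp only [Polynomial.eval_mul, Polynomial.eval_C, hpl, hq0, sub_zero]
      exact hP001
    · simp only [Polynomial.eval_mul, Polynomial.eval_C, hpl, sub_zero]
      exact hP001.trans_ne one_ne_zero
  have h1 : q.eval 1 = P 1 0 0 := by
    rw [← hPq]
    simp [hPdef, hpl]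
  have h2 : q.eval 1 = (Q₁ * H + Q₂).det := by simp [hq]
  rw [← h2, h1]
  exact hP100

end Pfaffian

section Clifford

/-- The first Pauli matrix. -/
def pauliX : Matrix (Fin 2) (Fin 2) ℂ := !![0, 1; 1, 0]

/-- The second Pauli matrix. -/
def pauliY : Matrix (Fin 2) (Fin 2) ℂ := !![0, -Complex.I; Complex.I, 0]

/-- The third Pauli matrix. -/
def pauliZ : Matrix (Fin 2) (Fin 2) ℂ := !![1, 0; 0, -1]

/-- Generators `c i`, `i < 2 l`, of a Clifford algebra acting on `ℂ ^ S`, with grading `γ` and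
charge conjugation `U`. -/
structure IsClifford {S : Type} [Fintype S] [DecidableEq S] (l : ℕ) (c : ℕ → Matrix S S ℂ)
    (γ U : Matrix S S ℂ) : Prop where
  card : Fintype.card S = 2 ^ l
  isHermitian : ∀ i < 2 * l, (c i).IsHermitian
  mul_self : ∀ i < 2 * l, c i * c i = 1
  anticomm : ∀ i < 2 * l, ∀ j < 2 * l, i ≠ j → c i * c j = -(c j * c i)
  grading_isHermitian : γ.IsHermitian
  grading_transpose : γᵀ = γ
  grading_mul_self : γ * γ = 1
  grading_anticomm : ∀ i < 2 * l, γ * c i = -(c i * γ)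
  grading_trace : 0 < l → γ.trace = 0
  conj_transpose : Uᵀ = (-1 : ℂ) ^ l.choose 2 • U
  conj_mul_self : U * U = (-1 : ℂ) ^ l.choose 2 • 1
  conj_mul : ∀ i < 2 * l, U * (c i)ᵀ = (-1 : ℂ) ^ (l + 1) • (c i * U)
  conj_grading : U * γ = (-1 : ℂ) ^ l • (γ * U)

theorem exists_isClifford (l : ℕ) :
    ∃ (S : Type) (_ : Fintype S) (_ : DecidableEq S) (c : ℕ → Matrix S S ℂ) (γ U : Matrix S S ℂ),
      IsClifford l c γ U := by
  induction l with
  | zero =>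
    refine ⟨Unit, inferInstance, inferInstance, fun _ => 0, 1, 1, ?_⟩
    constructor <;> simp
  | succ l ih =>
    obtain ⟨S, _, _, c, γ, U, h⟩ := ih
    have hXX : pauliX * pauliX = 1 := by
      ext i j; fin_cases i <;> fin_cases j <;> simp [pauliX]
    have hYY : pauliY * pauliY = 1 := by
      ext i j; fin_cases i <;> fin_cases j <;> simp [pauliY]
    have hZZ : pauliZ * pauliZ = 1 := by
      ext i j; fin_cases i <;> fin_cases j <;> simp [pauliZ]
    have hXY : pauliX * pauliY = -(pauliY * pauliX) := by
      ext i j; fin_cases i <;> fin_cases j <;> simp [pauliX, pauliY]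
    have hZX : pauliZ * pauliX = -(pauliX * pauliZ) := by
      ext i j; fin_cases i <;> fin_cases j <;> simp [pauliX, pauliZ]
    have hZY : pauliZ * pauliY = -(pauliY * pauliZ) := by
      ext i j; fin_cases i <;> fin_cases j <;> simp [pauliY, pauliZ]
    have hXh : pauliXᴴ = pauliX := by
      ext i j; fin_cases i <;> fin_cases j <;> simp [pauliX]
    have hYh : pauliYᴴ = pauliY := by
      ext i j; fin_cases i <;> fin_cases j <;> simp [pauliY]
    have hZh : pauliZᴴ = pauliZ := by
      ext i j; fin_cases i <;> fin_cases j <;> simp [pauliZ]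
    have hXt : pauliXᵀ = pauliX := by
      ext i j; fin_cases i <;> fin_cases j <;> simp [pauliX]
    have hYt : pauliYᵀ = -pauliY := by
      ext i j; fin_cases i <;> fin_cases j <;> simp [pauliY]
    have hZt : pauliZᵀ = pauliZ := by
      ext i j; fin_cases i <;> fin_cases j <;> simp [pauliZ]
    have hZtr : pauliZ.trace = 0 := by simp [pauliZ, Matrix.trace_fin_two]
    let c' : ℕ → Matrix (S × Fin 2) (S × Fin 2) ℂ := fun i =>
      if i < 2 * l then c i ⊗ₖ 1 else if i = 2 * l then γ ⊗ₖ pauliX else γ ⊗ₖ pauliY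
    have hcases : ∀ {p : ℕ → Matrix (S × Fin 2) (S × Fin 2) ℂ → Prop},
        (∀ i < 2 * l, p i (c i ⊗ₖ 1)) → p (2 * l) (γ ⊗ₖ pauliX) → p (2 * l + 1) (γ ⊗ₖ pauliY) →
        ∀ i < 2 * (l + 1), p i (c' i) := by
      intro p h1 h2 h3 i hi
      rcases lt_or_ge i (2 * l) with hi' | hi'
      · simpa [c', hi'] using h1 i hi'
      · obtain rfl | rfl : i = 2 * l ∨ i = 2 * l + 1 := by omega
        · simpa [c'] using h2
        · simpa [c'] using h3
    have hγt := h.grading_transpose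
    have hγγ := h.grading_mul_self
    have hγU : γ * U = (-1 : ℂ) ^ l • (U * γ) := by
      rw [h.conj_grading, smul_smul, ← mul_pow]; simp
    refine ⟨S × Fin 2, inferInstance, inferInstance, c', γ ⊗ₖ pauliZ, (U * γ) ⊗ₖ pauliX, ?_⟩
    constructor
    · simp [h.card, pow_succ]
    · refine hcases (fun i hi => ?_) ?_ ?_
      · rw [Matrix.IsHermitian, Matrix.conjTranspose_kronecker, (h.isHermitian i hi).eq,
          Matrix.conjTranspose_one]
      · rw [Matrix.IsHermitian, Matrix.conjTranspose_kronecker, h.grading_isHermitian.eq, hXh]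
      · rw [Matrix.IsHermitian, Matrix.conjTranspose_kronecker, h.grading_isHermitian.eq, hYh]
    · refine hcases (p := fun _ A => A * A = 1) (fun i hi => ?_) ?_ ?_ <;>
        simp only [← Matrix.mul_kronecker_mul, hγγ, hXX, hYY, one_mul, Matrix.one_kronecker_one]
      rw [h.mul_self i hi, Matrix.one_kronecker_one]
    · have hs : ∀ A B : Matrix S S ℂ, ∀ C : Matrix (Fin 2) (Fin 2) ℂ,
        A = -B → A ⊗ₖ C = -(B ⊗ₖ C) := fun A B C hAB => by
          rw [hAB]; ext; simp
      have hs' : ∀ A : Matrix S S ℂ, ∀ B C : Matrix (Fin 2) (Fin 2) ℂ,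
        B = -C → A ⊗ₖ B = -(A ⊗ₖ C) := fun A B C hAB => by
          rw [hAB]; ext; simp
      refine hcases (p := fun i A => ∀ j < 2 * (l + 1), i ≠ j → A * c' j = -(c' j * A))
        (fun i hi => ?_) ?_ ?_
      · refine hcases (p := fun j B => i ≠ j → c i ⊗ₖ 1 * B = -(B * c i ⊗ₖ 1))
          (fun j hj hij => ?_) (fun _ => ?_) (fun _ => ?_) <;>
          simp only [← Matrix.mul_kronecker_mul, mul_one, one_mul]
        · exact hs _ _ _ (h.anticomm i hi j hj hij)
        · exact hs _ _ _ (by rw [h.grading_anticomm i hi, neg_neg])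
        · exact hs _ _ _ (by rw [h.grading_anticomm i hi, neg_neg])
      · refine hcases (p := fun j B => 2 * l ≠ j → γ ⊗ₖ pauliX * B = -(B * γ ⊗ₖ pauliX))
          (fun j hj _ => ?_) (fun h => absurd rfl h) (fun _ => ?_) <;>
          simp only [← Matrix.mul_kronecker_mul, mul_one, one_mul]
        · exact hs _ _ _ (h.grading_anticomm j hj)
        · exact hs' _ _ _ hXY
      · refine hcases (p := fun j B => 2 * l + 1 ≠ j → γ ⊗ₖ pauliY * B = -(B * γ ⊗ₖ pauliY))
          (fun j hj _ => ?_) (fun _ => ?_) (fun h => absurd rfl h) <;>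
          simp only [← Matrix.mul_kronecker_mul, mul_one, one_mul]
        · exact hs _ _ _ (h.grading_anticomm j hj)
        · exact hs' _ _ _ (by rw [hXY, neg_neg])
    · rw [Matrix.IsHermitian, Matrix.conjTranspose_kronecker, h.grading_isHermitian.eq, hZh]
    · rw [← Matrix.kroneckerMap_transpose, hγt, hZt]
    · rw [← Matrix.mul_kronecker_mul, hγγ, hZZ, Matrix.one_kronecker_one]
    · refine hcases (p := fun i A => γ ⊗ₖ pauliZ * A = -(A * γ ⊗ₖ pauliZ)) (fun i hi => ?_) ?_ ?_ <;>
        simp only [← Matrix.mul_kronecker_mul, hZX, hZY, mul_one, one_mul]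
      · rw [h.grading_anticomm i hi]; ext; simp
      · ext; simp
      · ext; simp
    · intro _
      rw [Matrix.trace_kronecker, hZtr, mul_zero]
    · rw [← Matrix.kroneckerMap_transpose, Matrix.transpose_mul, hγt, h.conj_transpose, hXt,
        Nat.choose_succ_succ' l 1, Nat.choose_one_right, pow_add, mul_smul_comm, hγU, smul_smul,
        Matrix.smul_kronecker, mul_comm]
    · rw [← Matrix.mul_kronecker_mul, hXX, Nat.choose_succ_succ' l 1, Nat.choose_one_right, pow_add]
      have : U * γ * (U * γ) = ((-1 : ℂ) ^ l * (-1 : ℂ) ^ l.choose 2) • 1 := by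
        rw [mul_assoc, ← mul_assoc γ, hγU, smul_mul_assoc, mul_assoc U γ, hγγ, mul_one, mul_smul_comm,
          h.conj_mul_self, smul_smul]
      rw [this, Matrix.smul_kronecker, Matrix.one_kronecker_one]
    · have e1 : U * γ * γ = U := by rw [mul_assoc, hγγ, mul_one]
      have e2 : γ * (U * γ) = (-1 : ℂ) ^ l • U := by
        rw [← mul_assoc, hγU, smul_mul_assoc, e1]
      refine hcases (p := fun i A => (U * γ) ⊗ₖ pauliX * Aᵀ =
        (-1 : ℂ) ^ (l + 1 + 1) • (A * (U * γ) ⊗ₖ pauliX)) (fun i hi => ?_) ?_ ?_ <;>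
        simp only [← Matrix.kroneckerMap_transpose, ← Matrix.mul_kronecker_mul, hγt,
          Matrix.transpose_one, hXt, hYt, mul_one, one_mul, hXX, e1, e2, ← Matrix.smul_kronecker,
          mul_neg, hXY, smul_smul, ← pow_add]
      · have : γ * (c i)ᵀ = -((c i)ᵀ * γ) := by
          have := congrArg Matrix.transpose (h.grading_anticomm i hi)
          rw [Matrix.transpose_neg, Matrix.transpose_mul, Matrix.transpose_mul, hγt] at this
          rw [this, neg_neg]
        rw [mul_assoc, this, mul_neg, ← mul_assoc, h.conj_mul i hi, pow_succ _ (l + 1)]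
        simp [mul_assoc]
      · rw [show l + 1 + 1 + l = 2 * (l + 1) by ring, pow_mul]; simp
      · rw [show l + 1 + 1 + l = 2 * (l + 1) by ring, pow_mul]; simp
    · rw [← Matrix.mul_kronecker_mul, ← Matrix.mul_kronecker_mul, hZX, mul_assoc, hγγ, mul_one,
        ← mul_assoc, hγU, smul_mul_assoc, mul_assoc, hγγ, mul_one, pow_succ]
      ext ⟨a, a'⟩ ⟨b, b'⟩
      simp only [Matrix.kroneckerMap_apply, Matrix.smul_apply, Matrix.neg_apply, smul_eq_mul]
      have := (mul_pow (-1 : ℂ) (-1) l).symm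
      simp only [neg_mul_neg, one_mul, one_pow] at this
      linear_combination (-(U a b * (pauliX * pauliZ) a' b')) * this

end Clifford

section Spin

/-- Independent normalised spins: for each `i`, the elements `X i`, `Y i`, `Z i` satisfy the
commutation relations of `su(2)` with parameter `η`, different spins commute, and `R` is the joint
rotation by `π` about the `X` axes. -/
structure SpinFamily {κ A : Type*} [Fintype κ] [Ring A] [StarRing A] [Algebra ℂ A] (η : ℝ)
    (X Y Z : κ → A) (R : A) : Prop where
  starX : ∀ i, star (X i) = X i
  starY : ∀ i, star (Y i) = Y i
  starZ : ∀ i, star (Z i) = Z i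
  starR : star R = R
  commXX : ∀ i j, X i * X j = X j * X i
  commXY : ∀ i j, i ≠ j → X i * Y j = Y j * X i
  commXZ : ∀ i j, i ≠ j → X i * Z j = Z j * X i
  commYY : ∀ i j, Y i * Y j = Y j * Y i
  commYZ : ∀ i j, i ≠ j → Y i * Z j = Z j * Y i
  commZZ : ∀ i j, Z i * Z j = Z j * Z i
  lieZY : ∀ i, Z i * Y i = Y i * Z i + (Complex.I * η) • X i
  lieYX : ∀ i, Y i * X i = X i * Y i + (Complex.I * η) • Z i
  lieXZ : ∀ i, X i * Z i = Z i * X i + (Complex.I * η) • Y i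
  casimir : ∀ i, X i * X i + Y i * Y i + Z i * Z i = (1 + η : ℂ) • 1
  mulRR : R * R = 1
  mulRX : ∀ i, R * X i = X i * R
  mulRY : ∀ i, R * Y i = -(Y i * R)
  mulRZ : ∀ i, R * Z i = -(Z i * R)

theorem SpinFamily.map {κ A B : Type*} [Fintype κ] [Ring A] [StarRing A] [Algebra ℂ A] [Ring B]
    [StarRing B] [Algebra ℂ B] {η : ℝ} {X Y Z : κ → A} {R : A} (h : SpinFamily η X Y Z R)
    (f : A →⋆ₐ[ℂ] B) :
    SpinFamily η (fun i => f (X i)) (fun i => f (Y i)) (fun i => f (Z i)) (f R) where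
  starX i := by rw [← map_star, h.starX]
  starY i := by rw [← map_star, h.starY]
  starZ i := by rw [← map_star, h.starZ]
  starR := by rw [← map_star, h.starR]
  commXX i j := by rw [← map_mul, h.commXX, map_mul]
  commXY i j hij := by rw [← map_mul, h.commXY i j hij, map_mul]
  commXZ i j hij := by rw [← map_mul, h.commXZ i j hij, map_mul]
  commYY i j := by rw [← map_mul, h.commYY, map_mul]
  commYZ i j hij := by rw [← map_mul, h.commYZ i j hij, map_mul]
  commZZ i j := by rw [← map_mul, h.commZZ, map_mul]
  lieZY i := by rw [← map_mul, h.lieZY, map_add, map_mul, map_smul]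
  lieYX i := by rw [← map_mul, h.lieYX, map_add, map_mul, map_smul]
  lieXZ i := by rw [← map_mul, h.lieXZ, map_add, map_mul, map_smul]
  casimir i := by
    rw [← map_mul, ← map_mul, ← map_mul, ← map_add, ← map_add, h.casimir, map_smul, map_one]
  mulRR := by rw [← map_mul, h.mulRR, map_one]
  mulRX i := by rw [← map_mul, h.mulRX, map_mul]
  mulRY i := by rw [← map_mul, h.mulRY, map_neg, map_mul]
  mulRZ i := by rw [← map_mul, h.mulRZ, map_neg, map_mul]

variable (j : ℕ)

/-- The raising operator of the spin `j` representation of `su(2)`. -/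
noncomputable def spinRaise : Matrix (Fin (2 * j + 1)) (Fin (2 * j + 1)) ℂ :=
  .of fun a b => if b.val = a.val + 1 then (Real.sqrt ((a + 1) * (2 * j - a)) : ℂ) else 0

/-- The coordinate of the spin `j` representation which is diagonal in the weight basis. -/
noncomputable def spinX : Matrix (Fin (2 * j + 1)) (Fin (2 * j + 1)) ℂ :=
  .diagonal fun a => (((j - a) / j : ℝ) : ℂ)

/-- The imaginary coordinate of the spin `j` representation. -/
noncomputable def spinY : Matrix (Fin (2 * j + 1)) (Fin (2 * j + 1)) ℂ :=
  (-(Complex.I / (2 * j)) : ℂ) • (spinRaise j - (spinRaise j)ᵀ)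

/-- The real off-diagonal coordinate of the spin `j` representation. -/
noncomputable def spinZ : Matrix (Fin (2 * j + 1)) (Fin (2 * j + 1)) ℂ :=
  (1 / (2 * j) : ℂ) • (spinRaise j + (spinRaise j)ᵀ)

/-- The alternating diagonal sign. -/
noncomputable def spinR : Matrix (Fin (2 * j + 1)) (Fin (2 * j + 1)) ℂ :=
  .diagonal fun a => (-1) ^ a.val

theorem spinRaise_conjTranspose : (spinRaise j)ᴴ = (spinRaise j)ᵀ := by
  ext a b
  simp only [spinRaise, Matrix.conjTranspose_apply, Matrix.transpose_apply, Matrix.of_apply]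
  split_ifs <;> simp

theorem spinRaise_mul_transpose : spinRaise j * (spinRaise j)ᵀ =
    .diagonal fun a : Fin (2 * j + 1) => ((a + 1) * (2 * j - a) : ℂ) := by
  ext a c
  rw [Matrix.mul_apply]
  simp only [spinRaise, Matrix.transpose_apply, Matrix.of_apply]
  rcases eq_or_ne a c with rfl | hac
  · rw [Matrix.diagonal_apply_eq]
    have ha : (a : ℝ) ≤ 2 * j := by
      have := Nat.lt_succ_iff.mp a.2
      exact_mod_cast this
    rcases eq_or_ne a.val (2 * j) with h | h
    · rw [Finset.sum_eq_zero]
      · rw [h]; push_cast; ring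
      · intro b _
        rw [if_neg (by have := b.2; omega), mul_zero]
    · have h1 : a.val + 1 < 2 * j + 1 := by have := a.2; omega
      rw [Finset.sum_eq_single (⟨a.val + 1, h1⟩ : Fin (2 * j + 1))]
      · simp only [if_true]
        rw [← Complex.ofReal_mul, Real.mul_self_sqrt (by nlinarith)]
        push_cast; ring
      · intro b _ hb
        rw [if_neg (fun h => hb (Fin.ext h)), mul_zero]
      · simp
  · rw [Matrix.diagonal_apply_ne _ hac]
    refine Finset.sum_eq_zero fun b _ => ?_
    split_ifs with h1 h2
    · exact absurd (Fin.ext (by omega)) hac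
    all_goals simp

theorem transpose_mul_spinRaise : (spinRaise j)ᵀ * spinRaise j =
    .diagonal fun a : Fin (2 * j + 1) => (a * (2 * j - a + 1) : ℂ) := by
  ext a c
  rw [Matrix.mul_apply]
  simp only [spinRaise, Matrix.transpose_apply, Matrix.of_apply]
  rcases eq_or_ne a c with rfl | hac
  · rw [Matrix.diagonal_apply_eq]
    have ha : (a : ℝ) ≤ 2 * j := by
      have := Nat.lt_succ_iff.mp a.2
      exact_mod_cast this
    rcases eq_or_ne a.val 0 with h | h
    · rw [Finset.sum_eq_zero]
      · rw [h]; push_cast; ring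
      · intro b _
        rw [if_neg (by omega), mul_zero]
    · have h1 : a.val - 1 < 2 * j + 1 := by have := a.2; omega
      have h3 : a.val = a.val - 1 + 1 := by omega
      have h2 : (a : ℝ) = ((a.val - 1 : ℕ) : ℝ) + 1 := by exact_mod_cast h3
      have h2' : ((a.val : ℕ) : ℂ) = ((a.val - 1 : ℕ) : ℂ) + 1 := by exact_mod_cast h3
      rw [Finset.sum_eq_single (⟨a.val - 1, h1⟩ : Fin (2 * j + 1))]
      · simp only [if_pos h3]
        rw [← Complex.ofReal_mul, Real.mul_self_sqrt (by
          have : (0 : ℝ) ≤ ((a.val - 1 : ℕ) : ℝ) := by positivity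
          nlinarith), h2']
        push_cast; ring
      · intro b _ hb
        rw [if_neg (fun h => hb (Fin.ext (by simp; omega))), mul_zero]
      · simp
  · rw [Matrix.diagonal_apply_ne _ hac]
    refine Finset.sum_eq_zero fun b _ => ?_
    split_ifs with h1 h2
    · exact absurd (Fin.ext (by omega)) hac
    all_goals simp

theorem spinX_mul_spinRaise (hj : j ≠ 0) :
    spinX j * spinRaise j = spinRaise j * spinX j + (1 / j : ℂ) • spinRaise j := by
  ext a b
  have hj' : (j : ℂ) ≠ 0 := by exact_mod_cast hj
  simp only [spinX, Matrix.diagonal_mul, Matrix.mul_diagonal, Matrix.add_apply, Matrix.smul_apply,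
    spinRaise, Matrix.of_apply, smul_eq_mul]
  split_ifs with h
  · rw [h]; push_cast; field_simp; ring
  · simp

theorem spinR_mul_spinRaise : spinR j * spinRaise j = -(spinRaise j * spinR j) := by
  ext a b
  simp only [spinR, Matrix.diagonal_mul, Matrix.mul_diagonal, Matrix.neg_apply,
    spinRaise, Matrix.of_apply]
  split_ifs with h
  · rw [h, pow_succ]; ring
  · simp

theorem spinX_transpose : (spinX j)ᵀ = spinX j := Matrix.diagonal_transpose _

theorem spinR_transpose : (spinR j)ᵀ = spinR j := Matrix.diagonal_transpose _

theorem spinY_transpose : (spinY j)ᵀ = -spinY j := by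
  rw [spinY, Matrix.transpose_smul, Matrix.transpose_sub, Matrix.transpose_transpose, ← smul_neg,
    neg_sub]

theorem spinZ_transpose : (spinZ j)ᵀ = spinZ j := by
  rw [spinZ, Matrix.transpose_smul, Matrix.transpose_add, Matrix.transpose_transpose,
    add_comm (spinRaise j)ᵀ]

theorem spinX_isHermitian : (spinX j).IsHermitian :=
  Matrix.isHermitian_diagonal_of_self_adjoint _ (by ext; simp)

theorem spinR_isHermitian : (spinR j).IsHermitian :=
  Matrix.isHermitian_diagonal_of_self_adjoint _ (by ext; simp)

theorem spinRaise_transpose_conjTranspose : ((spinRaise j)ᵀ)ᴴ = spinRaise j := by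
  rw [← spinRaise_conjTranspose, Matrix.conjTranspose_conjTranspose]

theorem spinY_isHermitian : (spinY j).IsHermitian := by
  rw [Matrix.IsHermitian, spinY, Matrix.conjTranspose_smul, Matrix.conjTranspose_sub,
    spinRaise_conjTranspose, spinRaise_transpose_conjTranspose]
  simp
  module

theorem spinZ_isHermitian : (spinZ j).IsHermitian := by
  rw [Matrix.IsHermitian, spinZ, Matrix.conjTranspose_smul, Matrix.conjTranspose_add,
    spinRaise_conjTranspose, spinRaise_transpose_conjTranspose]
  simp [add_comm]

theorem spinFamily_single (hj : j ≠ 0) : SpinFamily (1 / j : ℝ) (fun _ : Unit => spinX j)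
    (fun _ => spinY j) (fun _ => spinZ j) (spinR j) := by
  have hj' : (j : ℂ) ≠ 0 := by exact_mod_cast hj
  have hI := Complex.I_mul_I
  have hXJ := spinX_mul_spinRaise j hj
  have hXJ' : spinX j * (spinRaise j)ᵀ =
      (spinRaise j)ᵀ * spinX j - (1 / j : ℂ) • (spinRaise j)ᵀ := by
    have := congrArg Matrix.transpose hXJ
    rw [Matrix.transpose_mul, Matrix.transpose_add, Matrix.transpose_mul, Matrix.transpose_smul,
      spinX_transpose] at this
    rw [this, add_sub_cancel_right]
  have hRJ := spinR_mul_spinRaise j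
  have hRJ' : spinR j * (spinRaise j)ᵀ = -((spinRaise j)ᵀ * spinR j) := by
    have := congrArg Matrix.transpose hRJ
    rw [Matrix.transpose_mul, Matrix.transpose_neg, Matrix.transpose_mul, spinR_transpose] at this
    rw [this, neg_neg]
  have hsq : (spinZ j * spinZ j + spinY j * spinY j) = (1 / (2 * j ^ 2) : ℂ) •
      (spinRaise j * (spinRaise j)ᵀ + (spinRaise j)ᵀ * spinRaise j) := by
    have e1 : (1 / (2 * j) * (1 / (2 * j)) : ℂ) = 1 / (4 * j ^ 2) := by field_simp; norm_num
    have e2 : (-(Complex.I / (2 * j)) * -(Complex.I / (2 * j)) : ℂ) = -1 / (4 * j ^ 2) := by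
      field_simp; rw [Complex.I_sq]; norm_num
    have e3 : (1 / (2 * j ^ 2) : ℂ) = 1 / (4 * j ^ 2) - -1 / (4 * j ^ 2) := by field_simp; norm_num
    rw [spinZ, spinY, smul_mul_smul, smul_mul_smul, e1, e2, e3]
    simp only [add_mul, mul_add, sub_mul, mul_sub, smul_add, smul_sub, sub_smul]
    module
  have hlie : spinRaise j * (spinRaise j)ᵀ - (spinRaise j)ᵀ * spinRaise j =
      (2 * j : ℂ) • spinX j := by
    rw [spinRaise_mul_transpose, transpose_mul_spinRaise, spinX, Matrix.diagonal_sub,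
      ← Matrix.diagonal_smul]
    congr 1
    ext a
    simp only [Pi.smul_apply, smul_eq_mul]
    push_cast
    field_simp
    ring
  refine ⟨fun _ => spinX_isHermitian j, fun _ => spinY_isHermitian j, fun _ => spinZ_isHermitian j,
    spinR_isHermitian j, fun _ _ => rfl, fun a b h => (h rfl).elim, fun a b h => (h rfl).elim,
    fun _ _ => rfl, fun a b h => (h rfl).elim, fun _ _ => rfl, fun _ => ?_, fun _ => ?_, fun _ => ?_,
    fun _ => ?_, ?_, fun _ => ?_, fun _ => ?_, fun _ => ?_⟩
  · have : spinX j = (1 / (2 * j) : ℂ) •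
        (spinRaise j * (spinRaise j)ᵀ - (spinRaise j)ᵀ * spinRaise j) := by
      rw [hlie, smul_smul, one_div_mul_cancel (by simpa using hj'), one_smul]
    rw [this, spinZ, spinY, smul_mul_smul, smul_mul_smul]
    simp only [add_mul, mul_add, sub_mul, mul_sub]
    match_scalars <;> field_simp <;> ring
  · rw [spinY, spinZ, smul_mul_assoc, mul_smul_comm, sub_mul, mul_sub, hXJ, hXJ']
    match_scalars <;> field_simp <;> ring
  · rw [spinY, spinZ, smul_mul_assoc, mul_smul_comm, add_mul, mul_add, hXJ, hXJ']
    match_scalars <;> field_simp <;> (try rw [Complex.I_sq]) <;> ring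
  · rw [add_assoc, add_comm (spinY j * spinY j), hsq, spinRaise_mul_transpose,
      transpose_mul_spinRaise, spinX, Matrix.diagonal_mul_diagonal, Matrix.diagonal_add,
      ← Matrix.diagonal_smul, Matrix.diagonal_add, ← Matrix.diagonal_one, ← Matrix.diagonal_smul]
    congr 1
    ext a
    simp only [Pi.smul_apply, smul_eq_mul]
    push_cast
    field_simp
    ring
  · rw [spinR, Matrix.diagonal_mul_diagonal, ← Matrix.diagonal_one]
    congr 1
    ext a
    rw [← mul_pow]; simp
  · rw [spinR, spinX, Matrix.diagonal_mul_diagonal, Matrix.diagonal_mul_diagonal]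
    simp only [mul_comm]
  · rw [spinY, mul_smul_comm, smul_mul_assoc, mul_sub, sub_mul, hRJ, hRJ']
    module
  · rw [spinZ, mul_smul_comm, smul_mul_assoc, mul_add, add_mul, hRJ, hRJ']
    module

end Spin

section Tensor
variable {κ m : Type} [Fintype κ] [DecidableEq κ] [Fintype m] [DecidableEq m]

/-- The tensor product of a family of matrices, acting on the tensor power indexed by `κ`. -/
def tens (A : κ → Matrix m m ℂ) : Matrix (κ → m) (κ → m) ℂ :=
  .of fun v w => ∏ i, A i (v i) (w i)

theorem tens_mul (A B : κ → Matrix m m ℂ) : tens A * tens B = tens (fun i => A i * B i) := by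
  ext v w
  simp only [tens, Matrix.mul_apply, Matrix.of_apply, ← Finset.prod_mul_distrib]
  rw [Finset.prod_univ_sum, Fintype.piFinset_univ]

theorem tens_diagonal (d : κ → m → ℂ) :
    tens (fun i => Matrix.diagonal (d i)) = .diagonal fun v => ∏ i, d i (v i) := by
  ext v w
  rw [tens, Matrix.of_apply]
  rcases eq_or_ne v w with rfl | h
  · simp
  · rw [Matrix.diagonal_apply_ne _ h]
    obtain ⟨i, hi⟩ := Function.ne_iff.mp h
    exact Finset.prod_eq_zero (Finset.mem_univ i) (Matrix.diagonal_apply_ne _ hi)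

theorem tens_one : tens (fun _ : κ => (1 : Matrix m m ℂ)) = 1 := by
  simp only [← Matrix.diagonal_one, tens_diagonal, Finset.prod_const_one]

theorem tens_conjTranspose (A : κ → Matrix m m ℂ) : (tens A)ᴴ = tens fun i => (A i)ᴴ := by
  ext v w
  simp [tens, Matrix.conjTranspose_apply]

theorem tens_transpose (A : κ → Matrix m m ℂ) : (tens A)ᵀ = tens fun i => (A i)ᵀ := rfl

theorem tens_update (A : κ → Matrix m m ℂ) (i : κ) (B : Matrix m m ℂ) (v w : κ → m) :
    tens (Function.update A i B) v w =
      B (v i) (w i) * ∏ j ∈ Finset.univ.erase i, A j (v j) (w j) := by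
  rw [tens, Matrix.of_apply, ← Finset.mul_prod_erase _ _ (Finset.mem_univ i),
    Function.update_self]
  congr 1
  refine Finset.prod_congr rfl fun j hj => ?_
  rw [Function.update_of_ne (Finset.ne_of_mem_erase hj)]

theorem tens_update_add (A : κ → Matrix m m ℂ) (i : κ) (B C : Matrix m m ℂ) :
    tens (Function.update A i (B + C)) =
      tens (Function.update A i B) + tens (Function.update A i C) := by
  ext v w
  simp only [Matrix.add_apply, tens_update, add_mul]

theorem tens_update_smul (A : κ → Matrix m m ℂ) (i : κ) (B : Matrix m m ℂ) (r : ℂ) :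
    tens (Function.update A i (r • B)) = r • tens (Function.update A i B) := by
  ext v w
  simp only [Matrix.smul_apply, tens_update, smul_eq_mul, mul_assoc]

theorem sum_tens {T : Type} [Fintype T] (e : T → Matrix m m ℂ) (he : ∑ t, e t = 1) :
    ∑ v : κ → T, tens (fun i => e (v i)) = 1 := by
  rw [← tens_one, ← he]
  ext v w
  simp only [tens, Matrix.sum_apply, Matrix.of_apply]
  rw [Finset.prod_univ_sum, Fintype.piFinset_univ]

/-- A matrix acting on the `i`-th factor of a tensor power. -/
def lift (i : κ) : Matrix m m ℂ →⋆ₐ[ℂ] Matrix (κ → m) (κ → m) ℂ where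
  toFun A := tens (Function.update 1 i A)
  map_one' := by
    rw [← tens_one]; congr 1; exact Function.update_eq_self i (1 : κ → Matrix m m ℂ)
  map_mul' A B := by
    rw [tens_mul]; congr 1; ext1 j
    rcases eq_or_ne j i with rfl | h
    · simp
    · simp [h]
  map_zero' := by
    simpa using tens_update_smul (1 : κ → Matrix m m ℂ) i 0 0
  map_add' A B := tens_update_add _ _ _ _
  commutes' r := by
    rw [Algebra.algebraMap_eq_smul_one, tens_update_smul, Algebra.algebraMap_eq_smul_one,
      ← tens_one]
    congr 2; exact Function.update_eq_self i (1 : κ → Matrix m m ℂ)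
  map_star' A := by
    rw [Matrix.star_eq_conjTranspose, Matrix.star_eq_conjTranspose, tens_conjTranspose]
    congr 1; ext1 j
    rcases eq_or_ne j i with rfl | h
    · simp
    · simp [h]

theorem lift_apply (i : κ) (A : Matrix m m ℂ) : lift i A = tens (Function.update 1 i A) := rfl

theorem lift_transpose (i : κ) (A : Matrix m m ℂ) : (lift i A)ᵀ = lift i Aᵀ := by
  rw [lift_apply, lift_apply, tens_transpose]
  congr 1; ext1 j
  rcases eq_or_ne j i with rfl | h
  · simp
  · simp [h]

theorem lift_mul_tens (i : κ) (A : Matrix m m ℂ) (B : κ → Matrix m m ℂ) :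
    lift i A * tens B = tens (Function.update B i (A * B i)) := by
  rw [lift_apply, tens_mul]
  congr 1; ext1 j
  rcases eq_or_ne j i with rfl | h
  · simp
  · simp [h]

theorem tens_mul_lift (i : κ) (A : Matrix m m ℂ) (B : κ → Matrix m m ℂ) :
    tens B * lift i A = tens (Function.update B i (B i * A)) := by
  rw [lift_apply, tens_mul]
  congr 1; ext1 j
  rcases eq_or_ne j i with rfl | h
  · simp
  · simp [h]

theorem lift_comm {i j : κ} (hij : i ≠ j) (A B : Matrix m m ℂ) :
    lift i A * lift j B = lift j B * lift i A := by
  rw [lift_apply j, lift_mul_tens, tens_mul_lift]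
  simp [hij]

theorem lift_diagonal (i : κ) (d : m → ℂ) :
    lift i (.diagonal d) = .diagonal fun v => d (v i) := by
  have : Function.update (1 : κ → Matrix m m ℂ) i (.diagonal d) =
      fun j => Matrix.diagonal (Function.update (fun _ _ => 1 : κ → m → ℂ) i d j) := by
    ext1 j
    rcases eq_or_ne j i with rfl | h
    · simp
    · simp [h]
  rw [lift_apply, this, tens_diagonal]
  congr 1; ext v
  rw [← Finset.mul_prod_erase _ _ (Finset.mem_univ i), Function.update_self,
    Finset.prod_eq_one, mul_one]
  intro j hj
  rw [Function.update_of_ne (Finset.ne_of_mem_erase hj)]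

end Tensor

section Modes
variable (k j : ℕ)

/-- The operator `spinX` acting on the `i`-th of `k` spins. -/
noncomputable def modeX (i : Fin k) := lift i (spinX j)

/-- The operator `spinY` acting on the `i`-th of `k` spins. -/
noncomputable def modeY (i : Fin k) := lift i (spinY j)

/-- The operator `spinZ` acting on the `i`-th of `k` spins. -/
noncomputable def modeZ (i : Fin k) := lift i (spinZ j)

/-- The operator `spinR` acting on all `k` spins. -/
noncomputable def modeR := tens fun _ : Fin k => spinR j

theorem modeX_transpose (i : Fin k) : (modeX k j i)ᵀ = modeX k j i := by
  rw [modeX, lift_transpose, spinX_transpose]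

theorem modeY_transpose (i : Fin k) : (modeY k j i)ᵀ = -modeY k j i := by
  rw [modeY, lift_transpose, spinY_transpose, map_neg]

theorem modeZ_transpose (i : Fin k) : (modeZ k j i)ᵀ = modeZ k j i := by
  rw [modeZ, lift_transpose, spinZ_transpose]

theorem modeR_transpose : (modeR k j)ᵀ = modeR k j := by
  simp only [modeR, tens_transpose, spinR_transpose]

theorem modeX_eq_diagonal (i : Fin k) :
    modeX k j i = .diagonal fun v => (((j - v i) / j : ℝ) : ℂ) := lift_diagonal i _

theorem modeR_eq_diagonal : modeR k j = .diagonal fun v => ∏ i, (-1) ^ (v i).val :=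
  tens_diagonal _

theorem spinFamily_mode (hj : j ≠ 0) :
    SpinFamily (1 / j : ℝ) (modeX k j) (modeY k j) (modeZ k j) (modeR k j) := by
  have h (i : Fin k) := (spinFamily_single j hj).map (lift i)
  have h0 := spinFamily_single j hj
  have hcomm (a b : Fin k) (A : Matrix (Fin (2 * j + 1)) (Fin (2 * j + 1)) ℂ) :
      lift a A * lift b A = lift b A * lift a A := by
    rcases eq_or_ne a b with rfl | hab
    · rfl
    · exact lift_comm hab _ _
  refine ⟨fun i => (h i).starX (), fun i => (h i).starY (), fun i => (h i).starZ (), ?_,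
    fun a b => hcomm a b _, fun a b hab => lift_comm hab _ _, fun a b hab => lift_comm hab _ _,
    fun a b => hcomm a b _, fun a b hab => lift_comm hab _ _, fun a b => hcomm a b _,
    fun i => (h i).lieZY (), fun i => (h i).lieYX (), fun i => (h i).lieXZ (),
    fun i => (h i).casimir (), ?_, fun i => ?_, fun i => ?_, fun i => ?_⟩
  · rw [modeR, Matrix.star_eq_conjTranspose, tens_conjTranspose]
    simp only [(spinR_isHermitian j).eq]
  · rw [modeR, tens_mul, h0.mulRR, tens_one]
  · rw [modeR, modeX, tens_mul_lift, lift_mul_tens, h0.mulRX ()]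
  · rw [modeR, modeY, tens_mul_lift, lift_mul_tens, h0.mulRY (), ← neg_one_smul ℂ,
      tens_update_smul, neg_one_smul]
  · rw [modeR, modeZ, tens_mul_lift, lift_mul_tens, h0.mulRZ (), ← neg_one_smul ℂ,
      tens_update_smul, neg_one_smul]

theorem exists_resolution {m : Type} [Fintype m] [DecidableEq m] {A : Matrix m m ℂ}
    (hA : A.IsHermitian) : ∃ (e : m → Matrix m m ℂ) (z : m → ℝ), (∀ t, (e t)ᴴ = e t) ∧
      (∀ t, e t * e t = e t) ∧ ∑ t, e t = 1 ∧ ∀ t, A * e t = (z t : ℂ) • e t := by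
  set U := (hA.eigenvectorUnitary : Matrix m m ℂ) with hUdef
  have hU : Uᴴ * U = 1 := Matrix.mem_unitaryGroup_iff'.mp hA.eigenvectorUnitary.2
  have hU' : U * Uᴴ = 1 := Matrix.mem_unitaryGroup_iff.mp hA.eigenvectorUnitary.2
  have hs : A = U * .diagonal (fun i => (hA.eigenvalues i : ℂ)) * Uᴴ := hA.spectral_theorem
  have hAU : A * U = U * .diagonal (fun i => (hA.eigenvalues i : ℂ)) := by
    conv_lhs => rw [hs]
    rw [mul_assoc, hU, mul_one]
  refine ⟨fun t => U * Matrix.single t t 1 * Uᴴ, hA.eigenvalues, fun t => ?_, fun t => ?_, ?_,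
    fun t => ?_⟩
  · simp [Matrix.conjTranspose_mul, Matrix.conjTranspose_single, mul_assoc]
  · calc _ = U * (Matrix.single t t 1 * (Uᴴ * U) * Matrix.single t t 1) * Uᴴ := by
          simp only [mul_assoc]
      _ = _ := by simp [hU]
  · rw [← Finset.sum_mul, ← Finset.mul_sum]
    have : ∑ t : m, Matrix.single t t (1 : ℂ) = 1 := by
      ext a b
      simp [Matrix.sum_apply, Matrix.single_apply, Matrix.one_apply, ite_and]
    rw [this, mul_one, hU']
  · rw [← mul_assoc, ← mul_assoc, hAU, mul_assoc U]
    have : Matrix.diagonal (fun i => (hA.eigenvalues i : ℂ)) * Matrix.single t t 1 =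
        (hA.eigenvalues t : ℂ) • Matrix.single t t 1 := by
      ext a b
      rcases eq_or_ne t a with rfl | h
      · simp [Matrix.diagonal_mul]
      · simp [Matrix.diagonal_mul, Matrix.single_apply_of_row_ne h]
    rw [this, mul_smul_comm, smul_mul_assoc]

theorem exists_resolution_modeZ : ∃ (e : (Fin k → Fin (2 * j + 1)) → Matrix _ _ ℂ)
    (z : (Fin k → Fin (2 * j + 1)) → Fin k → ℝ), (∀ t, (e t)ᴴ = e t) ∧
      (∀ t, e t * e t = e t) ∧ ∑ t, e t = 1 ∧ ∀ t i, modeZ k j i * e t = (z t i : ℂ) • e t := by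
  obtain ⟨e, z, h1, h2, h3, h4⟩ := exists_resolution (spinZ_isHermitian j)
  refine ⟨fun t => tens fun i => e (t i), fun t i => z (t i), fun t => ?_, fun t => ?_,
    sum_tens _ h3, fun t i => ?_⟩
  · simp only [tens_conjTranspose, h1]
  · simp only [tens_mul, h2]
  · rw [modeZ, lift_mul_tens, h4, tens_update_smul]
    congr 2
    exact Function.update_eq_self i fun i => e (t i)

end Modes

section Kron
variable {W V : Type} {κ : Type}

theorem neg_kron (A : Matrix W W ℂ) (B : Matrix V V ℂ) : (-A) ⊗ₖ B = -(A ⊗ₖ B) := by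
  ext; simp

theorem kron_neg (A : Matrix W W ℂ) (B : Matrix V V ℂ) : A ⊗ₖ (-B) = -(A ⊗ₖ B) := by
  ext; simp

theorem sub_kron (A A' : Matrix W W ℂ) (B : Matrix V V ℂ) :
    (A - A') ⊗ₖ B = A ⊗ₖ B - A' ⊗ₖ B := by
  ext; simp [sub_mul]

theorem kron_sub (A : Matrix W W ℂ) (B B' : Matrix V V ℂ) :
    A ⊗ₖ (B - B') = A ⊗ₖ B - A ⊗ₖ B' := by
  ext; simp [mul_sub]

theorem sum_kron (s : Finset κ) (A : κ → Matrix W W ℂ) (B : Matrix V V ℂ) :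
    (∑ i ∈ s, A i) ⊗ₖ B = ∑ i ∈ s, A i ⊗ₖ B := by
  ext; simp [Matrix.sum_apply, Finset.sum_mul]

theorem kron_sum (s : Finset κ) (A : Matrix W W ℂ) (B : κ → Matrix V V ℂ) :
    A ⊗ₖ (∑ i ∈ s, B i) = ∑ i ∈ s, A ⊗ₖ B i := by
  ext; simp [Matrix.sum_apply, Finset.mul_sum]

end Kron

section Algebra
variable {A κ : Type*} [Ring A]

theorem sum_mul_self_of_anticomm (s : Finset κ) (a : κ → A)
    (h : ∀ i j, i ≠ j → a i * a j = -(a j * a i)) :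
    (∑ i ∈ s, a i) * (∑ i ∈ s, a i) = ∑ i ∈ s, a i * a i := by
  classical
  induction s using Finset.induction_on with
  | empty => simp
  | insert i s hi ih =>
    have : a i * (∑ j ∈ s, a j) = -((∑ j ∈ s, a j) * a i) := by
      rw [Finset.mul_sum, Finset.sum_mul, ← Finset.sum_neg_distrib]
      exact Finset.sum_congr rfl fun j hj => h i j fun e => hi (e ▸ hj)
    rw [Finset.sum_insert hi, Finset.sum_insert hi, add_mul, mul_add, mul_add, ih, this]
    abel

end Algebra

section Gap
variable {W V κ : Type} [Fintype W] [DecidableEq W] [Fintype V] [DecidableEq V] [Fintype κ]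

/-- The relations between the coefficients `P`, `N` of a Hamiltonian and the Clifford generators
`C`, `Γ`. -/
structure IsFrame (P C : κ → Matrix W W ℂ) (Γ N : Matrix W W ℂ) : Prop where
  starP : ∀ i, (P i)ᴴ = P i
  starC : ∀ i, (C i)ᴴ = C i
  starΓ : Γᴴ = Γ
  starN : Nᴴ = N
  antiPC : ∀ i j, P i * C j = -(C j * P i)
  antiPΓ : ∀ i, P i * Γ = -(Γ * P i)
  antiCΓ : ∀ i, C i * Γ = -(Γ * C i)
  antiCC : ∀ i j, i ≠ j → C i * C j = -(C j * C i)
  antiNC : ∀ i, N * C i = -(C i * N)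
  antiNΓ : N * Γ = -(Γ * N)
  sqC : ∀ i, C i * C i = 1
  sqΓ : Γ * Γ = 1

/-- The scalar part `a - ∑ (1 - X i)`. -/
noncomputable def gapOp (X : κ → Matrix V V ℂ) (a : ℂ) : Matrix V V ℂ := a • 1 - ∑ i, (1 - X i)

/-- The Hamiltonian attached to a frame and a family of spins. -/
noncomputable def ham (P C : κ → Matrix W W ℂ) (Γ N : Matrix W W ℂ) (X Y Z : κ → Matrix V V ℂ)
    (a : ℂ) : Matrix (W × V) (W × V) ℂ :=
  ∑ i, P i ⊗ₖ Z i + N ⊗ₖ 1 + ∑ i, C i ⊗ₖ Y i + Γ ⊗ₖ gapOp X a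

theorem kron_anticomm {a a' : Matrix W W ℂ} (h : a * a' = -(a' * a)) (b b' : Matrix V V ℂ) :
    (a ⊗ₖ b) * (a' ⊗ₖ b') + (a' ⊗ₖ b') * (a ⊗ₖ b) = (a * a') ⊗ₖ (b * b' - b' * b) := by
  have h' : a' * a = -(a * a') := by rw [h, neg_neg]
  rw [← Matrix.mul_kronecker_mul, ← Matrix.mul_kronecker_mul, h', kron_sub, neg_kron,
    sub_eq_add_neg]

variable {P C : κ → Matrix W W ℂ} {Γ N : Matrix W W ℂ} {X Y Z : κ → Matrix V V ℂ}
  {R : Matrix V V ℂ} {η : ℝ} {a : ℂ}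

theorem gapOp_isHermitian (hS : SpinFamily η X Y Z R) (ha : star a = a) :
    (gapOp X a)ᴴ = gapOp X a := by
  have hX (i : κ) : (X i)ᴴ = X i := hS.starX i
  rw [gapOp, Matrix.conjTranspose_sub, Matrix.conjTranspose_smul, Matrix.conjTranspose_one,
    Matrix.conjTranspose_sum, ha]
  simp only [Matrix.conjTranspose_sub, Matrix.conjTranspose_one, hX]

theorem ham_isHermitian (hF : IsFrame P C Γ N) (hS : SpinFamily η X Y Z R) (ha : star a = a) :
    (ham P C Γ N X Y Z a).IsHermitian := by
  have hY (i : κ) : (Y i)ᴴ = Y i := hS.starY i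
  have hZ (i : κ) : (Z i)ᴴ = Z i := hS.starZ i
  rw [Matrix.IsHermitian, ham]
  simp only [Matrix.conjTranspose_add, Matrix.conjTranspose_sum, Matrix.conjTranspose_kronecker,
    hF.starP, hF.starC, hF.starΓ, hF.starN, hY, hZ, gapOp_isHermitian hS ha,
    Matrix.conjTranspose_one]

theorem mul_gapOp_sub (i : κ) {T B : Matrix V V ℂ} {u : ℂ} (hi : T * X i = X i * T + u • B)
    (hj : ∀ j, j ≠ i → T * X j = X j * T) : T * gapOp X a - gapOp X a * T = u • B := by
  rw [gapOp, mul_sub, sub_mul, mul_smul_comm, smul_mul_assoc, mul_one, one_mul, Finset.mul_sum,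
    Finset.sum_mul]
  have : ∑ j, T * (1 - X j) - ∑ j, (1 - X j) * T = -(u • B) := by
    rw [← Finset.sum_sub_distrib, Finset.sum_eq_single i]
    · rw [mul_sub, sub_mul, hi]; simp
    · intro j _ hji
      rw [mul_sub, sub_mul, hj j hji]; simp
    · simp
  have h2 : a • T - ∑ j, T * (1 - X j) - (a • T - ∑ j, (1 - X j) * T) =
      -(∑ j, T * (1 - X j) - ∑ j, (1 - X j) * T) := by abel
  rw [h2, this, neg_neg]

theorem ham_mul_self (hF : IsFrame P C Γ N) (hS : SpinFamily η X Y Z R) :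
    ham P C Γ N X Y Z a * ham P C Γ N X Y Z a =
      (∑ i, P i ⊗ₖ Z i + N ⊗ₖ 1) * (∑ i, P i ⊗ₖ Z i + N ⊗ₖ 1) +
      1 ⊗ₖ (∑ i, Y i * Y i) + 1 ⊗ₖ (gapOp X a * gapOp X a) +
      (η : ℂ) • ∑ i, ((Complex.I • (P i * C i)) ⊗ₖ X i + (Complex.I • (Γ * P i)) ⊗ₖ Y i +
        (Complex.I • (C i * Γ)) ⊗ₖ Z i) := by
  classical
  set g := gapOp X a with hg
  have hKK : (∑ i, C i ⊗ₖ Y i) * (∑ i, C i ⊗ₖ Y i) = 1 ⊗ₖ (∑ i, Y i * Y i) := by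
    rw [sum_mul_self_of_anticomm, kron_sum]
    · exact Finset.sum_congr rfl fun i _ => by rw [← Matrix.mul_kronecker_mul, hF.sqC]
    · intro i j hij
      rw [← Matrix.mul_kronecker_mul, ← Matrix.mul_kronecker_mul, hF.antiCC i j hij, neg_kron,
        hS.commYY]
  have hLL : (Γ ⊗ₖ g) * (Γ ⊗ₖ g) = 1 ⊗ₖ (g * g) := by rw [← Matrix.mul_kronecker_mul, hF.sqΓ]
  have hPK : (∑ i, P i ⊗ₖ Z i) * (∑ i, C i ⊗ₖ Y i) + (∑ i, C i ⊗ₖ Y i) * (∑ i, P i ⊗ₖ Z i) =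
      (η : ℂ) • ∑ i, (Complex.I • (P i * C i)) ⊗ₖ X i := by
    rw [Finset.sum_mul_sum, Finset.sum_mul_sum, Finset.sum_comm (γ := κ), ← Finset.sum_add_distrib,
      Finset.smul_sum]
    refine Finset.sum_congr rfl fun j _ => ?_
    rw [← Finset.sum_add_distrib, Finset.sum_eq_single j]
    · rw [kron_anticomm (hF.antiPC j j), hS.lieZY, add_sub_cancel_left, Matrix.kronecker_smul,
        Matrix.smul_kronecker, smul_smul, mul_comm]
    · intro i _ hij
      rw [kron_anticomm (hF.antiPC i j), hS.commYZ j i hij.symm, sub_self, Matrix.kronecker_zero]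
    · simp
  have hNK : (N ⊗ₖ (1 : Matrix V V ℂ)) * (∑ i, C i ⊗ₖ Y i) +
      (∑ i, C i ⊗ₖ Y i) * (N ⊗ₖ 1) = 0 := by
    rw [Finset.mul_sum, Finset.sum_mul, ← Finset.sum_add_distrib]
    refine Finset.sum_eq_zero fun j _ => ?_
    rw [kron_anticomm (hF.antiNC j), mul_one, one_mul, sub_self, Matrix.kronecker_zero]
  have hNL : (N ⊗ₖ (1 : Matrix V V ℂ)) * (Γ ⊗ₖ g) + (Γ ⊗ₖ g) * (N ⊗ₖ 1) = 0 := by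
    rw [kron_anticomm hF.antiNΓ, mul_one, one_mul, sub_self, Matrix.kronecker_zero]
  have hPL : (∑ i, P i ⊗ₖ Z i) * (Γ ⊗ₖ g) + (Γ ⊗ₖ g) * (∑ i, P i ⊗ₖ Z i) =
      (η : ℂ) • ∑ i, (Complex.I • (Γ * P i)) ⊗ₖ Y i := by
    rw [Finset.mul_sum, Finset.sum_mul, ← Finset.sum_add_distrib, Finset.smul_sum]
    refine Finset.sum_congr rfl fun i _ => ?_
    rw [kron_anticomm (hF.antiPΓ i), hg, mul_gapOp_sub (u := -(Complex.I * η)) (B := Y i) i,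
      Matrix.kronecker_smul, hF.antiPΓ, neg_kron, smul_neg, neg_smul, neg_neg,
      Matrix.smul_kronecker, smul_smul, mul_comm]
    · rw [hS.lieXZ]; module
    · exact fun j hj => (hS.commXZ j i hj).symm
  have hKL : (∑ i, C i ⊗ₖ Y i) * (Γ ⊗ₖ g) + (Γ ⊗ₖ g) * (∑ i, C i ⊗ₖ Y i) =
      (η : ℂ) • ∑ i, (Complex.I • (C i * Γ)) ⊗ₖ Z i := by
    rw [Finset.mul_sum, Finset.sum_mul, ← Finset.sum_add_distrib, Finset.smul_sum]
    refine Finset.sum_congr rfl fun i _ => ?_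
    rw [kron_anticomm (hF.antiCΓ i), hg, mul_gapOp_sub (u := Complex.I * η) (B := Z i) i
      (hS.lieYX i), Matrix.kronecker_smul, Matrix.smul_kronecker, smul_smul, mul_comm]
    exact fun j hj => (hS.commXY j i hj).symm
  rw [Finset.sum_add_distrib, Finset.sum_add_distrib, smul_add, smul_add, ← hPK, ← hPL, ← hKL,
    ← hKK, ← hLL, ham, ← hg]
  have e : ∀ F n K L : Matrix (W × V) (W × V) ℂ, n * K + K * n = 0 → n * L + L * n = 0 →
      (F + n + K + L) * (F + n + K + L) = (F + n) * (F + n) + K * K + L * L +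
        (F * K + K * F + (F * L + L * F) + (K * L + L * K)) := by
    intro F n K L h1 h2
    have : (F + n + K + L) * (F + n + K + L) = (F + n) * (F + n) + K * K + L * L +
        (F * K + K * F + (F * L + L * F) + (K * L + L * K)) + (n * K + K * n) +
        (n * L + L * n) := by noncomm_ring
    rw [this, h1, h2, add_zero, add_zero]
  exact e _ _ _ _ hNK hNL

end Gap

section Gap
variable {W V κ : Type} [Fintype W] [DecidableEq W] [Fintype V] [DecidableEq V] [Fintype κ]

theorem mul_self_nonneg_of_isHermitian {A : Matrix W W ℂ} (hA : Aᴴ = A) : 0 ≤ A * A := by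
  have := star_mul_self_nonneg A
  rwa [Matrix.star_eq_conjTranspose, hA] at this

theorem kron_nonneg {A : Matrix W W ℂ} {B : Matrix V V ℂ} (hA : 0 ≤ A) (hB : 0 ≤ B) :
    0 ≤ A ⊗ₖ B :=
  ((Matrix.nonneg_iff_posSemidef.mp hA).kronecker (Matrix.nonneg_iff_posSemidef.mp hB)).nonneg

theorem one_kron_mono {A B : Matrix V V ℂ} (h : A ≤ B) :
    (1 : Matrix W W ℂ) ⊗ₖ A ≤ (1 : Matrix W W ℂ) ⊗ₖ B := by
  rw [← sub_nonneg, ← kron_sub]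
  exact kron_nonneg zero_le_one (sub_nonneg.mpr h)

theorem kron_one_mono {A B : Matrix W W ℂ} (h : A ≤ B) :
    A ⊗ₖ (1 : Matrix V V ℂ) ≤ B ⊗ₖ (1 : Matrix V V ℂ) := by
  rw [← sub_nonneg, ← sub_kron]
  exact kron_nonneg (sub_nonneg.mpr h) zero_le_one

theorem neg_le_kron {A : Matrix W W ℂ} {B : Matrix V V ℂ} (hA : Aᴴ = A) (hB : Bᴴ = B) {α β : ℝ}
    (hα : A * A ≤ (α : ℂ) • 1) (hβ : B * B ≤ (β : ℂ) • 1) :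
    -(((α + β) / 2 : ℝ) : ℂ) • 1 ≤ A ⊗ₖ B := by
  have h := mul_self_nonneg_of_isHermitian (A := A ⊗ₖ (1 : Matrix V V ℂ) + (1 : Matrix W W ℂ) ⊗ₖ B)
    (by rw [Matrix.conjTranspose_add, Matrix.conjTranspose_kronecker,
      Matrix.conjTranspose_kronecker, hA, hB, Matrix.conjTranspose_one, Matrix.conjTranspose_one])
  rw [add_mul, mul_add, mul_add, ← Matrix.mul_kronecker_mul, ← Matrix.mul_kronecker_mul,
    ← Matrix.mul_kronecker_mul, ← Matrix.mul_kronecker_mul, one_mul, mul_one, mul_one, one_mul,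
    mul_one, one_mul] at h
  have h1 := kron_one_mono (V := V) hα
  have h2 := one_kron_mono (W := W) hβ
  rw [Matrix.smul_kronecker, Matrix.one_kronecker_one] at h1
  rw [Matrix.kronecker_smul, Matrix.one_kronecker_one] at h2
  have h3 := h.trans (add_le_add (add_le_add_left h1 _) (add_le_add_right h2 _))
  rw [← sub_nonneg]
  have h4 : A ⊗ₖ B - -(((α + β) / 2 : ℝ) : ℂ) • 1 = (1 / 2 : ℂ) •
      ((α : ℂ) • 1 + A ⊗ₖ B + (A ⊗ₖ B + (β : ℂ) • 1)) := by
    push_cast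
    module
  rw [h4]
  exact smul_nonneg (by positivity) h3

variable {P C : κ → Matrix W W ℂ} {Γ N : Matrix W W ℂ} {X Y Z : κ → Matrix V V ℂ}
  {R : Matrix V V ℂ} {η : ℝ} {a : ℂ}

theorem SpinFamily.mul_self_le (hS : SpinFamily η X Y Z R) (i : κ) :
    X i * X i ≤ ((1 + η : ℝ) : ℂ) • 1 ∧ Y i * Y i ≤ ((1 + η : ℝ) : ℂ) • 1 ∧
      Z i * Z i ≤ ((1 + η : ℝ) : ℂ) • 1 := by
  have hX := mul_self_nonneg_of_isHermitian (hS.starX i)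
  have hY := mul_self_nonneg_of_isHermitian (hS.starY i)
  have hZ := mul_self_nonneg_of_isHermitian (hS.starZ i)
  push_cast
  rw [← hS.casimir i]
  refine ⟨?_, ?_, ?_⟩ <;> rw [← sub_nonneg]
  · convert add_nonneg hY hZ using 1; abel
  · convert add_nonneg hX hZ using 1; abel
  · convert add_nonneg hX hY using 1; abel

theorem sum_mul_self_of_resolution {T : Type} [Fintype T] {e : T → Matrix V V ℂ} {z : T → κ → ℝ}
    (he : ∑ t, e t = 1) (hZe : ∀ t i, Z i * e t = (z t i : ℂ) • e t) :
    (∑ i, P i ⊗ₖ Z i + N ⊗ₖ 1) * (∑ i, P i ⊗ₖ Z i + N ⊗ₖ 1) =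
      ∑ t, ((∑ i, (z t i : ℂ) • P i + N) * (∑ i, (z t i : ℂ) • P i + N)) ⊗ₖ e t := by
  set F := ∑ i, P i ⊗ₖ Z i + N ⊗ₖ 1 with hF
  have h (t : T) (B : Matrix W W ℂ) :
      F * (B ⊗ₖ e t) = ((∑ i, (z t i : ℂ) • P i + N) * B) ⊗ₖ e t := by
    rw [hF, add_mul, add_mul, Matrix.add_kronecker, Finset.sum_mul, Finset.sum_mul, sum_kron,
      ← Matrix.mul_kronecker_mul, one_mul]
    congr 1
    refine Finset.sum_congr rfl fun i _ => ?_
    rw [← Matrix.mul_kronecker_mul, hZe, Matrix.kronecker_smul, smul_mul_assoc,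
      Matrix.smul_kronecker]
  calc F * F = F * F * 1 ⊗ₖ (∑ t, e t) := by rw [he, Matrix.one_kronecker_one, mul_one]
    _ = _ := by
      rw [kron_sum, Finset.mul_sum]
      refine Finset.sum_congr rfl fun t _ => ?_
      rw [mul_assoc, h, h, mul_one]

theorem le_sum_mul_self {T : Type} [Fintype T] {e : T → Matrix V V ℂ} {z : T → κ → ℝ}
    (hse : ∀ t, (e t)ᴴ = e t) (hee : ∀ t, e t * e t = e t)
    (he : ∑ t, e t = 1) (hZe : ∀ t i, Z i * e t = (z t i : ℂ) • e t) {c : ℝ}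
    (h1 : ∀ z : κ → ℝ, ((c * ∑ i, z i ^ 2 : ℝ) : ℂ) • 1 ≤
      (∑ i, (z i : ℂ) • P i + N) * (∑ i, (z i : ℂ) • P i + N)) :
    1 ⊗ₖ ((c : ℂ) • ∑ i, Z i * Z i) ≤
      (∑ i, P i ⊗ₖ Z i + N ⊗ₖ 1) * (∑ i, P i ⊗ₖ Z i + N ⊗ₖ 1) := by
  have hZZ : (c : ℂ) • ∑ i, Z i * Z i = ∑ t, ((c * ∑ i, z t i ^ 2 : ℝ) : ℂ) • e t := by
    rw [← mul_one (∑ i, Z i * Z i), ← he, Finset.mul_sum, Finset.smul_sum]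
    refine Finset.sum_congr rfl fun t _ => ?_
    rw [Finset.sum_mul]
    simp only [mul_assoc, hZe, mul_smul_comm]
    push_cast
    rw [Finset.mul_sum, Finset.smul_sum, Finset.sum_smul]
    refine Finset.sum_congr rfl fun i _ => ?_
    module
  rw [sum_mul_self_of_resolution he hZe, hZZ, kron_sum]
  refine Finset.sum_le_sum fun t _ => ?_
  rw [Matrix.kronecker_smul, ← Matrix.smul_kronecker, ← sub_nonneg, ← sub_kron]
  exact kron_nonneg (sub_nonneg.mpr (h1 _)) (hee t ▸ mul_self_nonneg_of_isHermitian (hse t))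

/-- A lower bound for the square of the Hamiltonian. -/
theorem le_ham_mul_self (hF : IsFrame P C Γ N) (hS : SpinFamily η X Y Z R) (hη : 0 ≤ η)
    {T : Type} [Fintype T] {e : T → Matrix V V ℂ} {z : T → κ → ℝ}
    (hse : ∀ t, (e t)ᴴ = e t) (hee : ∀ t, e t * e t = e t)
    (he : ∑ t, e t = 1) (hZe : ∀ t i, Z i * e t = (z t i : ℂ) • e t) {b c δ : ℝ}
    (hc0 : 0 ≤ c) (hc1 : c ≤ 1)
    (h1 : ∀ z : κ → ℝ, ((c * ∑ i, z i ^ 2 : ℝ) : ℂ) • 1 ≤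
      (∑ i, (z i : ℂ) • P i + N) * (∑ i, (z i : ℂ) • P i + N))
    (h2 : (δ : ℂ) • 1 ≤ (c : ℂ) • ∑ i, (1 - X i * X i) + gapOp X a * gapOp X a)
    (hb1 : 1 ≤ b) (hb : ∀ i, P i * P i ≤ (b : ℂ) • 1) :
    ((δ - η * (Fintype.card κ * (3 * ((b + (1 + η)) / 2))) : ℝ) : ℂ) • 1 ≤
      ham P C Γ N X Y Z a * ham P C Γ N X Y Z a := by
  have hI : star Complex.I = -Complex.I := Complex.conj_I
  have hnn {r : ℝ} (hr : 0 ≤ r) : (0 : ℂ) ≤ r := by exact_mod_cast hr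
  have h1b : (1 : Matrix W W ℂ) ≤ (b : ℂ) • 1 := by
    rw [← sub_nonneg]
    have : (b : ℂ) • (1 : Matrix W W ℂ) - 1 = ((b - 1 : ℝ) : ℂ) • 1 := by push_cast; module
    rw [this]
    exact smul_nonneg (hnn (by linarith)) zero_le_one
  have hherm {A B : Matrix W W ℂ} (hA : Aᴴ = A) (hB : Bᴴ = B) (hAB : A * B = -(B * A)) :
      (Complex.I • (A * B))ᴴ = Complex.I • (A * B) := by
    rw [Matrix.conjTranspose_smul, Matrix.conjTranspose_mul, hA, hB, hI, hAB, smul_neg, neg_smul]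
  have hsq {A B : Matrix W W ℂ} (hB : B * B = 1) (hAB : A * B = -(B * A)) :
      (Complex.I • (A * B)) * (Complex.I • (A * B)) = A * A := by
    have hBA : B * A = -(A * B) := by rw [hAB, neg_neg]
    rw [smul_mul_smul, Complex.I_mul_I, ← mul_assoc, mul_assoc A B A, hBA, mul_neg, neg_mul,
      mul_assoc, mul_assoc, hB, mul_one, neg_smul, one_smul, neg_neg]
  have hE (i : κ) : -((3 * ((b + (1 + η)) / 2) : ℝ) : ℂ) • 1 ≤
      (Complex.I • (P i * C i)) ⊗ₖ X i + (Complex.I • (Γ * P i)) ⊗ₖ Y i +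
        (Complex.I • (C i * Γ)) ⊗ₖ Z i := by
    have hΓP : Γ * P i = -(P i * Γ) := by rw [hF.antiPΓ, neg_neg]
    have hX := neg_le_kron (hherm (hF.starP i) (hF.starC i) (hF.antiPC i i)) (hS.starX i)
      (by rw [hsq (hF.sqC i) (hF.antiPC i i)]; exact hb i) (hS.mul_self_le i).1
    have hY := neg_le_kron (hherm hF.starΓ (hF.starP i) hΓP) (hS.starY i)
      (by
        rw [hΓP, smul_neg, neg_mul_neg, hsq hF.sqΓ (hF.antiPΓ i)]
        exact hb i) (hS.mul_self_le i).2.1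
    have hZ := neg_le_kron (hherm (hF.starC i) hF.starΓ (hF.antiCΓ i)) (hS.starZ i)
      (by rw [hsq hF.sqΓ (hF.antiCΓ i), hF.sqC]; exact h1b) (hS.mul_self_le i).2.2
    refine le_trans (le_of_eq ?_) (add_le_add (add_le_add hX hY) hZ)
    push_cast
    module
  have hE' : -((η * (Fintype.card κ * (3 * ((b + (1 + η)) / 2))) : ℝ) : ℂ) • 1 ≤
      (η : ℂ) • ∑ i, ((Complex.I • (P i * C i)) ⊗ₖ X i + (Complex.I • (Γ * P i)) ⊗ₖ Y i +
        (Complex.I • (C i * Γ)) ⊗ₖ Z i) := by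
    refine le_trans (le_of_eq ?_) (smul_le_smul_of_nonneg_left
      (Finset.sum_le_sum fun i _ => hE i) (hnn hη))
    rw [Finset.sum_const, Finset.card_univ, ← Nat.cast_smul_eq_nsmul ℂ]
    push_cast
    module
  have hmain : (1 : Matrix W W ℂ) ⊗ₖ ((δ : ℂ) • (1 : Matrix V V ℂ)) ≤
      1 ⊗ₖ ((c : ℂ) • ∑ i, Z i * Z i) + 1 ⊗ₖ (∑ i, Y i * Y i) +
        1 ⊗ₖ (gapOp X a * gapOp X a) := by
    rw [← Matrix.kronecker_add, ← Matrix.kronecker_add]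
    refine one_kron_mono (h2.trans (add_le_add_left ?_ _))
    have : (c : ℂ) • ∑ i, Z i * Z i + ∑ i, Y i * Y i - (c : ℂ) • ∑ i, (1 - X i * X i) =
        ((1 - c : ℝ) : ℂ) • ∑ i, Y i * Y i + ((c * η * Fintype.card κ : ℝ) : ℂ) • 1 := by
      have hx : ∑ i, (1 - X i * X i) =
          ∑ i, (Y i * Y i) + ∑ i, Z i * Z i - ((η * Fintype.card κ : ℝ) : ℂ) • 1 := by
        have : ∀ i, 1 - X i * X i = Y i * Y i + Z i * Z i - (η : ℂ) • 1 := by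
          intro i
          have h : ((1 : ℂ) + η) • (1 : Matrix V V ℂ) = 1 + (η : ℂ) • 1 := by module
          rw [eq_sub_iff_add_eq, sub_add_eq_add_sub, ← h, ← hS.casimir i]
          abel
        simp only [this]
        rw [Finset.sum_sub_distrib, Finset.sum_add_distrib, Finset.sum_const, Finset.card_univ,
          ← Nat.cast_smul_eq_nsmul ℂ, smul_smul]
        push_cast
        rw [mul_comm (η : ℂ)]
      rw [hx]
      push_cast
      module
    rw [← sub_nonneg, this]
    exact add_nonneg (smul_nonneg (hnn (by linarith))
      (Finset.sum_nonneg fun i _ => mul_self_nonneg_of_isHermitian (hS.starY i)))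
      (smul_nonneg (hnn (by positivity)) zero_le_one)
  rw [ham_mul_self hF hS]
  refine le_trans (le_of_eq ?_) (add_le_add (hmain.trans (add_le_add_left (add_le_add_left
    (le_sum_mul_self hse hee he hZe h1) _) _)) hE')
  rw [Matrix.kronecker_smul, Matrix.one_kronecker_one]
  push_cast
  module

end Gap

section Bounds
variable {W κ : Type} [Fintype W] [DecidableEq W] [Fintype κ]

theorem posDef_of_le {A : Matrix W W ℂ} {ε : ℝ} (hε : 0 < ε) (h : (ε : ℂ) • 1 ≤ A) :
    A.PosDef := by
  have h1 : (((ε : ℂ) • 1 : Matrix W W ℂ)).PosDef := by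
    have : (0 : ℂ) < ε := by exact_mod_cast hε
    exact Matrix.PosDef.smul Matrix.PosDef.one this
  have := h1.add_posSemidef (Matrix.le_iff.mp h)
  rwa [add_sub_cancel] at this

theorem det_ne_zero_of_le {H : Matrix W W ℂ} {ε : ℝ} (hε : 0 < ε) (h : (ε : ℂ) • 1 ≤ H * H) :
    H.det ≠ 0 := by
  have := (posDef_of_le hε h).det_pos.ne'
  rw [Matrix.det_mul] at this
  exact left_ne_zero_of_mul this

theorem det_add_ne_zero {H E : Matrix W W ℂ} (hH : Hᴴ = H) (hE : Eᴴ = E) {ε ε' : ℝ}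
    (hε : ε' < ε) (h : (ε : ℂ) • 1 ≤ H * H) (h' : E * E ≤ (ε' : ℂ) • 1) : (H + E).det ≠ 0 := by
  intro h0
  obtain ⟨v, hv, hHv⟩ := Matrix.exists_mulVec_eq_zero_iff.mpr h0
  have hpos : (H * H - E * E).PosDef := by
    refine posDef_of_le (sub_pos.mpr hε) ?_
    refine le_trans (le_of_eq ?_) (sub_le_sub h h')
    push_cast; module
  have h1 : H *ᵥ v = -(E *ᵥ v) := by
    rw [Matrix.add_mulVec] at hHv
    exact eq_neg_of_add_eq_zero_left hHv
  have h2 := hpos.dotProduct_mulVec_pos hv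
  have key (A : Matrix W W ℂ) (hA : Aᴴ = A) :
      star v ⬝ᵥ ((A * A) *ᵥ v) = star (A *ᵥ v) ⬝ᵥ (A *ᵥ v) := by
    rw [← Matrix.mulVec_mulVec, Matrix.dotProduct_mulVec, Matrix.star_mulVec, hA]
  rw [Matrix.sub_mulVec, dotProduct_sub, key H hH, key E hE, h1] at h2
  simp at h2

theorem sum_mul_self_le {E : κ → Matrix W W ℂ} (hE : ∀ i, (E i)ᴴ = E i) {r : ℝ}
    (h : ∀ i, E i * E i ≤ (r : ℂ) • 1) :
    (∑ i, E i) * (∑ i, E i) ≤ ((Fintype.card κ ^ 2 * r : ℝ) : ℂ) • 1 := by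
  have h1 : (0 : Matrix W W ℂ) ≤ ∑ i, ∑ j, (E i - E j) * (E i - E j) :=
    Finset.sum_nonneg fun i _ => Finset.sum_nonneg fun j _ =>
      mul_self_nonneg_of_isHermitian (by rw [Matrix.conjTranspose_sub, hE, hE])
  have h2 : ∑ i, ∑ j, (E i - E j) * (E i - E j) = (2 : ℂ) • ((Fintype.card κ : ℂ) •
      ∑ i, E i * E i - (∑ i, E i) * (∑ i, E i)) := by
    have e (i j : κ) : (E i - E j) * (E i - E j) =
        E i * E i + E j * E j - E i * E j - E j * E i := by noncomm_ring
    simp only [e, Finset.sum_sub_distrib, Finset.sum_add_distrib, Finset.sum_const,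
      Finset.card_univ, ← Finset.mul_sum, ← Finset.sum_mul, ← Nat.cast_smul_eq_nsmul ℂ,
      ← Finset.smul_sum]
    module
  have h3 : (Fintype.card κ : ℂ) • ∑ i, E i * E i - (∑ i, E i) * (∑ i, E i) =
      (1 / 2 : ℂ) • ((2 : ℂ) • ((Fintype.card κ : ℂ) •
      ∑ i, E i * E i - (∑ i, E i) * (∑ i, E i))) := by module
  have h4 : (∑ i, E i) * (∑ i, E i) ≤ (Fintype.card κ : ℂ) • ∑ i, E i * E i := by
    rw [← sub_nonneg, h3, ← h2]
    exact smul_nonneg (by positivity) h1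
  refine h4.trans ((smul_le_smul_of_nonneg_left (Finset.sum_le_sum fun i _ => h i)
    (by positivity)).trans (le_of_eq ?_))
  rw [Finset.sum_const, Finset.card_univ, ← Nat.cast_smul_eq_nsmul ℂ]
  push_cast
  module

open scoped Matrix.Norms.L2Operator in
theorem exists_le_smul_one {T : Type} [TopologicalSpace T] {s : Set T} (hs : IsCompact s)
    {A : T → Matrix W W ℂ} (hA : ContinuousOn A s) (hh : ∀ t, (A t)ᴴ = A t) :
    ∃ b : ℝ, 1 ≤ b ∧ ∀ t ∈ s, A t ≤ (b : ℂ) • 1 := by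
  obtain ⟨B, hB⟩ := hs.exists_bound_of_continuousOn hA
  refine ⟨max 1 B, le_max_left _ _, fun t ht => ?_⟩
  have h := IsSelfAdjoint.le_algebraMap_norm_self (a := A t) (hh t)
  refine h.trans ?_
  rw [Algebra.algebraMap_eq_smul_one, ← sub_nonneg]
  have : ((max 1 B : ℝ) : ℂ) • (1 : Matrix W W ℂ) - ‖A t‖ • 1 =
      ((max 1 B - ‖A t‖ : ℝ) : ℂ) • 1 := by
    rw [← Complex.coe_smul ‖A t‖, ← sub_smul]; push_cast; rfl
  rw [this]
  refine smul_nonneg ?_ zero_le_one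
  have := (hB t ht).trans (le_max_right 1 B)
  exact_mod_cast sub_nonneg.mpr this

theorem exists_le_mul_self {f : κ → Matrix W W ℂ} (hf : ∀ i, (f i)ᴴ = f i)
    (hdet : ∀ z : κ → ℝ, z ≠ 0 → (∑ i, (z i : ℂ) • f i).det ≠ 0) :
    ∃ c : ℝ, 0 < c ∧ c ≤ 1 ∧ ∀ z : κ → ℝ, ((c * ∑ i, z i ^ 2 : ℝ) : ℂ) • 1 ≤
      (∑ i, (z i : ℂ) • f i) * (∑ i, (z i : ℂ) • f i) := by
  classical
  set F : (κ → ℝ) → Matrix W W ℂ := fun z => ∑ i, (z i : ℂ) • f i with hFdef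
  have hFc : Continuous F := by
    refine continuous_finsetSum _ fun i _ => ?_
    exact (Complex.continuous_ofReal.comp (continuous_apply i)).smul continuous_const
  have hFh (z) : (F z)ᴴ = F z := by
    rw [hFdef, Matrix.conjTranspose_sum]
    refine Finset.sum_congr rfl fun i _ => ?_
    rw [Matrix.conjTranspose_smul, hf]
    simp
  set s : Set (κ → ℝ) := {z | ∑ i, z i ^ 2 = 1} with hs
  have hsc : IsCompact s := by
    refine Metric.isCompact_of_isClosed_isBounded ?_ ?_
    · exact isClosed_eq (by fun_prop) continuous_const
    · refine (Metric.isBounded_closedBall (x := (0 : κ → ℝ)) (r := 1)).subset fun z hz => ?_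
      rw [mem_closedBall_zero_iff, pi_norm_le_iff_of_nonneg zero_le_one]
      intro i
      rw [Real.norm_eq_abs, ← sq_le_one_iff_abs_le_one, ← (show ∑ i, z i ^ 2 = 1 from hz)]
      exact Finset.single_le_sum (f := fun i => z i ^ 2) (fun _ _ => sq_nonneg _)
        (Finset.mem_univ i)
  have hdet' (z) (hz : z ∈ s) : (F z).det ≠ 0 := by
    refine hdet z ?_
    rintro rfl
    simp [hs] at hz
  have hcont : ContinuousOn (fun z => (F z)⁻¹ * (F z)⁻¹) s := by
    have : ContinuousOn (fun z => (F z)⁻¹) s := by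
      simp only [Matrix.inv_def, Ring.inverse_eq_inv']
      exact (hFc.matrix_det.continuousOn.inv₀ hdet').smul hFc.matrix_adjugate.continuousOn
    exact this.mul this
  obtain ⟨b, hb1, hb⟩ := exists_le_smul_one hsc hcont fun z => by
    rw [Matrix.conjTranspose_mul, Matrix.conjTranspose_nonsing_inv, hFh]
  have hb0 : 0 < b := by linarith
  refine ⟨b⁻¹, inv_pos.mpr hb0, inv_le_one_of_one_le₀ hb1, fun z => ?_⟩
  have hunit (z) (hz : z ∈ s) : ((b⁻¹ : ℝ) : ℂ) • 1 ≤ F z * F z := by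
    have hu : IsUnit (F z).det := isUnit_iff_ne_zero.mpr (hdet' z hz)
    have := star_left_conjugate_le_conjugate (hb z hz) (F z)
    rw [Matrix.star_eq_conjTranspose, hFh, mul_smul_comm, mul_one, smul_mul_assoc, mul_assoc,
      mul_assoc, Matrix.nonsing_inv_mul _ hu, mul_one, Matrix.mul_nonsing_inv _ hu] at this
    have h := smul_le_smul_of_nonneg_left this (show (0 : ℂ) ≤ ((b⁻¹ : ℝ) : ℂ) by
      exact_mod_cast (inv_pos.mpr hb0).le)
    rwa [smul_smul, ← Complex.ofReal_mul, inv_mul_cancel₀ hb0.ne', Complex.ofReal_one,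
      one_smul] at h
  rcases eq_or_ne z 0 with rfl | hz
  · simp
  · set r := Real.sqrt (∑ i, z i ^ 2) with hr
    have hr2 : r * r = ∑ i, z i ^ 2 :=
      Real.mul_self_sqrt (Finset.sum_nonneg fun _ _ => sq_nonneg _)
    have hr0 : r ≠ 0 := by
      intro h0
      rw [h0, mul_zero] at hr2
      refine hz (funext fun i => ?_)
      have := (Finset.sum_eq_zero_iff_of_nonneg fun i _ => sq_nonneg (z i)).mp hr2.symm i
        (Finset.mem_univ i)
      simpa using this
    have hmem : (fun i => r⁻¹ * z i) ∈ s := by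
      change ∑ i, (r⁻¹ * z i) ^ 2 = 1
      simp only [mul_pow]
      rw [← Finset.mul_sum, ← hr2]
      field_simp
    have hFz : F z = (r : ℂ) • F fun i => r⁻¹ * z i := by
      simp only [hFdef, Finset.smul_sum, smul_smul]
      refine Finset.sum_congr rfl fun i _ => ?_
      rw [← Complex.ofReal_mul, mul_inv_cancel_left₀ hr0]
    have h := smul_le_smul_of_nonneg_left (hunit _ hmem) (show (0 : ℂ) ≤ ((r * r : ℝ) : ℂ) by
      exact_mod_cast mul_self_nonneg r)
    change _ ≤ F z * F z
    rw [hFz, smul_mul_smul, ← hr2, ← Complex.ofReal_mul]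
    refine le_trans (le_of_eq ?_) h
    rw [smul_smul]
    push_cast
    rw [mul_comm]

end Bounds

section Scalar
variable {κ : Type} [Fintype κ]

theorem exists_scalar_gap {c : ℝ} (hc : 0 < c) : ∃ δ : ℝ, 0 < δ ∧ ∀ x : κ → ℝ,
    (∀ i, x i ∈ Set.Icc (-1 : ℝ) 1) →
      δ ≤ c * ∑ i, (1 - x i ^ 2) + (1 / 2 - ∑ i, (1 - x i)) ^ 2 := by
  classical
  set φ : (κ → ℝ) → ℝ := fun x => c * ∑ i, (1 - x i ^ 2) + (1 / 2 - ∑ i, (1 - x i)) ^ 2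
  have hφ : Continuous φ := by fun_prop
  have hcomp : IsCompact (Set.Icc (fun _ : κ => (-1 : ℝ)) fun _ => 1) := isCompact_Icc
  obtain ⟨x, hx, hmin⟩ := hcomp.exists_isMinOn (Set.nonempty_Icc.mpr fun _ => by norm_num)
    hφ.continuousOn
  have hsq (i : κ) : 0 ≤ 1 - x i ^ 2 := by nlinarith [hx.1 i, hx.2 i]
  refine ⟨φ x, ?_, fun y hy => hmin ⟨fun i => (hy i).1, fun i => (hy i).2⟩⟩
  have h1 : 0 ≤ c * ∑ i, (1 - x i ^ 2) := mul_nonneg hc.le (Finset.sum_nonneg fun i _ => hsq i)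
  have h2 : 0 ≤ (1 / 2 - ∑ i, (1 - x i)) ^ 2 := sq_nonneg _
  refine lt_of_le_of_ne (add_nonneg h1 h2) fun h0 => ?_
  have h3 : c * ∑ i, (1 - x i ^ 2) = 0 := by
    change 0 = c * ∑ i, (1 - x i ^ 2) + (1 / 2 - ∑ i, (1 - x i)) ^ 2 at h0
    linarith
  have h4 : 1 / 2 - ∑ i, (1 - x i) = 0 := by
    change 0 = c * ∑ i, (1 - x i ^ 2) + (1 / 2 - ∑ i, (1 - x i)) ^ 2 at h0
    exact pow_eq_zero_iff (two_ne_zero) |>.mp (by linarith)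
  have h5 := (Finset.sum_eq_zero_iff_of_nonneg fun i _ => hsq i).mp
    ((mul_eq_zero.mp h3).resolve_left hc.ne')
  have h6 (i : κ) : 1 - x i = ((if x i = 1 then 0 else 2 : ℕ) : ℝ) := by
    have := h5 i (Finset.mem_univ i)
    have h : (1 - x i) * (1 + x i) = 0 := by linarith
    rcases mul_eq_zero.mp h with h | h
    · rw [if_pos (by linarith), h]; simp
    · rw [if_neg (by linarith)]; push_cast; linarith
  simp only [h6] at h4
  rw [← Nat.cast_sum] at h4
  have h7 : ((2 * ∑ i, (if x i = 1 then 0 else 2) : ℕ) : ℝ) = (1 : ℕ) := by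
    push_cast at h4 ⊢; linarith
  have := Nat.cast_injective h7
  omega

end Scalar

theorem sum_fin_cons {α M : Type*} [Fintype α] [AddCommMonoid M] {k : ℕ}
    (f : (Fin (k + 1) → α) → M) : ∑ x, f x = ∑ a, ∑ x, f (Fin.cons a x) := by
  rw [← (Fin.consEquiv fun _ => α).sum_comp, Fintype.sum_prod_type]
  rfl

section Projections
variable {W : Type} [Fintype W] [DecidableEq W]

/-- A complete orthogonal family of projections which diagonalises the involutions `s`, all of the
same rank. -/
structure IsResolution {k : ℕ} (s : Fin k → Matrix W W ℂ) (p : (Fin k → Fin 2) → Matrix W W ℂ) :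
    Prop where
  star : ∀ ε, (p ε)ᴴ = p ε
  mul_self : ∀ ε, p ε * p ε = p ε
  orth : ∀ ε ε', ε ≠ ε' → p ε * p ε' = 0
  sum : ∑ ε, p ε = 1
  mul : ∀ ε i, s i * p ε = (-1 : ℂ) ^ (ε i).val • p ε
  trace : ∀ ε, 2 ^ k * (p ε).trace = Fintype.card W
  comm : ∀ B, (∀ i, B * s i = s i * B) → ∀ ε, B * p ε = p ε * B

theorem exists_isResolution {k : ℕ} (s c : Fin k → Matrix W W ℂ) (hs : ∀ i, (s i)ᴴ = s i)
    (hss : ∀ i, s i * s i = 1) (hsc : ∀ i j, s i * s j = s j * s i) (hc : ∀ i, c i * c i = 1)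
    (hcs : ∀ i, c i * s i = -(s i * c i)) (hcs' : ∀ i j, i ≠ j → c i * s j = s j * c i) :
    ∃ p, IsResolution s p := by
  induction k with
  | zero =>
    refine ⟨fun _ => 1, fun _ => by simp, fun _ => by simp, fun ε ε' h => ?_, by simp,
      fun ε i => i.elim0, fun _ => by simp, fun B _ _ => by simp⟩
    exact (h (Subsingleton.elim _ _)).elim
  | succ k ih =>
    obtain ⟨p, hp⟩ := ih (fun i => s i.succ) (fun i => c i.succ) (fun i => hs _) (fun i => hss _)
      (fun i j => hsc _ _) (fun i => hc _) (fun i => hcs _)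
      (fun i j hij => hcs' _ _ fun h => hij (Fin.succ_injective _ h))
    set q : Fin 2 → Matrix W W ℂ := fun b => (1 / 2 : ℂ) • (1 + (-1 : ℂ) ^ b.val • s 0) with hq
    have h0 := hss 0
    have hsgn (b : Fin 2) : (-1 : ℂ) ^ b.val * (-1) ^ b.val = 1 := by
      rw [← mul_pow]; simp
    have hsq (b : Fin 2) : s 0 * q b = (-1 : ℂ) ^ b.val • q b := by
      simp only [hq, mul_smul_comm, mul_add, mul_one, h0, smul_add, smul_smul]
      rw [mul_left_comm, hsgn]
      module
    have hqq (b : Fin 2) : q b * q b = q b := by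
      have : q b * q b = (1 / 2 : ℂ) • (q b + (-1 : ℂ) ^ b.val • (s 0 * q b)) := by
        conv_lhs => enter [1]; rw [hq]
        simp only [smul_mul_assoc, add_mul, one_mul]
      rw [this, hsq, smul_smul, hsgn]
      module
    have hq_sum : q 0 + q 1 = 1 := by
      simp only [hq, Fin.val_zero, Fin.val_one, pow_zero, pow_one]
      module
    have hq_orth (b b' : Fin 2) (hb : b ≠ b') : q b * q b' = 0 := by
      have h1 : q 1 = 1 - q 0 := by rw [← hq_sum]; abel
      fin_cases b <;> fin_cases b' <;> first | exact (hb rfl).elim | skip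
      · change q 0 * q 1 = 0
        rw [h1, mul_sub, mul_one, hqq, sub_self]
      · change q 1 * q 0 = 0
        rw [h1, sub_mul, one_mul, hqq, sub_self]
    have hq_star (b : Fin 2) : (q b)ᴴ = q b := by
      simp only [hq, Matrix.conjTranspose_smul, Matrix.conjTranspose_add, Matrix.conjTranspose_one,
        hs]
      simp
    have hq_comm (B : Matrix W W ℂ) (hB : B * s 0 = s 0 * B) (b : Fin 2) : B * q b = q b * B := by
      simp only [hq, mul_smul_comm, smul_mul_assoc, mul_add, add_mul, mul_one, one_mul, hB]
    have hqp (b : Fin 2) (ε) : q b * p ε = p ε * q b := by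
      refine hp.comm _ (fun i => ?_) ε
      exact (hq_comm _ (hsc _ _) b).symm
    have hc0q : c 0 * q 1 = q 0 * c 0 := by
      simp only [hq, mul_smul_comm, smul_mul_assoc, mul_add, add_mul, mul_one, one_mul, hcs,
        Fin.val_zero, Fin.val_one, pow_zero, pow_one]
      module
    have hc0p (ε) : c 0 * p ε = p ε * c 0 :=
      hp.comm _ (fun i => hcs' _ _ (Fin.succ_ne_zero i).symm) ε
    have htr (ε) : (q 1 * p ε).trace = (q 0 * p ε).trace := by
      calc (q 1 * p ε).trace = (c 0 * (c 0 * q 1 * p ε)).trace := by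
            rw [mul_assoc, ← mul_assoc, hc, one_mul]
        _ = (q 0 * (c 0 * p ε) * c 0).trace := by rw [Matrix.trace_mul_comm, hc0q, mul_assoc (q 0)]
        _ = _ := by rw [hc0p, mul_assoc, mul_assoc (p ε), hc, mul_one]
    have htr2 (ε) : (q 0 * p ε).trace + (q 0 * p ε).trace = (p ε).trace := by
      conv_lhs => enter [2]; rw [← htr]
      rw [← Matrix.trace_add, ← add_mul, hq_sum, one_mul]
    refine ⟨fun ε => q (ε 0) * p (Fin.tail ε), fun ε => ?_, fun ε => ?_, fun ε ε' h => ?_, ?_,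
      fun ε i => ?_, fun ε => ?_, fun B hB ε => ?_⟩
    · rw [Matrix.conjTranspose_mul, hp.star, hq_star, hqp]
    · rw [mul_assoc, ← mul_assoc (p _), ← hqp, mul_assoc, ← mul_assoc, hqq, hp.mul_self]
    · rw [mul_assoc, ← mul_assoc (p _), ← hqp, mul_assoc, ← mul_assoc]
      rcases eq_or_ne (ε 0) (ε' 0) with h1 | h1
      · rw [hp.orth, mul_zero]
        intro h2
        apply h
        rw [← Fin.cons_self_tail ε, ← Fin.cons_self_tail ε', h1, h2]
      · rw [hq_orth _ _ h1, zero_mul]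
    · rw [sum_fin_cons]
      simp only [Fin.cons_zero, Fin.tail_cons, ← Finset.mul_sum, hp.sum,
        mul_one, Fin.sum_univ_two, hq_sum]
    · refine Fin.cases ?_ (fun i => ?_) i
      · rw [← mul_assoc, hsq, smul_mul_assoc]
      · rw [← mul_assoc, hq_comm _ (hsc _ _), mul_assoc, hp.mul, mul_smul_comm]
        rfl
    · have := hp.trace (Fin.tail ε)
      have h2 : (q (ε 0) * p (Fin.tail ε)).trace = (q 0 * p (Fin.tail ε)).trace := by
        rcases Fin.exists_fin_two.mp ⟨ε 0, rfl⟩ with h | h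
        · rw [h]
        · rw [h, htr]
      rw [h2, ← this, ← htr2]
      ring
    · rw [← mul_assoc, hq_comm _ (hB 0), mul_assoc, hp.comm _ (fun i => hB _), mul_assoc]

end Projections

section Count

theorem sum_telescope (N : ℕ) (ψ : ℕ → ℂ) :
    ∑ v ∈ Finset.range (2 * N + 1), (-1 : ℂ) ^ v * (ψ v + ψ (v + 1)) = ψ 0 + ψ (2 * N + 1) := by
  have h (n : ℕ) : ∑ v ∈ Finset.range n, (-1 : ℂ) ^ v * (ψ v + ψ (v + 1)) =
      ψ 0 - (-1) ^ n * ψ n := by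
    induction n with
    | zero => simp
    | succ n ih => rw [Finset.sum_range_succ, ih]; ring
  rw [h, pow_succ, pow_mul]
  simp

theorem sum_telescope_pi (N k : ℕ) (ψ : ℕ → ℂ) :
    ∑ b : Fin k → Fin 2, ∑ v : Fin k → Fin (2 * N + 1),
      (∏ i, (-1 : ℂ) ^ (v i).val) * ψ (∑ i, ((v i).val + (b i).val)) =
    ∑ u : Fin k → Fin 2, ψ (∑ i, (2 * N + 1) * (u i).val) := by
  induction k generalizing ψ with
  | zero => simp
  | succ k ih =>
    have h1 (b₀ : Fin 2) (v₀ : Fin (2 * N + 1)) := ih fun n => ψ (v₀.val + b₀.val + n)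
    have h2 (b₀ : Fin 2) :
        ∑ b : Fin k → Fin 2, ∑ v₀ : Fin (2 * N + 1), ∑ v : Fin k → Fin (2 * N + 1),
          ((-1 : ℂ) ^ v₀.val * ∏ i, (-1 : ℂ) ^ (v i).val) *
            ψ (v₀.val + b₀.val + ∑ i, ((v i).val + (b i).val)) =
        ∑ u : Fin k → Fin 2, ∑ v₀ : Fin (2 * N + 1), (-1 : ℂ) ^ v₀.val *
          ψ (v₀.val + b₀.val + ∑ i, (2 * N + 1) * (u i).val) := by
      rw [Finset.sum_comm, Finset.sum_comm (s := (Finset.univ : Finset (Fin k → Fin 2)))]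
      refine Finset.sum_congr rfl fun v₀ _ => ?_
      rw [← Finset.mul_sum, ← h1]
      simp only [Finset.mul_sum, mul_assoc]
    simp only [Fin.prod_univ_succ, Fin.sum_univ_succ (n := k)]
    rw [sum_fin_cons, sum_fin_cons]
    simp only [sum_fin_cons (k := k), Fin.cons_zero, Fin.cons_succ, h2]
    rw [Fin.sum_univ_two, Fin.sum_univ_two, ← Finset.sum_add_distrib, ← Finset.sum_add_distrib]
    refine Finset.sum_congr rfl fun u _ => ?_
    have := sum_telescope N fun n => ψ (n + ∑ i, (2 * N + 1) * (u i).val)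
    rw [← Fin.sum_univ_eq_sum_range
      (fun v => (-1 : ℂ) ^ v * (ψ (v + ∑ i, (2 * N + 1) * (u i).val) +
        ψ (v + 1 + ∑ i, (2 * N + 1) * (u i).val)))] at this
    rw [← Finset.sum_add_distrib]
    simpa [mul_add] using this

theorem sum_signs {N l : ℕ} (h : 2 * l < 3 * N) :
    ∑ b : Fin (2 * l) → Fin 2, ∑ v : Fin (2 * l) → Fin (2 * N + 1),
      (∏ i, (-1 : ℂ) ^ (v i).val) *
        (if 2 * ∑ i, ((v i).val + (b i).val) < N + 2 * l then 1 else -1) = 2 - 2 ^ (2 * l) := by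
  rw [sum_telescope_pi N (2 * l) fun n => if 2 * n < N + 2 * l then 1 else -1]
  have h1 (u : Fin (2 * l) → Fin 2) :
      (if 2 * ∑ i, (2 * N + 1) * (u i).val < N + 2 * l then 1 else -1 : ℂ) =
        (if u = 0 then 2 else 0) - 1 := by
    rcases eq_or_ne u 0 with rfl | hu
    · rw [if_pos, if_pos rfl]
      · norm_num
      · simp; omega
    · rw [if_neg, if_neg hu]
      · norm_num
      · obtain ⟨i, hi⟩ := Function.ne_iff.mp hu
        have h2 : 1 ≤ (u i).val := Nat.one_le_iff_ne_zero.mpr fun h => hi (Fin.ext h)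
        have h3 := Finset.single_le_sum (f := fun i => (2 * N + 1) * (u i).val)
          (fun _ _ => Nat.zero_le _) (Finset.mem_univ i)
        have h4 : (2 * N + 1) * 1 ≤ (2 * N + 1) * (u i).val := Nat.mul_le_mul_left _ h2
        have h5 : (2 * N + 1) * (u i).val ≤ ∑ i, (2 * N + 1) * (u i).val := h3
        omega
  simp only [h1, Finset.sum_sub_distrib, Finset.sum_ite_eq', Finset.mem_univ, if_true,
    Finset.sum_const, Finset.card_univ, Fintype.card_fun, Fintype.card_fin, nsmul_eq_mul]
  push_cast
  ring

end Count

section ResolutionMap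
variable {W V : Type} [Fintype W] [DecidableEq W] [Fintype V] [DecidableEq V] {k : ℕ}

/-- The operator with eigenvalue `φ ε v` on the joint eigenspace of a resolution `p` and of the
diagonal operators. -/
noncomputable def resMap (p : (Fin k → Fin 2) → Matrix W W ℂ) (φ : (Fin k → Fin 2) → V → ℂ) :
    Matrix (W × V) (W × V) ℂ :=
  ∑ ε, p ε ⊗ₖ Matrix.diagonal (φ ε)

variable {s : Fin k → Matrix W W ℂ} {p : (Fin k → Fin 2) → Matrix W W ℂ}

theorem resMap_mul (hp : IsResolution s p) (φ ψ : (Fin k → Fin 2) → V → ℂ) :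
    resMap p φ * resMap p ψ = resMap p (fun ε v => φ ε v * ψ ε v) := by
  rw [resMap, resMap, Finset.sum_mul_sum, resMap]
  refine Finset.sum_congr rfl fun ε _ => ?_
  rw [Finset.sum_eq_single ε]
  · rw [← Matrix.mul_kronecker_mul, hp.mul_self, Matrix.diagonal_mul_diagonal]
  · intro ε' _ h
    rw [← Matrix.mul_kronecker_mul, hp.orth _ _ h.symm, Matrix.zero_kronecker]
  · simp

theorem resMap_add (φ ψ : (Fin k → Fin 2) → V → ℂ) :
    resMap p φ + resMap p ψ = resMap p (fun ε v => φ ε v + ψ ε v) := by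
  simp only [resMap, ← Finset.sum_add_distrib, ← Matrix.kronecker_add, Matrix.diagonal_add]

theorem resMap_diagonal (hp : IsResolution s p) (φ : V → ℂ) :
    resMap p (fun _ => φ) = 1 ⊗ₖ Matrix.diagonal φ := by
  rw [resMap, ← sum_kron, hp.sum]

theorem resMap_const (hp : IsResolution s p) (c : ℂ) :
    resMap p (fun _ (_ : V) => c) = c • 1 := by
  rw [resMap_diagonal hp, ← Matrix.smul_one_eq_diagonal, Matrix.kronecker_smul,
    Matrix.one_kronecker_one]

theorem resMap_sum (hp : IsResolution s p) :
    resMap p (fun ε (_ : V) => ∑ i, (-1 : ℂ) ^ (ε i).val) = (∑ i, s i) ⊗ₖ 1 := by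
  have h : ∑ i, s i = ∑ ε, (∑ i, (-1 : ℂ) ^ (ε i).val) • p ε := by
    rw [← mul_one (∑ i, s i), ← hp.sum, Finset.mul_sum]
    refine Finset.sum_congr rfl fun ε _ => ?_
    simp only [Finset.sum_mul, hp.mul, Finset.sum_smul]
  rw [h, sum_kron, resMap]
  refine Finset.sum_congr rfl fun ε _ => ?_
  rw [← Matrix.smul_one_eq_diagonal, Matrix.kronecker_smul, Matrix.smul_kronecker]

theorem resMap_isHermitian (hp : IsResolution s p) (φ : (Fin k → Fin 2) → V → ℝ) :
    (resMap p (fun ε v => (φ ε v : ℂ))).IsHermitian := by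
  rw [Matrix.IsHermitian, resMap, Matrix.conjTranspose_sum]
  refine Finset.sum_congr rfl fun ε _ => ?_
  rw [Matrix.conjTranspose_kronecker, hp.star, Matrix.diagonal_conjTranspose]
  congr 2
  ext v
  simp

theorem le_resMap (hp : IsResolution s p) {φ : (Fin k → Fin 2) → V → ℝ} {c : ℝ}
    (h : ∀ ε v, c ≤ φ ε v) : (c : ℂ) • 1 ≤ resMap p (fun ε v => (φ ε v : ℂ)) := by
  rw [← resMap_const hp, ← sub_nonneg, resMap, resMap, ← Finset.sum_sub_distrib]
  refine Finset.sum_nonneg fun ε _ => ?_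
  rw [← kron_sub, Matrix.diagonal_sub]
  refine kron_nonneg (hp.mul_self ε ▸ mul_self_nonneg_of_isHermitian (hp.star ε)) ?_
  rw [Matrix.nonneg_iff_posSemidef, Matrix.posSemidef_diagonal_iff]
  intro v
  have := sub_nonneg.mpr (h ε v)
  exact_mod_cast this

theorem trace_resMap (hp : IsResolution s p) (φ : (Fin k → Fin 2) → V → ℂ) :
    2 ^ k * (resMap p φ).trace = Fintype.card W * ∑ ε, ∑ v, φ ε v := by
  rw [resMap, Matrix.trace_sum, Finset.mul_sum, Finset.mul_sum]
  refine Finset.sum_congr rfl fun ε _ => ?_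
  rw [Matrix.trace_kronecker, ← mul_assoc, hp.trace, Matrix.trace_diagonal]

end ResolutionMap

section Endpoint
variable {W V κ : Type} [Fintype W] [DecidableEq W] [Fintype V] [DecidableEq V] [Fintype κ]
  {c C : κ → Matrix W W ℂ} {Γ N : Matrix W W ℂ} {X Y Z : κ → Matrix V V ℂ}
  {R : Matrix V V ℂ} {η : ℝ} {a : ℂ}

theorem grading_mul_ham (hF : IsFrame c C Γ N) (hS : SpinFamily η X Y Z R) (hN : N = 0) :
    (Γ ⊗ₖ R) * ham c C Γ N X Y Z a = ham c C Γ N X Y Z a * (Γ ⊗ₖ R) := by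
  have hg : R * gapOp X a = gapOp X a * R := by
    simp only [gapOp, mul_sub, sub_mul, Finset.mul_sum, Finset.sum_mul, hS.mulRX, mul_one, one_mul,
      mul_smul_comm, smul_mul_assoc]
  have h1 (i : κ) : Γ * c i = -(c i * Γ) := by rw [hF.antiPΓ, neg_neg]
  have h2 (i : κ) : Γ * C i = -(C i * Γ) := by rw [hF.antiCΓ, neg_neg]
  simp only [ham, hN, Matrix.zero_kronecker, add_zero, mul_add, add_mul, Finset.mul_sum,
    Finset.sum_mul, ← Matrix.mul_kronecker_mul, hg, h1, h2, hS.mulRY, hS.mulRZ, neg_kron, kron_neg,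
    neg_neg]

/-- The involutions `-i c C`. -/
noncomputable def flip (c C : κ → Matrix W W ℂ) (i : κ) : Matrix W W ℂ :=
  -(Complex.I • (c i * C i))

/-- The perturbed scalar part. -/
noncomputable def gapFlip (c C : κ → Matrix W W ℂ) (X : κ → Matrix V V ℂ) (η : ℝ) (a : ℂ) :
    Matrix (W × V) (W × V) ℂ :=
  1 ⊗ₖ gapOp X a + (η / 2 : ℂ) • (∑ i, flip c C i) ⊗ₖ 1

theorem flip_conjTranspose (hF : IsFrame c C Γ N) (i : κ) : (flip c C i)ᴴ = flip c C i := by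
  rw [flip, Matrix.conjTranspose_neg, Matrix.conjTranspose_smul, Matrix.conjTranspose_mul, hF.starP,
    hF.starC, hF.antiPC]
  simp

theorem grading_mul_flip (hF : IsFrame c C Γ N) (i : κ) : Γ * flip c C i = flip c C i * Γ := by
  have h1 : Γ * c i = -(c i * Γ) := by rw [hF.antiPΓ, neg_neg]
  have h2 : Γ * C i = -(C i * Γ) := by rw [hF.antiCΓ, neg_neg]
  rw [flip, mul_neg, mul_smul_comm, ← mul_assoc, h1, neg_mul, mul_assoc, h2, mul_neg, neg_neg,
    neg_mul, smul_mul_assoc, mul_assoc]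

theorem mul_flip (hc : ∀ i, c i * c i = 1) (i : κ) : c i * flip c C i = -(Complex.I • C i) := by
  rw [flip, mul_neg, mul_smul_comm, ← mul_assoc, hc, one_mul]

theorem flip_mul (hF : IsFrame c C Γ N) (hc : ∀ i, c i * c i = 1) (i : κ) :
    flip c C i * c i = Complex.I • C i := by
  rw [flip, hF.antiPC, neg_mul, smul_mul_assoc, neg_mul, mul_assoc, hc, mul_one]
  simp

theorem mul_flip' (hF : IsFrame c C Γ N) (i : κ) : C i * flip c C i = Complex.I • c i := by
  rw [flip, hF.antiPC, mul_neg, mul_smul_comm, mul_neg, ← mul_assoc, hF.sqC, one_mul]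
  simp

theorem flip_mul' (hF : IsFrame c C Γ N) (i : κ) : flip c C i * C i = -(Complex.I • c i) := by
  rw [flip, neg_mul, smul_mul_assoc, mul_assoc, hF.sqC, mul_one]

theorem flip_mul_flip (hF : IsFrame c C Γ N) (hc : ∀ i, c i * c i = 1) (i : κ) :
    flip c C i * flip c C i = 1 := by
  conv_lhs => enter [2]; rw [flip]
  rw [mul_neg, mul_smul_comm, ← mul_assoc, flip_mul hF hc, smul_mul_assoc, hF.sqC, smul_smul]
  simp

theorem mul_flip_of_ne (hF : IsFrame c C Γ N) (hcc : ∀ i j, i ≠ j → c i * c j = -(c j * c i))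
    {i j : κ} (h : i ≠ j) : c i * flip c C j = flip c C j * c i := by
  have h1 : C j * c i = -(c i * C j) := by rw [hF.antiPC, neg_neg]
  rw [flip, mul_neg, mul_smul_comm, ← mul_assoc, hcc i j h, neg_mul, neg_mul, smul_mul_assoc, mul_assoc,
    mul_assoc, h1, mul_neg]

theorem mul_flip_of_ne' (hF : IsFrame c C Γ N) {i j : κ} (h : i ≠ j) :
    C i * flip c C j = flip c C j * C i := by
  have h1 : C i * c j = -(c j * C i) := by rw [hF.antiPC, neg_neg]
  rw [flip, mul_neg, mul_smul_comm, ← mul_assoc, h1, neg_mul, neg_mul, smul_mul_assoc, mul_assoc,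
    mul_assoc, hF.antiCC i j h, mul_neg, neg_neg]

theorem flip_comm (hF : IsFrame c C Γ N) (hcc : ∀ i j, i ≠ j → c i * c j = -(c j * c i))
    (i j : κ) : flip c C i * flip c C j = flip c C j * flip c C i := by
  rcases eq_or_ne i j with rfl | h
  · rfl
  · conv_lhs => enter [1]; rw [flip]
    conv_rhs => enter [2]; rw [flip]
    rw [neg_mul, smul_mul_assoc, mul_assoc, mul_flip_of_ne' hF h, ← mul_assoc,
      mul_flip_of_ne hF hcc h, mul_neg, mul_smul_comm, mul_assoc]

theorem mul_gapFlip (hF : IsFrame c C Γ N) (hc : ∀ i, c i * c i = 1)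
    (hcc : ∀ i j, i ≠ j → c i * c j = -(c j * c i)) (hS : SpinFamily η X Y Z R) :
    (∑ i, c i ⊗ₖ Z i + ∑ i, C i ⊗ₖ Y i) * gapFlip c C X η a =
      gapFlip c C X η a * (∑ i, c i ⊗ₖ Z i + ∑ i, C i ⊗ₖ Y i) := by
  rw [← Finset.sum_add_distrib, Finset.sum_mul, Finset.mul_sum]
  refine Finset.sum_congr rfl fun i _ => ?_
  have hZ : Z i * gapOp X a - gapOp X a * Z i = (-(Complex.I * η)) • Y i := by
    refine mul_gapOp_sub i ?_ fun j hj => (hS.commXZ j i hj).symm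
    rw [hS.lieXZ]; module
  have hY : Y i * gapOp X a - gapOp X a * Y i = (Complex.I * η) • Z i :=
    mul_gapOp_sub i (hS.lieYX i) fun j hj => (hS.commXY j i hj).symm
  have hs : c i * (∑ j, flip c C j) - (∑ j, flip c C j) * c i = (-(2 * Complex.I)) • C i := by
    rw [Finset.mul_sum, Finset.sum_mul, ← Finset.sum_sub_distrib, Finset.sum_eq_single i]
    · rw [mul_flip hc, flip_mul hF hc]; module
    · intro j _ hj
      rw [mul_flip_of_ne hF hcc hj.symm, sub_self]
    · simp
  have hs' : C i * (∑ j, flip c C j) - (∑ j, flip c C j) * C i = (2 * Complex.I) • c i := by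
    rw [Finset.mul_sum, Finset.sum_mul, ← Finset.sum_sub_distrib, Finset.sum_eq_single i]
    · rw [mul_flip' hF, flip_mul' hF]; module
    · intro j _ hj
      rw [mul_flip_of_ne' hF hj.symm, sub_self]
    · simp
  rw [← sub_eq_zero]
  have h1 : (c i ⊗ₖ Z i + C i ⊗ₖ Y i) * gapFlip c C X η a -
      gapFlip c C X η a * (c i ⊗ₖ Z i + C i ⊗ₖ Y i) =
      c i ⊗ₖ (Z i * gapOp X a - gapOp X a * Z i) + C i ⊗ₖ (Y i * gapOp X a - gapOp X a * Y i) +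
      (η / 2 : ℂ) • ((c i * (∑ j, flip c C j) - (∑ j, flip c C j) * c i) ⊗ₖ Z i +
        (C i * (∑ j, flip c C j) - (∑ j, flip c C j) * C i) ⊗ₖ Y i) := by
    simp only [gapFlip, mul_add, add_mul, mul_smul_comm, smul_mul_assoc, ← Matrix.mul_kronecker_mul,
      mul_one, one_mul, kron_sub, sub_kron]
    module
  rw [h1, hZ, hY, hs, hs']
  simp only [Matrix.kronecker_smul, Matrix.smul_kronecker]
  module

end Endpoint

section Endpoint
variable {k j : ℕ}

theorem gapOp_modeX (hj : j ≠ 0) (a : ℝ) : gapOp (modeX k j) (a : ℂ) =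
    .diagonal fun v => ((a - ∑ i, ((v i).val : ℝ) / j : ℝ) : ℂ) := by
  have hj' : (j : ℂ) ≠ 0 := by exact_mod_cast hj
  have h (i : Fin k) : 1 - modeX k j i = .diagonal fun v => ((v i).val : ℂ) / j := by
    rw [modeX_eq_diagonal, ← Matrix.diagonal_one, Matrix.diagonal_sub]
    congr 1
    ext v
    push_cast
    field_simp
    ring
  rw [gapOp, Matrix.smul_one_eq_diagonal]
  simp only [h]
  ext v w
  rcases eq_or_ne v w with rfl | hvw
  · simp [Matrix.sum_apply]
  · simp [Matrix.sum_apply, hvw]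

/-- The eigenvalues of the perturbed scalar part. -/
noncomputable def gapValue (k j : ℕ) (ε : Fin k → Fin 2) (v : Fin k → Fin (2 * j + 1)) : ℝ :=
  (j + k - 2 * ∑ i, ((v i).val + (ε i).val : ℕ)) / (2 * j)

/-- The signs of the eigenvalues of the perturbed scalar part. -/
noncomputable def gapSign (k j : ℕ) (ε : Fin k → Fin 2) (v : Fin k → Fin (2 * j + 1)) : ℝ :=
  if 2 * ∑ i, ((v i).val + (ε i).val) < j + k then 1 else -1

theorem gapSign_mul_self (ε : Fin k → Fin 2) (v : Fin k → Fin (2 * j + 1)) :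
    gapSign k j ε v * gapSign k j ε v = 1 := by
  rw [gapSign]; split_ifs <;> norm_num

theorem le_gapSign_mul (hj : Odd j) (hk : Even k) (ε : Fin k → Fin 2)
    (v : Fin k → Fin (2 * j + 1)) :
    1 / (2 * j : ℝ) ≤ gapSign k j ε v * gapValue k j ε v := by
  have hj0 : (0 : ℝ) < 2 * j := by exact_mod_cast Nat.mul_pos two_pos hj.pos
  rw [gapSign, gapValue, mul_div_assoc', div_le_div_iff_of_pos_right hj0]
  set n := ∑ i, ((v i).val + (ε i).val)
  split_ifs with h
  · have h1 : 2 * n + 1 ≤ j + k := h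
    have : (2 * n + 1 : ℝ) ≤ j + k := by exact_mod_cast h1
    linarith
  · have h1 : j + k + 1 ≤ 2 * n := by
      obtain ⟨a, rfl⟩ := hj
      obtain ⟨b, rfl⟩ := hk
      omega
    have : (j + k + 1 : ℝ) ≤ 2 * n := by exact_mod_cast h1
    linarith

theorem le_gapValue_mul_self (hj : Odd j) (hk : Even k) (ε : Fin k → Fin 2)
    (v : Fin k → Fin (2 * j + 1)) :
    1 / (2 * j : ℝ) ^ 2 ≤ gapValue k j ε v * gapValue k j ε v := by
  have h1 := le_gapSign_mul hj hk ε v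
  have h0 : (0 : ℝ) ≤ 1 / (2 * j) := by positivity
  calc _ = 1 / (2 * j : ℝ) * (1 / (2 * j)) := by ring
    _ ≤ (gapSign k j ε v * gapValue k j ε v) * (gapSign k j ε v * gapValue k j ε v) :=
      mul_le_mul h1 h1 h0 (h0.trans h1)
    _ = (gapSign k j ε v * gapSign k j ε v) * (gapValue k j ε v * gapValue k j ε v) := by ring
    _ = _ := by rw [gapSign_mul_self, one_mul]

variable {W : Type} [Fintype W] [DecidableEq W] {c C : Fin k → Matrix W W ℂ} {Γ : Matrix W W ℂ}

theorem gapFlip_eq_resMap (hj : j ≠ 0) {p : (Fin k → Fin 2) → Matrix W W ℂ}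
    (hp : IsResolution (flip c C) p) :
    gapFlip c C (modeX k j) (1 / j : ℝ) ((1 / 2 : ℝ) : ℂ) =
      resMap p fun ε v => (gapValue k j ε v : ℂ) := by
  have hj' : (j : ℂ) ≠ 0 := by exact_mod_cast hj
  have h1 : (((1 / j : ℝ) : ℂ) / 2) • ((∑ i, flip c C i) ⊗ₖ
      (1 : Matrix (Fin k → Fin (2 * j + 1)) _ ℂ)) =
      resMap p fun ε _ => ((1 / j : ℝ) : ℂ) / 2 * ∑ i, (-1 : ℂ) ^ (ε i).val := by
    rw [← resMap_sum hp, ← one_mul (resMap p fun ε _ => ∑ i, (-1 : ℂ) ^ (ε i).val),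
      ← smul_mul_assoc, ← resMap_const hp, resMap_mul hp]
  rw [gapFlip, h1, gapOp_modeX hj, ← resMap_diagonal hp, resMap_add]
  congr 1
  ext ε v
  have h2 (i : Fin k) : (-1 : ℂ) ^ (ε i).val = 1 - 2 * (ε i).val := by
    rcases Fin.exists_fin_two.mp ⟨ε i, rfl⟩ with h | h <;> rw [h] <;> norm_num
  simp only [h2, gapValue, Finset.sum_sub_distrib, ← Finset.mul_sum, Finset.sum_add_distrib,
    ← Finset.sum_div]
  push_cast
  simp only [Finset.sum_const, Finset.card_univ, Fintype.card_fin]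
  field_simp
  simp
  ring

/-- At the endpoint of the twisted homotopy, the signature can be computed explicitly. -/
theorem trace_sign_of_gap {l : ℕ} {c C : Fin (2 * l) → Matrix W W ℂ} (hF : IsFrame c C Γ 0)
    (hc : ∀ i, c i * c i = 1) (hcc : ∀ i i', i ≠ i' → c i * c i' = -(c i' * c i)) (hj : Odd j)
    (hlj : 2 * l < 3 * j) {ε : ℝ} (hε : (2 * l : ℝ) ^ 2 * (1 / (2 * j) ^ 2) < ε)
    (hgap : (ε : ℂ) • 1 ≤ ham c C Γ 0 (modeX _ j) (modeY _ j) (modeZ _ j) ((1 / 2 : ℝ) : ℂ) *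
      ham c C Γ 0 (modeX _ j) (modeY _ j) (modeZ _ j) ((1 / 2 : ℝ) : ℂ))
    {S : Matrix (W × (Fin (2 * l) → Fin (2 * j + 1))) (W × (Fin (2 * l) → Fin (2 * j + 1))) ℂ}
    (hS : IsSign S ((Γ ⊗ₖ modeR _ j) *
      ham c C Γ 0 (modeX _ j) (modeY _ j) (modeZ _ j) ((1 / 2 : ℝ) : ℂ))) :
    2 ^ (2 * l) * S.trace = Fintype.card W * (2 - 2 ^ (2 * l)) := by
  have hj0 : j ≠ 0 := hj.pos.ne'
  have hjR : (0 : ℝ) < j := by exact_mod_cast hj.pos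
  have hk : Even (2 * l) := even_two_mul l
  have hM := spinFamily_mode (2 * l) j hj0
  have hsf := flip_mul_flip hF hc
  obtain ⟨p, hp⟩ := exists_isResolution (flip c C) c (flip_conjTranspose hF) hsf
    (flip_comm hF hcc) hc (fun i => by rw [mul_flip hc, flip_mul hF hc])
    (fun i i' h => mul_flip_of_ne hF hcc h)
  have hgval := gapFlip_eq_resMap (j := j) hj0 hp
  have hMg := mul_gapFlip (a := ((1 / 2 : ℝ) : ℂ)) hF hc hcc hM
  set X := modeX (2 * l) j
  set Y := modeY (2 * l) j
  set Z := modeZ (2 * l) j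
  set R := modeR (2 * l) j with hR
  set η : ℝ := 1 / j with hη
  set H := ham c C Γ 0 X Y Z ((1 / 2 : ℝ) : ℂ) with hHdef
  set g := gapFlip c C X η ((1 / 2 : ℝ) : ℂ) with hgdef
  set D := ∑ i, c i ⊗ₖ Z i + ∑ i, C i ⊗ₖ Y i with hD
  set G := Γ ⊗ₖ R with hG
  set Γ' := Γ ⊗ₖ (1 : Matrix (Fin (2 * l) → Fin (2 * j + 1)) (Fin (2 * l) → Fin (2 * j + 1)) ℂ) with hΓ'
  have hRs : Rᴴ = R := hM.starR
  have hGs : Gᴴ = G := by rw [hG, Matrix.conjTranspose_kronecker, hF.starΓ, hRs]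
  have hGG : G * G = 1 := by
    rw [hG, ← Matrix.mul_kronecker_mul, hF.sqΓ, hM.mulRR, Matrix.one_kronecker_one]
  have hGdet : G.det ≠ 0 := by
    intro h
    have := congrArg Matrix.det hGG
    simp [h] at this
  have hGH : G * H = H * G := grading_mul_ham hF hM rfl
  have hHs : Hᴴ = H := ham_isHermitian hF hM (by simp)
  -- first homotopy
  set E : ℝ → Fin (2 * l) → Matrix (W × (Fin (2 * l) → Fin (2 * j + 1))) (W × (Fin (2 * l) → Fin (2 * j + 1))) ℂ :=
    fun t i => ((t * (η / 2) : ℝ) : ℂ) • ((Γ * flip c C i) ⊗ₖ 1) with hE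
  have hEs (t : ℝ) (i) : (E t i)ᴴ = E t i := by
    simp only [hE, Matrix.conjTranspose_smul, Matrix.conjTranspose_kronecker,
      Matrix.conjTranspose_mul, hF.starΓ, flip_conjTranspose hF, Matrix.conjTranspose_one,
      grading_mul_flip hF]
    simp
  have hGE (t : ℝ) (i) : G * E t i = E t i * G := by
    rw [hE, mul_smul_comm, smul_mul_assoc, hG, ← Matrix.mul_kronecker_mul,
      ← Matrix.mul_kronecker_mul, mul_one, one_mul, mul_assoc, ← grading_mul_flip hF]
  have hEE (t : ℝ) (i) : E t i * E t i = (((t * (η / 2)) ^ 2 : ℝ) : ℂ) • 1 := by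
    rw [hE, smul_mul_assoc, mul_smul_comm, smul_smul, ← Matrix.mul_kronecker_mul, mul_one]
    have : Γ * flip c C i * (Γ * flip c C i) = 1 := by
      rw [mul_assoc, ← mul_assoc (flip c C i), ← grading_mul_flip hF, mul_assoc Γ (flip c C i), hsf,
        mul_one, hF.sqΓ]
    rw [this, Matrix.one_kronecker_one]
    push_cast
    rw [pow_two]
  have hsum (t : ℝ) : ∑ i, E t i = (t : ℂ) • ((η / 2 : ℂ) • Γ' * ((∑ i, flip c C i) ⊗ₖ 1)) := by
    rw [hΓ', sum_kron, smul_mul_assoc, Finset.mul_sum, Finset.smul_sum, Finset.smul_sum]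
    refine Finset.sum_congr rfl fun i _ => ?_
    rw [← Matrix.mul_kronecker_mul, mul_one, smul_smul]
    simp only [hE]
    push_cast
    rfl
  have hend : H + ∑ i, E 1 i = D + Γ' * g := by
    rw [hsum, hgdef, gapFlip, mul_add, hΓ', ← Matrix.mul_kronecker_mul, mul_one, one_mul, hHdef,
      ham, hD, Matrix.zero_kronecker, Complex.ofReal_one, one_smul, mul_smul_comm, smul_mul_assoc]
    abel
  have hDs : Dᴴ = D := by
    have hY (i) : (Y i)ᴴ = Y i := hM.starY i
    have hZ (i) : (Z i)ᴴ = Z i := hM.starZ i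
    simp only [hD, Matrix.conjTranspose_add, Matrix.conjTranspose_sum,
      Matrix.conjTranspose_kronecker, hF.starP, hF.starC, hY, hZ]
  have hgs : gᴴ = g := by
    rw [hgval]
    exact resMap_isHermitian hp _
  have hΓs : Γ'ᴴ = Γ' := by
    rw [hΓ', Matrix.conjTranspose_kronecker, hF.starΓ, Matrix.conjTranspose_one]
  have hΓΓ : Γ' * Γ' = 1 := by
    rw [hΓ', ← Matrix.mul_kronecker_mul, hF.sqΓ, mul_one, Matrix.one_kronecker_one]
  have hDΓ : D * Γ' = -(Γ' * D) := by
    simp only [hD, hΓ', add_mul, mul_add, Finset.sum_mul, Finset.mul_sum,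
      ← Matrix.mul_kronecker_mul, mul_one, one_mul, hF.antiPΓ, hF.antiCΓ, neg_kron,
      Finset.sum_neg_distrib]
    abel
  have hΓg : Γ' * g = g * Γ' := by
    have : Γ * (∑ i, flip c C i) = (∑ i, flip c C i) * Γ := by
      simp only [Finset.sum_mul, Finset.mul_sum, grading_mul_flip hF]
    simp only [hgdef, gapFlip, hΓ', add_mul, mul_add, ← Matrix.mul_kronecker_mul, mul_one, one_mul,
      mul_smul_comm, smul_mul_assoc, this]
  have hGD : G * D = D * G := by
    have h1 (i) : Γ * c i = -(c i * Γ) := by rw [hF.antiPΓ, neg_neg]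
    have h2 (i) : Γ * C i = -(C i * Γ) := by rw [hF.antiCΓ, neg_neg]
    simp only [hD, hG, add_mul, mul_add, Finset.sum_mul, Finset.mul_sum,
      ← Matrix.mul_kronecker_mul, h1, h2, hM.mulRY, hM.mulRZ, neg_kron, kron_neg, neg_neg]
  have hGΓ : G * Γ' = 1 ⊗ₖ R := by
    rw [hG, hΓ', ← Matrix.mul_kronecker_mul, hF.sqΓ, mul_one]
  have hGΓ' : Γ' * G = 1 ⊗ₖ R := by
    rw [hG, hΓ', ← Matrix.mul_kronecker_mul, hF.sqΓ, one_mul]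
  have hRval : (1 : Matrix W W ℂ) ⊗ₖ R =
      resMap p fun _ v => ((∏ i, (-1 : ℝ) ^ (v i).val : ℝ) : ℂ) := by
    rw [resMap_diagonal hp, hR, modeR_eq_diagonal]
    push_cast
    rfl
  have hRg : (1 ⊗ₖ R) * g = g * (1 ⊗ₖ R) := by
    rw [hRval, hgval, resMap_mul hp, resMap_mul hp]
    simp only [mul_comm]
  have hgg : ((1 / (2 * j) ^ 2 : ℝ) : ℂ) • 1 ≤ g * g := by
    rw [hgval, resMap_mul hp]
    have := le_resMap hp (φ := fun ε v => gapValue (2 * l) j ε v * gapValue (2 * l) j ε v)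
      (fun ε v => le_gapValue_mul_self hj hk ε v)
    push_cast at this ⊢
    exact this
  have hherm {A : Matrix (W × (Fin (2 * l) → Fin (2 * j + 1))) (W × (Fin (2 * l) → Fin (2 * j + 1))) ℂ} (hA : Aᴴ = A)
      (hGA : G * A = A * G) : (G * A).IsHermitian := by
    rw [Matrix.IsHermitian, Matrix.conjTranspose_mul, hA, hGs, hGA]
  -- the sign at the end
  set T := resMap p fun ε v => (((∏ i, (-1 : ℝ) ^ (v i).val) * gapSign (2 * l) j ε v : ℝ) : ℂ)
  have hGΓg : G * (Γ' * g) = Γ' * g * G := by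
    rw [← mul_assoc, hGΓ, hRg, hΓg, mul_assoc, hGΓ']
  have hprod (v : Fin (2 * l) → Fin (2 * j + 1)) :
      (∏ i, (-1 : ℝ) ^ (v i).val) * ∏ i, (-1 : ℝ) ^ (v i).val = 1 := by
    rw [← Finset.prod_mul_distrib]
    exact Finset.prod_eq_one fun i _ => by rw [← mul_pow]; simp
  have hT : IsSign T (G * (Γ' * g)) := by
    refine ⟨resMap_isHermitian hp _, hherm (by
      rw [Matrix.conjTranspose_mul, hΓs, hgs, hΓg]) hGΓg, ?_, ?_⟩
    · rw [resMap_mul hp, ← one_smul ℂ (1 : Matrix _ _ ℂ), ← resMap_const hp]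
      congr 1
      ext ε v
      rw [← Complex.ofReal_mul, mul_mul_mul_comm, hprod, gapSign_mul_self]
      simp
    · rw [← mul_assoc G, hGΓ, hRval, hgval, resMap_mul hp, resMap_mul hp]
      have := le_resMap hp (φ := fun ε v => gapSign (2 * l) j ε v * gapValue (2 * l) j ε v)
        (fun ε v => le_gapSign_mul hj hk ε v)
      convert posDef_of_le (by positivity) this using 3 with ε
      funext v
      rw [← Complex.ofReal_mul, ← Complex.ofReal_mul, mul_mul_mul_comm, hprod, one_mul]
  have hdet (t : ℝ) : (G * ((t : ℂ) • D + Γ' * g)).det ≠ 0 := by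
    rw [Matrix.det_mul]
    refine mul_ne_zero hGdet (det_ne_zero_of_le (ε := 1 / (2 * j) ^ 2) (by positivity) ?_)
    have h1 : ((t : ℂ) • D + Γ' * g) * ((t : ℂ) • D + Γ' * g) =
        g * g + (t : ℂ) • D * (t : ℂ) • D := by
      have h2 : D * (Γ' * g) = -(Γ' * g * D) := by
        rw [← mul_assoc, hDΓ, neg_mul, mul_assoc, hMg, mul_assoc]
      have h3 : Γ' * g * (Γ' * g) = g * g := by
        rw [mul_assoc, ← mul_assoc g, ← hΓg, mul_assoc Γ' g, ← mul_assoc, hΓΓ, one_mul]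
      rw [add_mul, mul_add, mul_add, h3, smul_mul_assoc, smul_mul_assoc, h2, mul_smul_comm _ (Γ' * g)]
      module
    rw [h1]
    exact hgg.trans (le_add_of_nonneg_right (mul_self_nonneg_of_isHermitian (by
      rw [Matrix.conjTranspose_smul, hDs]; simp)))
  obtain ⟨S', hS', -⟩ := exists_isSign (H := G * (D + Γ' * g)) (hherm (by
    rw [Matrix.conjTranspose_add, hDs, Matrix.conjTranspose_mul, hΓs, hgs, hΓg])
    (by rw [mul_add, add_mul, hGD, hGΓg])) (by simpa using hdet 1)
  have hSS' : S.trace = S'.trace := by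
    refine trace_sign_eq_of_path (H := fun t => G * (H + ∑ i, E t i)) ?_ (fun t => ?_)
      (fun t ht => ?_) ?_ ?_
    · simp only [hsum]
      fun_prop
    · refine hherm ?_ ?_
      · rw [Matrix.conjTranspose_add, Matrix.conjTranspose_sum, hHs]
        simp only [hEs]
      · rw [mul_add, add_mul, hGH, Finset.mul_sum, Finset.sum_mul]
        simp only [hGE]
    · rw [Matrix.det_mul]
      refine mul_ne_zero hGdet (det_add_ne_zero hHs ?_ hε hgap ?_)
      · rw [Matrix.conjTranspose_sum]
        simp only [hEs]
      · have := sum_mul_self_le (hEs t) (r := 1 / (2 * j) ^ 2) fun i => by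
          rw [hEE]
          refine smul_le_smul_of_nonneg_right (Complex.real_le_real.mpr ?_) zero_le_one
          rw [mul_pow, hη, div_div, mul_comm (j : ℝ), div_pow, one_pow]
          exact mul_le_of_le_one_left (by positivity) (pow_le_one₀ ht.1 ht.2)
        simpa using this
    · have h0 : ∑ i, E 0 i = 0 := by rw [hsum]; simp
      change IsSign S (G * (H + ∑ i, E 0 i))
      rwa [h0, add_zero]
    · rwa [hend]
  have hS'T : S'.trace = T.trace := by
    refine (trace_sign_eq_of_path (H := fun t => G * ((t : ℂ) • D + Γ' * g)) ?_ (fun t => ?_)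
      (fun t ht => ?_) (S := T) (T := S') ?_ ?_).symm
    · fun_prop
    · refine hherm ?_ ?_
      · rw [Matrix.conjTranspose_add, Matrix.conjTranspose_smul, hDs, Matrix.conjTranspose_mul, hΓs,
          hgs, hΓg]
        simp
      · rw [mul_add, add_mul, hGΓg, mul_smul_comm, hGD, smul_mul_assoc]
    · exact hdet t
    · simpa using hT
    · simpa using hS'
  rw [hSS', hS'T, trace_resMap hp, ← sum_signs hlj]
  congr 1
  refine Finset.sum_congr rfl fun ε _ => Finset.sum_congr rfl fun v _ => ?_
  rw [gapSign]
  push_cast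
  split_ifs <;> simp

end Endpoint

section Uniform

theorem smul_one_mono {ι : Type} [Fintype ι] [DecidableEq ι] {x y : ℝ} (h : x ≤ y) :
    (x : ℂ) • (1 : Matrix ι ι ℂ) ≤ (y : ℂ) • 1 :=
  smul_le_smul_of_nonneg_right (Complex.real_le_real.mpr h) zero_le_one

theorem le_diagonal {V : Type} [Fintype V] [DecidableEq V] {φ : V → ℝ} {δ : ℝ}
    (h : ∀ v, δ ≤ φ v) : (δ : ℂ) • 1 ≤ Matrix.diagonal fun v => (φ v : ℂ) := by
  rw [Matrix.le_iff, Matrix.smul_one_eq_diagonal, Matrix.diagonal_sub,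
    Matrix.posSemidef_diagonal_iff]
  intro v
  have := sub_nonneg.mpr (h v)
  exact_mod_cast this

theorem le_modeX_gap {k j : ℕ} (hj : j ≠ 0) {c δ : ℝ}
    (hδ : ∀ x : Fin k → ℝ, (∀ i, x i ∈ Set.Icc (-1 : ℝ) 1) →
      δ ≤ c * ∑ i, (1 - x i ^ 2) + (1 / 2 - ∑ i, (1 - x i)) ^ 2) :
    (δ : ℂ) • 1 ≤ (c : ℂ) • ∑ i, (1 - modeX k j i * modeX k j i) +
      gapOp (modeX k j) ((1 / 2 : ℝ) : ℂ) * gapOp (modeX k j) ((1 / 2 : ℝ) : ℂ) := by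
  have hj' : (0 : ℝ) < j := by exact_mod_cast Nat.pos_of_ne_zero hj
  have h (v : Fin k → Fin (2 * j + 1)) := hδ (fun i => ((j - (v i).val) / j : ℝ)) fun i => by
    have : ((v i).val : ℝ) ≤ 2 * j := by exact_mod_cast Nat.le_of_lt_succ (v i).isLt
    have h0 : (0 : ℝ) ≤ (v i).val := Nat.cast_nonneg _
    rw [Set.mem_Icc, le_div_iff₀ hj', div_le_iff₀ hj']
    constructor <;> linarith
  refine (le_diagonal h).trans (le_of_eq ?_)
  rw [gapOp_modeX hj, Matrix.diagonal_mul_diagonal]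
  simp only [modeX_eq_diagonal, Matrix.diagonal_mul_diagonal, ← Matrix.diagonal_one,
    Matrix.diagonal_sub]
  have h2 (v : Fin k → Fin (2 * j + 1)) :
      ∑ i, ((v i).val : ℝ) / j = ∑ i, (1 - (j - (v i).val) / j : ℝ) :=
    Finset.sum_congr rfl fun i _ => by field_simp; ring
  simp only [h2]
  ext v w
  rcases eq_or_ne v w with rfl | hvw
  · simp [Matrix.sum_apply, pow_two]
  · simp [Matrix.sum_apply, hvw]

theorem exists_le_ham (k : ℕ) {c b : ℝ} (hc0 : 0 < c) (hc1 : c ≤ 1) (hb1 : 1 ≤ b) :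
    ∃ ε : ℝ, 0 < ε ∧ ∃ J : ℕ, ∀ j ≥ J, j ≠ 0 ∧ k < 3 * j ∧ (k : ℝ) ^ 2 * (1 / (2 * j) ^ 2) < ε ∧
      ∀ {W : Type} [Fintype W] [DecidableEq W] {P C : Fin k → Matrix W W ℂ} {Γ N : Matrix W W ℂ},
        IsFrame P C Γ N → (∀ z : Fin k → ℝ, ((c * ∑ i, z i ^ 2 : ℝ) : ℂ) • 1 ≤
          (∑ i, (z i : ℂ) • P i + N) * (∑ i, (z i : ℂ) • P i + N)) →
        (∀ i, P i * P i ≤ (b : ℂ) • 1) →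
        (ε : ℂ) • 1 ≤ ham P C Γ N (modeX _ j) (modeY _ j) (modeZ _ j) ((1 / 2 : ℝ) : ℂ) *
          ham P C Γ N (modeX _ j) (modeY _ j) (modeZ _ j) ((1 / 2 : ℝ) : ℂ) := by
  obtain ⟨δ, hδ0, hδ⟩ := exists_scalar_gap (κ := Fin k) hc0
  obtain ⟨J, hJ⟩ := exists_nat_gt ((k * (3 * ((b + 2) / 2)) + k ^ 2) * (2 / δ) + k + 1 : ℝ)
  refine ⟨δ / 2, half_pos hδ0, J, fun j hj => ?_⟩
  have hjR : ((k * (3 * ((b + 2) / 2)) + k ^ 2) * (2 / δ) + k + 1 : ℝ) < j :=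
    hJ.trans_le (by exact_mod_cast hj)
  have hK : (0 : ℝ) ≤ k * (3 * ((b + 2) / 2)) := by positivity
  have hKδ : (0 : ℝ) ≤ (k * (3 * ((b + 2) / 2)) + k ^ 2) * (2 / δ) := by positivity
  have hk0 : (0 : ℝ) ≤ k := Nat.cast_nonneg _
  have hkj : (k : ℝ) < j := by linarith
  have hj1 : (1 : ℝ) < j := by linarith
  have hkj' : k < j := by exact_mod_cast hkj
  have hlt : (k * (3 * ((b + 2) / 2)) + k ^ 2 : ℝ) / j < δ / 2 := by
    rw [div_lt_iff₀ (by linarith)]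
    have : ((k * (3 * ((b + 2) / 2)) + k ^ 2) * (2 / δ) : ℝ) < j := by linarith
    calc (k * (3 * ((b + 2) / 2)) + k ^ 2 : ℝ)
        = δ / 2 * ((k * (3 * ((b + 2) / 2)) + k ^ 2) * (2 / δ)) := by field_simp
      _ < δ / 2 * j := mul_lt_mul_of_pos_left this (half_pos hδ0)
  refine ⟨by omega, by omega, lt_of_le_of_lt ?_ hlt, ?_⟩
  · rw [mul_one_div]
    refine div_le_div₀ (by positivity) (by linarith) (by linarith) ?_
    nlinarith
  intro W _ _ P C Γ N hF h1 hb
  have hj0 : j ≠ 0 := by omega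
  obtain ⟨e, z, he1, he2, he3, he4⟩ := exists_resolution_modeZ k j
  have h := le_ham_mul_self hF (spinFamily_mode k j hj0) (by positivity) he1 he2 he3 he4 hc0.le hc1
    h1 (le_modeX_gap hj0 hδ) hb1 hb
  refine (smul_one_mono ?_).trans h
  rw [Fintype.card_fin]
  have hη : (1 / j : ℝ) ≤ 1 := by rw [div_le_one (by linarith)]; exact hj1.le
  have h2 : (1 / j : ℝ) * (k * (3 * ((b + (1 + 1 / j)) / 2))) ≤
      (k * (3 * ((b + 2) / 2)) + k ^ 2 : ℝ) / j := by
    rw [one_div_mul_eq_div, div_le_div_iff_of_pos_right (by linarith)]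
    have : (k : ℝ) * (3 * ((b + (1 + 1 / j)) / 2)) ≤ k * (3 * ((b + 2) / 2)) := by
      refine mul_le_mul_of_nonneg_left ?_ hk0
      linarith
    nlinarith
  linarith

end Uniform

section Twisted

theorem IsSign.submatrix {ι κ : Type} [Fintype ι] [DecidableEq ι] [Fintype κ] [DecidableEq κ]
    {S H : Matrix ι ι ℂ} (h : IsSign S H) (e : κ ≃ ι) :
    IsSign (S.submatrix e e) (H.submatrix e e) := by
  refine ⟨h.isHermitian.submatrix e, h.isHermitian_right.submatrix e, ?_, ?_⟩
  · rw [Matrix.submatrix_mul_equiv, h.mul_self, Matrix.submatrix_one_equiv]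
  · rw [Matrix.submatrix_mul_equiv]
    exact h.posDef.submatrix e.injective

theorem trace_submatrix_equiv {ι κ : Type} [Fintype ι] [Fintype κ] (A : Matrix ι ι ℂ) (e : κ ≃ ι) :
    (A.submatrix e e).trace = A.trace :=
  e.sum_comp fun i => A i i

variable {W V κ U : Type} [Fintype W] [DecidableEq W] [Fintype V] [DecidableEq V] [Fintype κ]
  [Fintype U] [DecidableEq U]

theorem ham_kron (γ : Matrix U U ℂ) (P C : κ → Matrix W W ℂ) (Γ : Matrix W W ℂ)
    (X Y Z : κ → Matrix V V ℂ) (a : ℂ) :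
    ham (fun i => γ ⊗ₖ P i) (fun i => γ ⊗ₖ C i) (γ ⊗ₖ Γ) 0 X Y Z a =
      (γ ⊗ₖ ham P C Γ 0 X Y Z a).submatrix (Equiv.prodAssoc U W V) (Equiv.prodAssoc U W V) := by
  ext ⟨⟨a, b⟩, v⟩ ⟨⟨a', b'⟩, v'⟩
  simp [ham, Matrix.sum_apply, mul_add, Finset.mul_sum, mul_assoc]

theorem kron_assoc (A : Matrix U U ℂ) (B : Matrix W W ℂ) (D : Matrix V V ℂ) : (A ⊗ₖ B) ⊗ₖ D =
    (A ⊗ₖ (B ⊗ₖ D)).submatrix (Equiv.prodAssoc U W V) (Equiv.prodAssoc U W V) := by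
  ext ⟨⟨a, b⟩, v⟩ ⟨⟨a', b'⟩, v'⟩
  simp [mul_assoc]

/-- The coefficients of the homotopy from a twisted Hamiltonian to a Clifford one. -/
noncomputable def twist (γ : Matrix U U ℂ) (c : κ → Matrix U U ℂ) (f : κ → Matrix W W ℂ) (θ : ℝ)
    (i : κ) : Matrix (U × W) (U × W) ℂ :=
  (Real.cos θ : ℂ) • γ ⊗ₖ f i + (Real.sin θ : ℂ) • c i ⊗ₖ 1

variable {γ : Matrix U U ℂ} {c : κ → Matrix U U ℂ} {f C : κ → Matrix W W ℂ} {Γ : Matrix W W ℂ}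

theorem isFrame_twist (hF : IsFrame f C Γ 0) (hγ : γᴴ = γ) (hγγ : γ * γ = 1)
    (hcs : ∀ i, (c i)ᴴ = c i) (hγc : ∀ i, c i * γ = -(γ * c i)) (θ : ℝ) :
    IsFrame (twist γ c f θ) (fun i => γ ⊗ₖ C i) (γ ⊗ₖ Γ) 0 where
  starP i := by
    simp only [twist, Matrix.conjTranspose_add, Matrix.conjTranspose_smul,
      Matrix.conjTranspose_kronecker, hγ, hcs, hF.starP, Matrix.conjTranspose_one,
      Complex.star_def, Complex.conj_ofReal]
  starC i := by rw [Matrix.conjTranspose_kronecker, hγ, hF.starC]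
  starΓ := by rw [Matrix.conjTranspose_kronecker, hγ, hF.starΓ]
  starN := by simp
  antiPC i j := by
    simp only [twist, add_mul, mul_add, smul_mul_assoc, mul_smul_comm, ← Matrix.mul_kronecker_mul,
      hγc, hF.antiPC, kron_neg, neg_kron, one_mul, mul_one]
    module
  antiPΓ i := by
    simp only [twist, add_mul, mul_add, smul_mul_assoc, mul_smul_comm, ← Matrix.mul_kronecker_mul,
      hγc, hF.antiPΓ, kron_neg, neg_kron, one_mul, mul_one]
    module
  antiCΓ i := by rw [← Matrix.mul_kronecker_mul, ← Matrix.mul_kronecker_mul, hF.antiCΓ, kron_neg]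
  antiCC i j h := by
    rw [← Matrix.mul_kronecker_mul, ← Matrix.mul_kronecker_mul, hF.antiCC i j h, kron_neg]
  antiNC i := by simp
  antiNΓ := by simp
  sqC i := by rw [← Matrix.mul_kronecker_mul, hγγ, hF.sqC, Matrix.one_kronecker_one]
  sqΓ := by rw [← Matrix.mul_kronecker_mul, hγγ, hF.sqΓ, Matrix.one_kronecker_one]

theorem sum_twist_mul_self (hγγ : γ * γ = 1) (hγc : ∀ i, c i * γ = -(γ * c i))
    (hcc : ∀ i j, i ≠ j → c i * c j = -(c j * c i)) (hc : ∀ i, c i * c i = 1) (θ : ℝ)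
    (z : κ → ℝ) :
    (∑ i, (z i : ℂ) • twist γ c f θ i) * (∑ i, (z i : ℂ) • twist γ c f θ i) =
      ((Real.cos θ ^ 2 : ℝ) : ℂ) • 1 ⊗ₖ ((∑ i, (z i : ℂ) • f i) * (∑ i, (z i : ℂ) • f i)) +
      ((Real.sin θ ^ 2 * ∑ i, z i ^ 2 : ℝ) : ℂ) • 1 := by
  have h1 : ∑ i, (z i : ℂ) • twist γ c f θ i = (Real.cos θ : ℂ) • γ ⊗ₖ (∑ i, (z i : ℂ) • f i) +
      (Real.sin θ : ℂ) • (∑ i, (z i : ℂ) • c i) ⊗ₖ 1 := by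
    rw [kron_sum, sum_kron, Finset.smul_sum, Finset.smul_sum, ← Finset.sum_add_distrib]
    refine Finset.sum_congr rfl fun i _ => ?_
    rw [twist, Matrix.kronecker_smul, Matrix.smul_kronecker]
    module
  have h2 : (∑ i, (z i : ℂ) • c i) * (∑ i, (z i : ℂ) • c i) =
      ((∑ i, z i ^ 2 : ℝ) : ℂ) • 1 := by
    rw [sum_mul_self_of_anticomm]
    · simp only [smul_mul_assoc, mul_smul_comm, hc, smul_smul]
      push_cast
      rw [Finset.sum_smul]
      simp only [pow_two]
    · intro i j h
      simp only [smul_mul_assoc, mul_smul_comm, hcc i j h]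
      module
  have h3 : (∑ i, (z i : ℂ) • c i) * γ = -(γ * ∑ i, (z i : ℂ) • c i) := by
    simp only [Finset.mul_sum, Finset.sum_mul, smul_mul_assoc, mul_smul_comm, hγc, smul_neg,
      Finset.sum_neg_distrib]
  rw [h1]
  simp only [add_mul, mul_add, smul_mul_assoc, mul_smul_comm, ← Matrix.mul_kronecker_mul, h2, h3,
    hγγ, one_mul, mul_one, neg_kron, Matrix.smul_kronecker, Matrix.one_kronecker_one]
  push_cast
  module

/-- The signature of the product of the grading and the Hamiltonian. -/
theorem exists_twisted_trace {l : ℕ} {f C : Fin (2 * l) → Matrix W W ℂ} (hF : IsFrame f C Γ 0)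
    {α : ℝ} (hα0 : 0 < α) (hα1 : α ≤ 1) (hf : ∀ z : Fin (2 * l) → ℝ,
      ((α * ∑ i, z i ^ 2 : ℝ) : ℂ) • 1 ≤ (∑ i, (z i : ℂ) • f i) * (∑ i, (z i : ℂ) • f i)) :
    ∃ J : ℕ, ∀ j ≥ J, Odd j → ∀ S, IsSign S ((Γ ⊗ₖ modeR _ j) *
      ham f C Γ 0 (modeX _ j) (modeY _ j) (modeZ _ j) ((1 / 2 : ℝ) : ℂ)) →
      2 ^ (2 * l) * S.trace = Fintype.card W * (2 - 2 ^ (2 * l)) := by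
  obtain ⟨U, _, _, c', γ, U', hU⟩ := exists_isClifford l
  set c : Fin (2 * l) → Matrix U U ℂ := fun i => c' i with hcdef
  have hγ : γᴴ = γ := hU.grading_isHermitian
  have hγγ := hU.grading_mul_self
  have hcs (i) : (c i)ᴴ = c i := hU.isHermitian i i.isLt
  have hc (i) : c i * c i = 1 := hU.mul_self i i.isLt
  have hcc (i i') (h : i ≠ i') : c i * c i' = -(c i' * c i) :=
    hU.anticomm i i.isLt i' i'.isLt fun h' => h (Fin.ext h')
  have hγc (i) : c i * γ = -(γ * c i) := by
    rw [hU.grading_anticomm i i.isLt, neg_neg]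
  obtain ⟨b, hb1, hb⟩ := exists_le_smul_one (T := Fin (2 * l)) (s := Set.univ) (A := fun i => f i * f i)
    isCompact_univ continuous_of_discreteTopology.continuousOn
    fun i => by rw [Matrix.conjTranspose_mul, hF.starP]
  obtain ⟨ε, hε, J, hJ⟩ := exists_le_ham (2 * l) hα0 hα1 hb1
  refine ⟨J, fun j hj hjo S hS => ?_⟩
  obtain ⟨hj0, hlj, hεj, hgap⟩ := hJ j hj
  set X := modeX (2 * l) j
  set Y := modeY (2 * l) j
  set Z := modeZ (2 * l) j
  have hM := spinFamily_mode (2 * l) j hj0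
  have hFr := isFrame_twist hF hγ hγγ hcs hγc
  have hP (θ : ℝ) (i) : twist γ c f θ i * twist γ c f θ i ≤ (b : ℂ) • 1 := by
    have h1 := sum_twist_mul_self (f := f) hγγ hγc hcc hc θ (Pi.single i 1)
    have h2 {ι : Type} (A : Fin (2 * l) → Matrix ι ι ℂ) :
        ∑ i', ((Pi.single i 1 : Fin (2 * l) → ℝ) i' : ℂ) • A i' = A i := by
      rw [Finset.sum_eq_single i] <;> simp +contextual
    have h3 : ∑ i', (Pi.single i 1 : Fin (2 * l) → ℝ) i' ^ 2 = 1 := by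
      rw [Finset.sum_eq_single i] <;> simp +contextual
    rw [h2, h2, h3, mul_one] at h1
    rw [h1]
    have h4 : (1 : Matrix U U ℂ) ⊗ₖ (f i * f i) ≤ (b : ℂ) • 1 := by
      have := one_kron_mono (W := U) (hb i (Set.mem_univ i))
      rwa [Matrix.kronecker_smul, Matrix.one_kronecker_one] at this
    have h5 := smul_le_smul_of_nonneg_left h4
      (Complex.real_le_real.mpr (sq_nonneg (Real.cos θ)) : (0 : ℂ) ≤ ((Real.cos θ ^ 2 : ℝ) : ℂ))
    refine (add_le_add_left h5 _).trans ?_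
    rw [smul_smul, ← add_smul, ← Complex.ofReal_mul, ← Complex.ofReal_add]
    refine smul_one_mono ?_
    nlinarith [Real.sin_sq_add_cos_sq θ, sq_nonneg (Real.sin θ)]
  have hlow (θ : ℝ) (z : Fin (2 * l) → ℝ) : ((α * ∑ i, z i ^ 2 : ℝ) : ℂ) • 1 ≤
      (∑ i, (z i : ℂ) • twist γ c f θ i + 0) * (∑ i, (z i : ℂ) • twist γ c f θ i + 0) := by
    rw [add_zero, sum_twist_mul_self hγγ hγc hcc hc]
    have h4 : ((α * ∑ i, z i ^ 2 : ℝ) : ℂ) • 1 ≤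
        (1 : Matrix U U ℂ) ⊗ₖ ((∑ i, (z i : ℂ) • f i) * (∑ i, (z i : ℂ) • f i)) := by
      have := one_kron_mono (W := U) (hf z)
      rwa [Matrix.kronecker_smul, Matrix.one_kronecker_one] at this
    have h5 := smul_le_smul_of_nonneg_left h4
      (Complex.real_le_real.mpr (sq_nonneg (Real.cos θ)) : (0 : ℂ) ≤ ((Real.cos θ ^ 2 : ℝ) : ℂ))
    refine le_trans ?_ (add_le_add_left h5 _)
    rw [smul_smul, ← add_smul, ← Complex.ofReal_mul, ← Complex.ofReal_add]
    refine smul_one_mono ?_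
    have h6 : 0 ≤ ∑ i, z i ^ 2 := Finset.sum_nonneg fun i _ => sq_nonneg _
    have h7 : α * ∑ i, z i ^ 2 ≤ ∑ i, z i ^ 2 := mul_le_of_le_one_left h6 hα1
    nlinarith [Real.sin_sq_add_cos_sq θ, sq_nonneg (Real.sin θ)]
  have hgap' (θ : ℝ) := hgap (hFr θ) (hlow θ) (hP θ)
  set H : ℝ → Matrix ((U × W) × (Fin (2 * l) → Fin (2 * j + 1)))
      ((U × W) × (Fin (2 * l) → Fin (2 * j + 1))) ℂ := fun θ =>
    ham (twist γ c f θ) (fun i => γ ⊗ₖ C i) (γ ⊗ₖ Γ) 0 X Y Z ((1 / 2 : ℝ) : ℂ) with hH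
  set G := (γ ⊗ₖ Γ) ⊗ₖ modeR (2 * l) j with hG
  have hGs : Gᴴ = G := by
    have hRs : (modeR (2 * l) j)ᴴ = modeR (2 * l) j := hM.starR
    rw [hG, Matrix.conjTranspose_kronecker, (hFr 0).starΓ, hRs]
  have hGG : G * G = 1 := by
    rw [hG, ← Matrix.mul_kronecker_mul, (hFr 0).sqΓ, hM.mulRR, Matrix.one_kronecker_one]
  have hGdet : G.det ≠ 0 := by
    intro h
    have := congrArg Matrix.det hGG
    simp [h] at this
  have hGH (θ : ℝ) : G * H θ = H θ * G := grading_mul_ham (hFr θ) hM rfl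
  have hHs (θ : ℝ) : (H θ)ᴴ = H θ := ham_isHermitian (hFr θ) hM (by simp)
  have hherm (θ : ℝ) : (G * H θ).IsHermitian := by
    rw [Matrix.IsHermitian, Matrix.conjTranspose_mul, hHs, hGs, hGH]
  have hdet (θ : ℝ) : (G * H θ).det ≠ 0 := by
    rw [Matrix.det_mul]
    exact mul_ne_zero hGdet (det_ne_zero_of_le hε (hgap' θ))
  have htw0 : twist γ c f 0 = fun i => γ ⊗ₖ f i := by
    funext i; simp [twist]
  have hS0 : IsSign (((1 : Matrix U U ℂ) ⊗ₖ S).submatrix (Equiv.prodAssoc U W _)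
      (Equiv.prodAssoc U W _)) (G * H 0) := by
    convert (hS.one_kronecker U).submatrix (Equiv.prodAssoc U W _) using 1
    simp only [hH, htw0]
    rw [ham_kron, hG, kron_assoc, Matrix.submatrix_mul_equiv, ← Matrix.mul_kronecker_mul, hγγ]
  have htw1 : twist γ c f (Real.pi / 2) = fun i => c i ⊗ₖ 1 := by
    funext i; simp [twist]
  obtain ⟨S₁, hS₁, -⟩ := exists_isSign (hherm (Real.pi / 2)) (hdet _)
  have hpath : (((1 : Matrix U U ℂ) ⊗ₖ S).submatrix (Equiv.prodAssoc U W _)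
      (Equiv.prodAssoc U W _)).trace = S₁.trace := by
    refine trace_sign_eq_of_path (H := fun t => G * H (t * (Real.pi / 2))) ?_
      (fun t => hherm _) (fun t _ => hdet _) ?_ ?_
    · simp only [hH, ham, twist, Matrix.add_kronecker, Matrix.smul_kronecker]
      fun_prop
    · simpa using hS0
    · simpa using hS₁
  rw [trace_submatrix_equiv, Matrix.trace_kronecker, Matrix.trace_one, hU.card] at hpath
  have hend := trace_sign_of_gap (hFr (Real.pi / 2))
    (fun i => by rw [htw1]; simp only [← Matrix.mul_kronecker_mul, hc, mul_one,
      Matrix.one_kronecker_one])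
    (fun i i' h => by rw [htw1]; simp only [← Matrix.mul_kronecker_mul, hcc i i' h, neg_kron])
    hjo hlj (by exact_mod_cast hεj) (hgap' _) hS₁
  rw [← hpath, Fintype.card_prod, hU.card] at hend
  have h2 : (2 : ℂ) ^ l ≠ 0 := pow_ne_zero _ two_ne_zero
  refine mul_left_cancel₀ h2 ?_
  push_cast at hend
  linear_combination hend

end Twisted

section Untwisted

variable {W V κ : Type} [Fintype W] [DecidableEq W] [Fintype V] [DecidableEq V] [Fintype κ]
  {P C : κ → Matrix W W ℂ} {Γ N : Matrix W W ℂ}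

theorem IsFrame.smul (hF : IsFrame P C Γ N) (y : ℝ) : IsFrame P C Γ ((y : ℂ) • N) where
  starP := hF.starP
  starC := hF.starC
  starΓ := hF.starΓ
  starN := by rw [Matrix.conjTranspose_smul, hF.starN, Complex.star_def, Complex.conj_ofReal]
  antiPC := hF.antiPC
  antiPΓ := hF.antiPΓ
  antiCΓ := hF.antiCΓ
  antiCC := hF.antiCC
  antiNC i := by rw [smul_mul_assoc, mul_smul_comm, hF.antiNC, smul_neg]
  antiNΓ := by rw [smul_mul_assoc, mul_smul_comm, hF.antiNΓ, smul_neg]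
  sqC := hF.sqC
  sqΓ := hF.sqΓ

theorem IsFrame.zero (hF : IsFrame P C Γ N) : IsFrame P C Γ 0 := by
  simpa using hF.smul 0

theorem ham_smul (X Y Z : κ → Matrix V V ℂ) (a y : ℂ) :
    ham P C Γ (y • N) X Y Z a = ham P C Γ 0 X Y Z a + y • N ⊗ₖ 1 := by
  simp only [ham, Matrix.smul_kronecker, Matrix.zero_kronecker, add_zero]
  abel

/-- An additional nonsingular direction connects the Hamiltonian with that direction. -/
theorem exists_det_ne_zero {l : ℕ} {f C : Fin l → Matrix W W ℂ} (hF : IsFrame f C Γ N)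
    {α : ℝ} (hα0 : 0 < α) (hα1 : α ≤ 1) (hf : ∀ (z : Fin l → ℝ) (y : ℝ),
      ((α * (∑ i, z i ^ 2 + y ^ 2) : ℝ) : ℂ) • 1 ≤
        (∑ i, (z i : ℂ) • f i + (y : ℂ) • N) * (∑ i, (z i : ℂ) • f i + (y : ℂ) • N)) :
    ∃ J : ℕ, ∀ j ≥ J, j ≠ 0 ∧ ∀ t ∈ Set.Icc (0 : ℝ) 1, ((1 - t : ℂ) •
      ham f C Γ 0 (modeX _ j) (modeY _ j) (modeZ _ j) ((1 / 2 : ℝ) : ℂ) +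
        (t : ℂ) • N ⊗ₖ 1).det ≠ 0 := by
  obtain ⟨b, hb1, hb⟩ := exists_le_smul_one (T := Fin l) (s := Set.univ) (A := fun i => f i * f i)
    isCompact_univ continuous_of_discreteTopology.continuousOn
    fun i => by rw [Matrix.conjTranspose_mul, hF.starP]
  obtain ⟨ε, hε, J, hJ⟩ := exists_le_ham l hα0 hα1 hb1
  refine ⟨J, fun j hj => ⟨(hJ j hj).1, fun t ht => ?_⟩⟩
  rcases ht.2.eq_or_lt with rfl | ht1
  · have h := one_kron_mono (W := Unit) (hf 0 1)
    have h := kron_one_mono (V := Fin l → Fin (2 * j + 1)) (hf 0 1)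
    refine det_ne_zero_of_le hα0 ?_
    simpa [← Matrix.mul_kronecker_mul, Matrix.smul_kronecker] using h
  · have h1t : (1 - t : ℂ) ≠ 0 := by exact_mod_cast (sub_pos.mpr ht1).ne'
    have hgap := (hJ j hj).2.2.2 (hF.smul (t / (1 - t))) (fun z => (smul_one_mono ?_).trans
      (hf z (t / (1 - t)))) fun i => hb i (Set.mem_univ i)
    · have hdet := det_ne_zero_of_le hε hgap
      rw [ham_smul] at hdet
      have e : (1 - t : ℂ) • ham f C Γ 0 (modeX _ j) (modeY _ j) (modeZ _ j) ((1 / 2 : ℝ) : ℂ) +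
          (t : ℂ) • N ⊗ₖ 1 = (1 - t : ℂ) •
          (ham f C Γ 0 (modeX _ j) (modeY _ j) (modeZ _ j) ((1 / 2 : ℝ) : ℂ) +
            ((t / (1 - t) : ℝ) : ℂ) • N ⊗ₖ 1) := by
        rw [smul_add, smul_smul]
        congr 2
        push_cast
        field_simp
      rw [e, Matrix.det_smul]
      exact mul_ne_zero (pow_ne_zero _ h1t) hdet
    · have : 0 ≤ α * (t / (1 - t)) ^ 2 := by positivity
      linarith [mul_add α (∑ i, z i ^ 2) ((t / (1 - t)) ^ 2)]

theorem trace_sign_zero_of_path {H M G S : Matrix W W ℂ} (hH : H.IsHermitian) (hM : M.IsHermitian)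
    (hG : G.IsHermitian) (hGG : G * G = 1) (hMG : M * G = -(G * M))
    (hdet : ∀ t ∈ Set.Icc (0 : ℝ) 1, ((1 - t : ℂ) • H + (t : ℂ) • M).det ≠ 0)
    (hS : IsSign S H) : S.trace = 0 := by
  obtain ⟨T, hT, -⟩ := exists_isSign hM (by simpa using hdet 1 (by simp))
  rw [trace_sign_eq_of_path (H := fun t : ℝ => (1 - t : ℂ) • H + (t : ℂ) • M) (by fun_prop)
    (fun t => ?_) hdet (by simpa using hS) (by simpa using hT)]
  · exact hT.trace_eq_zero_of_anticommute hG hGG (by rw [hMG, neg_neg])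
  · rw [Matrix.IsHermitian, Matrix.conjTranspose_add, Matrix.conjTranspose_smul,
      Matrix.conjTranspose_smul, hH.eq, hM.eq]
    simp

/-- The sign of a Hamiltonian cut off by a commuting grading. -/
theorem IsSign.cutoff {S H G : Matrix W W ℂ} (h : IsSign S H) (hG : G.IsHermitian)
    (hGG : G * G = 1) (hGH : G * H = H * G) :
    IsSign ((2⁻¹ : ℂ) • (1 + G) * S + (2⁻¹ : ℂ) • (1 - G))
      ((2⁻¹ : ℂ) • (1 + G) * H + (2⁻¹ : ℂ) • (1 - G)) := by
  have hGS := h.commute_involution hG hGG hGH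
  set P := (2⁻¹ : ℂ) • (1 + G) with hP
  set Q := (2⁻¹ : ℂ) • (1 - G) with hQ
  have hPs : Pᴴ = P := by
    rw [hP, Matrix.conjTranspose_smul, Matrix.conjTranspose_add, hG.eq]; simp
  have hQs : Qᴴ = Q := by
    rw [hQ, Matrix.conjTranspose_smul, Matrix.conjTranspose_sub, hG.eq]; simp
  have hPP : P * P = P := by
    simp only [hP, smul_mul_assoc, mul_smul_comm, add_mul, mul_add, hGG, one_mul, mul_one]
    module
  have hQQ : Q * Q = Q := by
    simp only [hQ, smul_mul_assoc, mul_smul_comm, sub_mul, mul_sub, hGG, one_mul, mul_one]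
    module
  have hPQ : P * Q = 0 := by
    simp only [hP, hQ, smul_mul_assoc, mul_smul_comm, add_mul, mul_sub, hGG, one_mul, mul_one]
    module
  have hQP : Q * P = 0 := by
    simp only [hP, hQ, smul_mul_assoc, mul_smul_comm, sub_mul, mul_add, hGG, one_mul, mul_one]
    module
  have hPQ1 : P + Q = 1 := by rw [hP, hQ]; module
  have hPc {A : Matrix W W ℂ} (hA : G * A = A * G) : P * A = A * P := by
    simp only [hP, smul_mul_assoc, mul_smul_comm, add_mul, mul_add, hA, one_mul, mul_one]
  have hmul {A B : Matrix W W ℂ} (hA : G * A = A * G) :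
      (P * A + Q) * (P * B + Q) = P * (A * B) + Q := by
    have h0 : P * (A * B) = A * P * B := by rw [← mul_assoc, hPc hA]
    rw [h0, hPc hA]
    calc _ = A * (P * P) * B + A * (P * Q) + Q * P * B + Q * Q := by noncomm_ring
      _ = _ := by rw [hPP, hPQ, hQP, hQQ, mul_zero, zero_mul, add_zero, add_zero]
  have hsa {A : Matrix W W ℂ} (hAs : A.IsHermitian) (hA : G * A = A * G) :
      (P * A + Q).IsHermitian := by
    rw [Matrix.IsHermitian, Matrix.conjTranspose_add, Matrix.conjTranspose_mul, hAs.eq, hPs, hQs,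
      hPc hA]
  have h1 : (P * S + Q) * (P * S + Q) = 1 := by rw [hmul hGS, h.mul_self, mul_one, hPQ1]
  refine ⟨hsa h.isHermitian hGS, hsa h.isHermitian_right hGH, h1, ?_⟩
  have hGSH : G * (S * H) = S * H * G := by rw [← mul_assoc, hGS, mul_assoc, hGH, mul_assoc]
  have hu : IsUnit ((P * S + Q) * (P * H + Q)) := by
    rw [hmul hGS]
    refine IsUnit.of_mul_eq_one (P * (S * H)⁻¹ + Q) ?_
    rw [hmul hGSH, Matrix.mul_nonsing_inv _ h.posDef.det_pos.ne'.isUnit, mul_one, hPQ1]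
  rw [Matrix.PosSemidef.posDef_iff_isUnit]
  · exact hu
  · rw [hmul hGS]
    have e1 := h.posDef.posSemidef.conjTranspose_mul_mul_same P
    have e2 := Matrix.posSemidef_conjTranspose_mul_self Q
    rw [hQs, hQQ] at e2
    have hc := hPc hGSH
    rw [hPs, mul_assoc, ← hc, ← mul_assoc, hPP] at e1
    exact e1.add e2

theorem trace_mul_sign_of_det_pos {S H G T : Matrix W W ℂ} (h : IsSign S H) (hG : G.IsHermitian)
    (hGG : G * G = 1) (hGH : G * H = H * G) (hS : S.trace = 0) (hG0 : G.trace = 0)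
    (hdet : 0 < ((2⁻¹ : ℂ) • (1 + G) * H + (2⁻¹ : ℂ) • (1 - G)).det)
    (hT : IsSign T (G * H)) : ∃ w : ℕ, T.trace = Fintype.card W - 8 * w := by
  have hc := h.cutoff hG hGG hGH
  obtain ⟨R, hR, n, hn, hpos⟩ := exists_isSign hc.isHermitian_right hdet.ne'
  have heven : Even n := by
    rcases n.even_or_odd with h' | h'
    · exact h'
    · rw [h'.neg_one_pow, neg_one_mul, Left.neg_pos_iff] at hpos
      exact absurd hpos hdet.asymm
  obtain ⟨w, rfl⟩ := heven
  refine ⟨w, ?_⟩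
  rw [hR.trace_unique hc, smul_mul_assoc, add_mul, one_mul] at hn
  rw [hT.trace_unique (h.mul_involution hG hGG hGH)]
  simp only [Matrix.trace_add, Matrix.trace_smul, Matrix.trace_sub, hS, hG0, Matrix.trace_one,
    smul_eq_mul] at hn
  push_cast at hn
  linear_combination 2 * hn

end Untwisted

section Chiral

variable {E S V κ : Type} [Fintype E] [DecidableEq E] [Fintype S] [DecidableEq S] [Fintype V]
  [DecidableEq V]

/-- A family of real symmetric matrices anticommuting with a real symmetric involution. -/
structure IsChiral (F : κ → Matrix E E ℂ) (σ : Matrix E E ℂ) : Prop where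
  starF : ∀ i, (F i)ᴴ = F i
  transposeF : ∀ i, (F i)ᵀ = F i
  starσ : σᴴ = σ
  transposeσ : σᵀ = σ
  sqσ : σ * σ = 1
  anti : ∀ i, F i * σ = -(σ * F i)

theorem gapOp_transpose {k : ℕ} (j : ℕ) (a : ℂ) :
    (gapOp (modeX k j) a)ᵀ = gapOp (modeX k j) a := by
  simp only [gapOp, Matrix.transpose_sub, Matrix.transpose_smul, Matrix.transpose_one,
    Matrix.transpose_sum, modeX_transpose]

theorem intertwine_cutoff {W : Type} [Fintype W] [DecidableEq W] {U H G : Matrix W W ℂ}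
    (hH : U * Hᵀ = H * U) (hG : U * Gᵀ = G * U) (hGH : G * H = H * G) :
    U * ((2⁻¹ : ℂ) • (1 + G) * H + (2⁻¹ : ℂ) • (1 - G))ᵀ =
      ((2⁻¹ : ℂ) • (1 + G) * H + (2⁻¹ : ℂ) • (1 - G)) * U := by
  have h : U * (Hᵀ * Gᵀ) = G * H * U := by
    rw [← mul_assoc, hH, mul_assoc, hG, ← mul_assoc, hGH]
  simp only [Matrix.transpose_add, Matrix.transpose_sub, Matrix.transpose_mul,
    Matrix.transpose_smul, Matrix.transpose_one, mul_add, mul_sub, add_mul, sub_mul,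
    smul_mul_assoc, mul_smul_comm, one_mul, mul_one, h, hH, hG]

variable {l : ℕ} {F : Fin (2 * l + 1) → Matrix E E ℂ} {σ : Matrix E E ℂ}
  {c : ℕ → Matrix S S ℂ} {γ U : Matrix S S ℂ}

theorem IsChiral.isFrame (hF : IsChiral F σ) (hc : IsClifford l c γ U) :
    IsFrame (fun i : Fin (2 * l) => F i.castSucc ⊗ₖ (1 : Matrix S S ℂ)) (fun i => σ ⊗ₖ c i)
      (σ ⊗ₖ γ) (F (Fin.last _) ⊗ₖ 1) where
  starP i := by rw [Matrix.conjTranspose_kronecker, hF.starF, Matrix.conjTranspose_one]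
  starC i := by rw [Matrix.conjTranspose_kronecker, hF.starσ, (hc.isHermitian i i.isLt).eq]
  starΓ := by rw [Matrix.conjTranspose_kronecker, hF.starσ, hc.grading_isHermitian.eq]
  starN := by rw [Matrix.conjTranspose_kronecker, hF.starF, Matrix.conjTranspose_one]
  antiPC i j := by
    rw [← Matrix.mul_kronecker_mul, ← Matrix.mul_kronecker_mul, hF.anti, neg_kron, one_mul, mul_one]
  antiPΓ i := by
    rw [← Matrix.mul_kronecker_mul, ← Matrix.mul_kronecker_mul, hF.anti, neg_kron, one_mul, mul_one]
  antiCΓ i := by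
    rw [← Matrix.mul_kronecker_mul, ← Matrix.mul_kronecker_mul, hc.grading_anticomm i i.isLt,
      kron_neg, neg_neg]
  antiCC i j h := by
    rw [← Matrix.mul_kronecker_mul, ← Matrix.mul_kronecker_mul,
      hc.anticomm i i.isLt j j.isLt fun h' => h (Fin.ext h'), kron_neg]
  antiNC i := by
    rw [← Matrix.mul_kronecker_mul, ← Matrix.mul_kronecker_mul, hF.anti, neg_kron, one_mul, mul_one]
  antiNΓ := by
    rw [← Matrix.mul_kronecker_mul, ← Matrix.mul_kronecker_mul, hF.anti, neg_kron, one_mul, mul_one]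
  sqC i := by
    rw [← Matrix.mul_kronecker_mul, hF.sqσ, hc.mul_self i i.isLt, Matrix.one_kronecker_one]
  sqΓ := by
    rw [← Matrix.mul_kronecker_mul, hF.sqσ, hc.grading_mul_self, Matrix.one_kronecker_one]

/-- Reality of the chiral Hamiltonian: `ε` is the sign of the conjugation `A ⊗ U`. -/
theorem IsChiral.intertwine_ham (hF : IsChiral F σ) (hc : IsClifford l c γ U) (j : ℕ) (a : ℂ)
    {A : Matrix E E ℂ} {ε : ℂ} (hA : ∀ i, A * F i = ε • (F i * A)) (hAσ : A * σ = σ * A)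
    (hε : ε = (-1) ^ l) :
    ((A ⊗ₖ U) ⊗ₖ 1) * (ham (fun i : Fin (2 * l) => F i.castSucc ⊗ₖ (1 : Matrix S S ℂ))
      (fun i => σ ⊗ₖ c i) (σ ⊗ₖ γ) 0 (modeX _ j) (modeY _ j) (modeZ _ j) a)ᵀ =
      ε • (ham (fun i : Fin (2 * l) => F i.castSucc ⊗ₖ (1 : Matrix S S ℂ))
      (fun i => σ ⊗ₖ c i) (σ ⊗ₖ γ) 0 (modeX _ j) (modeY _ j) (modeZ _ j) a *
        ((A ⊗ₖ U) ⊗ₖ 1)) := by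
  have h1 (i : Fin (2 * l)) : U * (c i)ᵀ = -(ε • (c i * U)) := by
    rw [hc.conj_mul i i.isLt, hε, pow_succ]; simp
  have h2 : U * γᵀ = ε • (γ * U) := by rw [hc.grading_transpose, hc.conj_grading, hε]
  simp only [ham, Matrix.transpose_add, Matrix.transpose_sum, ← Matrix.kroneckerMap_transpose,
    Matrix.zero_kronecker, add_zero, gapOp_transpose, modeY_transpose, modeZ_transpose, mul_add,
    add_mul, Finset.mul_sum, Finset.sum_mul, hF.transposeF, hF.transposeσ, Matrix.transpose_one,
    ← Matrix.mul_kronecker_mul, hA, hAσ, h1, h2, one_mul, mul_one, smul_add, Finset.smul_sum,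
    Matrix.smul_kronecker, Matrix.kronecker_smul, kron_neg, neg_kron, neg_neg, mul_neg]

theorem IsChiral.intertwine_grading (hF : IsChiral F σ) (hc : IsClifford l c γ U)
    {A : Matrix E E ℂ} {R : Matrix V V ℂ} (hR : Rᵀ = R) {ε : ℂ} (hAσ : A * σ = σ * A)
    (hε : ε = (-1) ^ l) :
    ((A ⊗ₖ U) ⊗ₖ 1) * ((σ ⊗ₖ γ) ⊗ₖ R)ᵀ = ε • (((σ ⊗ₖ γ) ⊗ₖ R) * ((A ⊗ₖ U) ⊗ₖ 1)) := by
  have h2 : U * γᵀ = ε • (γ * U) := by rw [hc.grading_transpose, hc.conj_grading, hε]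
  simp only [← Matrix.kroneckerMap_transpose, hF.transposeσ, hR, ← Matrix.mul_kronecker_mul, hAσ, h2,
    one_mul, mul_one, Matrix.smul_kronecker, Matrix.kronecker_smul]

theorem det_kron_ne_zero (hc : IsClifford l c γ U) {A : Matrix E E ℂ} (hA : A * A = 1) :
    ((A ⊗ₖ U) ⊗ₖ (1 : Matrix V V ℂ)).det ≠ 0 := by
  have hU : U.det ≠ 0 := fun h => by
    have := congrArg Matrix.det hc.conj_mul_self
    rw [Matrix.det_mul, h, Matrix.det_smul, Matrix.det_one, zero_mul, mul_one] at this
    exact pow_ne_zero _ (pow_ne_zero _ (by norm_num)) this.symm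
  have hA0 : A.det ≠ 0 := fun h => by
    have := congrArg Matrix.det hA
    simp [h] at this
  rw [Matrix.det_kronecker, Matrix.det_kronecker, Matrix.det_one, one_pow, mul_one]
  exact pow_ne_zero _ (mul_ne_zero (pow_ne_zero _ hA0) (pow_ne_zero _ hU))

/-- The determinant of the cut-off Hamiltonian is positive in the relevant dimensions. -/
theorem IsChiral.det_cutoff_pos (hF : IsChiral F σ) (hc : IsClifford l c γ U)
    (hl : l % 4 = 1 ∨ l % 4 = 2) {j : ℕ}
    {H G : Matrix ((E × S) × (Fin (2 * l) → Fin (2 * j + 1))) _ ℂ}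
    (hH : H = ham (fun i : Fin (2 * l) => F i.castSucc ⊗ₖ (1 : Matrix S S ℂ))
      (fun i => σ ⊗ₖ c i) (σ ⊗ₖ γ) 0 (modeX _ j) (modeY _ j) (modeZ _ j) ((1 / 2 : ℝ) : ℂ))
    (hG : G = (σ ⊗ₖ γ) ⊗ₖ modeR _ j)
    (hdet : ∀ t ∈ Set.Icc (0 : ℝ) 1, ((1 - t : ℂ) • H +
      (t : ℂ) • (F (Fin.last _) ⊗ₖ (1 : Matrix S S ℂ)) ⊗ₖ 1).det ≠ 0) (hHh : H.IsHermitian)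
    (hGh : G.IsHermitian) (hGG : G * G = 1) (hGH : G * H = H * G)
    (hpos : ((2⁻¹ : ℂ) • (1 + G) * H + (2⁻¹ : ℂ) • (1 - G)).IsHermitian)
    (hne : ((2⁻¹ : ℂ) • (1 + G) * H + (2⁻¹ : ℂ) • (1 - G)).det ≠ 0) :
    0 < ((2⁻¹ : ℂ) • (1 + G) * H + (2⁻¹ : ℂ) • (1 - G)).det := by
  have hR := modeR_transpose (2 * l) j
  rcases hl with hl | hl
  · have hlo : (-1 : ℂ) ^ l = -1 := Odd.neg_one_pow (Nat.odd_iff.mpr (by omega))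
    have hch : (-1 : ℂ) ^ l.choose 2 = 1 := by
      refine Even.neg_one_pow ?_
      obtain ⟨k, rfl⟩ : ∃ k, l = 4 * k + 1 := ⟨l / 4, by omega⟩
      rw [Nat.choose_two_right, show (4 * k + 1) * (4 * k + 1 - 1) = 2 * (2 * (k * (4 * k + 1))) by
        rw [Nat.add_sub_cancel]; ring, Nat.mul_div_cancel_left _ two_pos]
      exact even_two_mul _
    have hσF (i) : σ * F i = (-1 : ℂ) • (F i * σ) := by rw [hF.anti]; simp
    refine det_pos_of_real (U := (σ ⊗ₖ U) ⊗ₖ 1) (M := (F (Fin.last _) ⊗ₖ 1) ⊗ₖ 1) hHh ?_ hGh hGG hGH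
      ?_ ?_ (det_kron_ne_zero hc hF.sqσ) ?_ ?_ ?_ hdet
    · rw [Matrix.IsHermitian, Matrix.conjTranspose_kronecker, Matrix.conjTranspose_kronecker,
        hF.starF, Matrix.conjTranspose_one, Matrix.conjTranspose_one]
    · simp only [hG, ← Matrix.mul_kronecker_mul, hF.anti, one_mul, mul_one, neg_kron]
    · rw [← Matrix.kroneckerMap_transpose, ← Matrix.kroneckerMap_transpose, hF.transposeσ,
        hc.conj_transpose, hch, one_smul, Matrix.transpose_one]
    · rw [hH, hF.intertwine_ham hc j _ hσF rfl hlo.symm, neg_one_smul]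
    · simp only [← Matrix.kroneckerMap_transpose, hF.transposeF, Matrix.transpose_one,
        ← Matrix.mul_kronecker_mul, hF.anti, one_mul, mul_one, neg_kron, neg_neg]
    · rw [hG, hF.intertwine_grading hc hR rfl hlo.symm, neg_one_smul]
  · have hlo : (-1 : ℂ) ^ l = 1 := Even.neg_one_pow (Nat.even_iff.mpr (by omega))
    have hch : (-1 : ℂ) ^ l.choose 2 = -1 := by
      refine Odd.neg_one_pow ?_
      obtain ⟨k, rfl⟩ : ∃ k, l = 4 * k + 2 := ⟨l / 4, by omega⟩
      rw [Nat.choose_two_right, show (4 * k + 2) * (4 * k + 2 - 1) =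
        2 * (2 * (4 * k ^ 2 + 3 * k) + 1) by
          rw [show 4 * k + 2 - 1 = 4 * k + 1 by omega]; ring, Nat.mul_div_cancel_left _ two_pos]
      exact odd_two_mul_add_one _
    refine det_pos_of_quaternionic (U := (1 ⊗ₖ U) ⊗ₖ 1) hpos ?_ (det_kron_ne_zero hc (one_mul 1))
      (intertwine_cutoff ?_ ?_ hGH) hne
    · rw [← Matrix.kroneckerMap_transpose, ← Matrix.kroneckerMap_transpose, Matrix.transpose_one,
        hc.conj_transpose, hch, neg_one_smul, kron_neg, neg_kron, Matrix.transpose_one]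
    · rw [hH, hF.intertwine_ham hc j _ (ε := 1) (A := 1) (by simp) (by simp) hlo.symm, one_smul]
    · rw [hG, hF.intertwine_grading hc hR (ε := 1) (A := 1) (by simp) hlo.symm, one_smul]

end Chiral

section Divisibility

variable {E : Type} [Fintype E] [DecidableEq E]

theorem exists_signature {l : ℕ} (hl : l % 4 = 1 ∨ l % 4 = 2)
    {F : Fin (2 * l + 1) → Matrix E E ℂ} {σ : Matrix E E ℂ} (hF : IsChiral F σ)
    (hdet : ∀ z : Fin (2 * l + 1) → ℝ, z ≠ 0 → (∑ i, (z i : ℂ) • F i).det ≠ 0) :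
    ∃ D w : ℕ, (2 : ℂ) ^ (2 * l) * (Fintype.card E * 2 ^ l * D - 8 * w) =
      Fintype.card E * 2 ^ l * (2 - 2 ^ (2 * l)) := by
  obtain ⟨S, _, _, c, γ, U, hc⟩ := exists_isClifford l
  obtain ⟨α, hα0, hα1, hα⟩ := exists_le_mul_self hF.starF hdet
  set f : Fin (2 * l) → Matrix (E × S) (E × S) ℂ := fun i => F i.castSucc ⊗ₖ 1 with hf
  set N : Matrix (E × S) (E × S) ℂ := F (Fin.last _) ⊗ₖ 1 with hN
  have hfr := hF.isFrame hc
  have hlow (z : Fin (2 * l) → ℝ) (y : ℝ) : ((α * (∑ i, z i ^ 2 + y ^ 2) : ℝ) : ℂ) • 1 ≤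
      (∑ i, (z i : ℂ) • f i + (y : ℂ) • N) * (∑ i, (z i : ℂ) • f i + (y : ℂ) • N) := by
    have h := kron_one_mono (V := S) (hα (Fin.snoc z y))
    rw [Matrix.smul_kronecker, Matrix.one_kronecker_one,
      ← mul_one (1 : Matrix S S ℂ), Matrix.mul_kronecker_mul] at h
    simpa only [Fin.sum_univ_castSucc, Fin.snoc_castSucc, Fin.snoc_last, hf, hN,
      Matrix.smul_kronecker, Matrix.add_kronecker, sum_kron] using h
  obtain ⟨J₁, h₁⟩ := exists_twisted_trace hfr.zero hα0 hα1 fun z => by simpa using hlow z 0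
  obtain ⟨J₂, h₂⟩ := exists_det_ne_zero hfr hα0 hα1 hlow
  set j := 2 * (J₁ + J₂) + 1 with hj
  obtain ⟨hj0, hpath⟩ := h₂ j (by omega)
  have htr := h₁ j (by omega) (odd_two_mul_add_one _)
  have hM := spinFamily_mode (2 * l) j hj0
  set H := ham f (fun i => σ ⊗ₖ c i) (σ ⊗ₖ γ) 0 (modeX (2 * l) j) (modeY _ j) (modeZ _ j)
    ((1 / 2 : ℝ) : ℂ) with hH
  set G := (σ ⊗ₖ γ) ⊗ₖ modeR (2 * l) j with hG
  have hRs : (modeR (2 * l) j)ᴴ = modeR (2 * l) j := hM.starR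
  have hGs : G.IsHermitian := by
    rw [Matrix.IsHermitian, hG, Matrix.conjTranspose_kronecker, hfr.starΓ, hRs]
  have hGG : G * G = 1 := by
    rw [hG, ← Matrix.mul_kronecker_mul, hfr.sqΓ, hM.mulRR, Matrix.one_kronecker_one]
  have hGH : G * H = H * G := grading_mul_ham hfr.zero hM rfl
  have hHs : H.IsHermitian := ham_isHermitian hfr.zero hM (by simp)
  have hNh : (N ⊗ₖ (1 : Matrix (Fin (2 * l) → Fin (2 * j + 1)) _ ℂ)).IsHermitian := by
    rw [Matrix.IsHermitian, Matrix.conjTranspose_kronecker, hfr.starN, Matrix.conjTranspose_one]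
  have hNG : (N ⊗ₖ (1 : Matrix (Fin (2 * l) → Fin (2 * j + 1)) _ ℂ)) * G = -(G * N ⊗ₖ 1) := by
    have h := hfr.antiNΓ
    rw [← hN] at h
    rw [hG, ← Matrix.mul_kronecker_mul, h, neg_kron, one_mul]
    refine congrArg Neg.neg ?_
    conv_rhs => rw [← Matrix.mul_kronecker_mul, mul_one]
  obtain ⟨T, hT, -⟩ := exists_isSign hHs (by simpa using hpath 0 (by simp))
  have hT0 := trace_sign_zero_of_path hHs hNh hGs hGG hNG hpath hT
  have hG0 : G.trace = 0 := by
    rw [hG, Matrix.trace_kronecker, Matrix.trace_kronecker, hc.grading_trace (by omega), mul_zero,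
      zero_mul]
  have hGT := hT.mul_involution hGs hGG hGH
  have hcut := hT.cutoff hGs hGG hGH
  obtain ⟨w, hw⟩ := trace_mul_sign_of_det_pos hT hGs hGG hGH hT0 hG0
    (hF.det_cutoff_pos hc hl hH hG hpath hHs hGs hGG hGH hcut.isHermitian_right hcut.det_ne_zero) hGT
  refine ⟨(2 * j + 1) ^ (2 * l), w, ?_⟩
  have h := htr _ hGT
  rw [hw] at h
  simp only [Fintype.card_prod, hc.card, Fintype.card_pi, Fintype.card_fin, Finset.prod_const,
    Finset.card_univ] at h
  exact_mod_cast h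

end Divisibility

section Real

variable {ι κ κ' : Type} [Fintype ι] [DecidableEq ι] [Fintype κ] [Fintype κ']

/-- Every nontrivial real combination of the family is nonsingular. -/
def IsNonsingular (M : κ → Matrix ι ι ℝ) : Prop :=
  ∀ z : κ → ℝ, z ≠ 0 → (∑ i, z i • M i).det ≠ 0

theorem IsNonsingular.comp {M : κ → Matrix ι ι ℝ} (hM : IsNonsingular M) {e : κ' → κ}
    (he : Function.Injective e) : IsNonsingular fun i => M (e i) := by
  intro z hz
  have h := hM (Function.extend e z 0) fun h0 => hz <| by
    funext i
    simpa [he.extend_apply] using congrFun h0 (e i)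
  rwa [← Fintype.sum_of_injective e he (fun i => z i • M (e i))] at h
  · intro i hi
    rw [Function.extend_apply' _ _ _ (by simpa using hi), Pi.zero_apply, zero_smul]
  · intro i
    rw [he.extend_apply]

/-- The symmetric matrix with off-diagonal block `A`. -/
def symBlock (A : Matrix ι ι ℝ) : Matrix (ι ⊕ ι) (ι ⊕ ι) ℝ := Matrix.fromBlocks 0 Aᵀ A 0

theorem det_symBlock_ne_zero {A : Matrix ι ι ℝ} (hA : A.det ≠ 0) : (symBlock A).det ≠ 0 := by
  have h : symBlock A * Matrix.fromBlocks 0 1 1 0 = Matrix.fromBlocks Aᵀ 0 0 A := by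
    simp [symBlock, Matrix.fromBlocks_multiply]
  have h' := congrArg Matrix.det h
  rw [Matrix.det_mul, Matrix.det_fromBlocks_zero₂₁, Matrix.det_transpose] at h'
  exact left_ne_zero_of_mul (h'.trans_ne (mul_ne_zero hA hA))

theorem isChiral_symBlock (M : κ → Matrix ι ι ℝ) :
    IsChiral (fun i => (symBlock (M i)).map Complex.ofReal)
      (Matrix.fromBlocks (1 : Matrix ι ι ℂ) 0 0 (-1)) := by
  have ht (A : Matrix ι ι ℝ) : (symBlock A)ᵀ = symBlock A := by
    simp [symBlock, Matrix.fromBlocks_transpose]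
  refine ⟨fun i => ?_, fun i => ?_, ?_, ?_, ?_, fun i => ?_⟩
  · ext a b
    simpa using congrArg Complex.ofReal (congrFun (congrFun (ht (M i)) a) b)
  · rw [← Matrix.transpose_map, ht]
  · simp [Matrix.fromBlocks_conjTranspose]
  · simp [Matrix.fromBlocks_transpose]
  · simp [Matrix.fromBlocks_multiply]
  · simp [symBlock, Matrix.fromBlocks_map, Matrix.fromBlocks_multiply, Matrix.fromBlocks_neg]

theorem IsNonsingular.two_pow_dvd {l : ℕ} (hl : l % 4 = 1 ∨ l % 4 = 2)
    {M : Fin (2 * l + 1) → Matrix ι ι ℝ} (hM : IsNonsingular M) :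
    2 ^ (l + 1) ∣ Fintype.card ι := by
  obtain ⟨D, w, h⟩ := exists_signature hl (isChiral_symBlock M) fun z hz => by
    have h1 : ∑ i, (z i : ℂ) • (symBlock (M i)).map Complex.ofReal =
        Complex.ofRealHom.mapMatrix (symBlock (∑ i, z i • M i)) := by
      ext (a | a) (b | b) <;> simp [symBlock, Matrix.sum_apply]
    rw [h1, ← RingHom.map_det]
    exact Complex.ofReal_ne_zero.mpr (det_symBlock_ne_zero (hM z hz))
  obtain ⟨k, rfl⟩ : ∃ k, l = k + 1 := ⟨l - 1, by omega⟩
  set n := Fintype.card ι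
  have h2 : (n : ℂ) * (2 * (2 ^ (2 * k) * (D + 1)) - 1) = 2 ^ (k + 2) * w := by
    rw [Fintype.card_sum] at h
    push_cast at h
    have hk : (2 : ℂ) ^ (k + 3) ≠ 0 := pow_ne_zero _ two_ne_zero
    refine mul_left_cancel₀ hk ?_
    linear_combination h
  have h3 : (n : ℤ) * (2 * (2 ^ (2 * k) * (D + 1)) - 1) = 2 ^ (k + 2) * w := by exact_mod_cast h2
  have hco : IsCoprime ((2 : ℤ) ^ (k + 2)) (2 * (2 ^ (2 * k) * (D + 1)) - 1) :=
    IsCoprime.pow_left ⟨2 ^ (2 * k) * (D + 1), -1, by ring⟩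
  have h4 := hco.dvd_of_dvd_mul_right (Dvd.intro _ h3.symm)
  exact_mod_cast h4

theorem det_gram_ne_zero {a b : Matrix ι ι ℝ} (h : a.det ≠ 0 ∨ b.det ≠ 0) :
    (aᵀ * a + bᵀ * b).det ≠ 0 := by
  have hsemi (c : Matrix ι ι ℝ) : (cᵀ * c).PosSemidef := by
    have := Matrix.posSemidef_conjTranspose_mul_self c
    rwa [Matrix.conjTranspose_eq_transpose_of_trivial] at this
  have hdef {c : Matrix ι ι ℝ} (hc : c.det ≠ 0) : (cᵀ * c).PosDef := by
    rw [(hsemi c).posDef_iff_isUnit, Matrix.isUnit_iff_isUnit_det, Matrix.det_mul,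
      Matrix.det_transpose]
    exact (mul_ne_zero hc hc).isUnit
  rcases h with h | h
  · exact ((hdef h).add_posSemidef (hsemi b)).det_pos.ne'
  · exact (Matrix.PosDef.posSemidef_add (hsemi a) (hdef h)).det_pos.ne'

theorem det_quaternion_ne_zero {a b : Matrix ι ι ℝ} (hab : a * b = b * a)
    (h : a.det ≠ 0 ∨ b.det ≠ 0) : (Matrix.fromBlocks a (-bᵀ) b aᵀ).det ≠ 0 := by
  set T := Matrix.fromBlocks a (-bᵀ) b aᵀ with hT
  have hab' : aᵀ * bᵀ = bᵀ * aᵀ := by rw [← Matrix.transpose_mul, ← Matrix.transpose_mul, hab]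
  have h1 : Tᵀ * T = Matrix.fromBlocks (aᵀ * a + bᵀ * b) 0 0 (aᵀᵀ * aᵀ + bᵀᵀ * bᵀ) := by
    rw [hT, Matrix.fromBlocks_transpose, Matrix.fromBlocks_multiply]
    simp [hab, hab', add_comm]
  have h2 := congrArg Matrix.det h1
  rw [Matrix.det_mul, Matrix.det_fromBlocks_zero₂₁] at h2
  refine right_ne_zero_of_mul (h2.trans_ne (mul_ne_zero (det_gram_ne_zero h) (det_gram_ne_zero ?_)))
  rwa [Matrix.det_transpose, Matrix.det_transpose]

/-- Two copies of a nonsingular family, acting on a tensor square. -/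
def doubling (M : κ → Matrix ι ι ℝ) :
    κ ⊕ κ → Matrix ((ι × ι) ⊕ (ι × ι)) ((ι × ι) ⊕ (ι × ι)) ℝ :=
  Sum.elim (fun i => Matrix.fromBlocks (M i ⊗ₖ 1) 0 0 (M i ⊗ₖ 1)ᵀ)
    fun i => Matrix.fromBlocks 0 (-(1 ⊗ₖ M i)ᵀ) (1 ⊗ₖ M i) 0

theorem IsNonsingular.doubling {M : κ → Matrix ι ι ℝ} (hM : IsNonsingular M) :
    IsNonsingular (doubling M) := by
  intro z hz
  set A := ∑ i, z (Sum.inl i) • M i with hA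
  set B := ∑ i, z (Sum.inr i) • M i with hB
  have h : ∑ i, z i • RadonHurwitz.doubling M i = Matrix.fromBlocks (A ⊗ₖ (1 : Matrix ι ι ℝ))
      (-(1 ⊗ₖ B)ᵀ) (1 ⊗ₖ B) (A ⊗ₖ 1)ᵀ := by
    ext (⟨a, a'⟩ | ⟨a, a'⟩) (⟨b, b'⟩ | ⟨b, b'⟩) <;>
      simp [RadonHurwitz.doubling, Matrix.sum_apply, hA, hB, Finset.sum_mul, Finset.mul_sum, mul_assoc,
        mul_left_comm]
  rw [h]
  refine det_quaternion_ne_zero ?_ ?_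
  · rw [← Matrix.mul_kronecker_mul, ← Matrix.mul_kronecker_mul, mul_one, one_mul, one_mul, mul_one]
  · rw [Matrix.det_kronecker, Matrix.det_kronecker, Matrix.det_one, one_pow, mul_one, one_mul]
    by_cases hz1 : (fun i => z (Sum.inl i)) = 0
    · refine Or.inr (pow_ne_zero _ (hM _ fun hz2 => hz ?_))
      funext i
      rcases i with i | i
      exacts [congrFun hz1 i, congrFun hz2 i]
    · exact Or.inl (pow_ne_zero _ (hM _ hz1))

theorem IsNonsingular.two_pow_dvd_two_mul_sq {q : ℕ} {M : Fin (8 * q + 2) → Matrix ι ι ℝ}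
    (hM : IsNonsingular M) : 2 ^ (8 * q + 2) ∣ 2 * Fintype.card ι ^ 2 := by
  have h := ((hM.doubling.comp finSumFinEquiv.symm.injective).comp
    (Fin.castLE_injective (show 2 * (8 * q + 1) + 1 ≤ _ by omega))).two_pow_dvd (by omega)
  rw [Fintype.card_sum, Fintype.card_prod, ← two_mul, ← pow_two] at h
  exact h

theorem IsNonsingular.two_pow_dvd_eight_mul_pow {q : ℕ} {M : Fin (8 * q + 9) → Matrix ι ι ℝ}
    (hM : IsNonsingular M) : 2 ^ (16 * q + 18) ∣ 8 * Fintype.card ι ^ 4 := by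
  have h := ((hM.doubling.comp finSumFinEquiv.symm.injective).comp
    (Fin.castLE_injective (show 8 * (2 * q + 2) + 2 ≤ _ by omega))).two_pow_dvd_two_mul_sq
  rw [Fintype.card_sum, Fintype.card_prod] at h
  convert h using 1 <;> ring

theorem le_of_two_pow_dvd {a b t : ℕ} (ht : Odd t) (h : 2 ^ a ∣ 2 ^ b * t) : a ≤ b :=
  (Nat.pow_dvd_pow_iff_le_right (by norm_num)).mp
    (((Nat.coprime_two_left.mpr ht).pow_left a).dvd_of_dvd_mul_right h)

end Real

end RadonHurwitz

/-- Write `m = 2^(4q+r) s` with `s` odd and `0 ≤ r ≤ 3`.  If `n' > 8q + 2^r`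
(the Radon–Hurwitz number of `m`), then for any real `m×m` matrices `M₁, …, M_{n'}` some
nontrivial linear combination of them is singular. -/
theorem singular_combination_beyond_radon_hurwitz (m q r s n' : ℕ)
    (hm1 : 1 ≤ m) (hr : r ≤ 3) (hs : Odd s) (hm : m = 2 ^ (4 * q + r) * s)
    (hn' : 8 * q + 2 ^ r < n')
    (M : Fin n' → Matrix (Fin m) (Fin m) ℝ) :
    ∃ l : Fin n' → ℝ, l ≠ 0 ∧ (∑ i, l i • M i).det = 0 := by
  by_contra! hM
  replace hM : RadonHurwitz.IsNonsingular M := hM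
  interval_cases r
  · have h := (hM.comp (Fin.castLE_injective (show 8 * q + 2 ≤ n' by omega))).two_pow_dvd_two_mul_sq
    rw [Fintype.card_fin, hm, show 2 * (2 ^ (4 * q + 0) * s) ^ 2 = 2 ^ (8 * q + 1) * s ^ 2 by ring]
      at h
    have := RadonHurwitz.le_of_two_pow_dvd hs.pow h
    omega
  · have h := (hM.comp (Fin.castLE_injective (show 2 * (4 * q + 1) + 1 ≤ n' by omega))).two_pow_dvd
      (by omega)
    rw [Fintype.card_fin, hm] at h
    have := RadonHurwitz.le_of_two_pow_dvd hs h
    omega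
  · have h := (hM.comp (Fin.castLE_injective (show 2 * (4 * q + 2) + 1 ≤ n' by omega))).two_pow_dvd
      (by omega)
    rw [Fintype.card_fin, hm] at h
    have := RadonHurwitz.le_of_two_pow_dvd hs h
    omega
  · have h := (hM.comp (Fin.castLE_injective
      (show 8 * q + 9 ≤ n' by omega))).two_pow_dvd_eight_mul_pow
    rw [Fintype.card_fin, hm, show 8 * (2 ^ (4 * q + 3) * s) ^ 4 = 2 ^ (16 * q + 15) * s ^ 4 by ring]
      at h
    have := RadonHurwitz.le_of_two_pow_dvd hs.pow h
    omega
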